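/- Let f ∈ ℤ[X] be monic of degree n ≥ 1 and irreducible over ℚ, let L be the splitting field of f over ℚ, and let G = Gal(L/ℚ) act on the set R of roots of f in L. For a multiset π of positive integers with sum n, let c_π be the proportion of elements σ ∈ G for which the multiset of sizes of the orbits of the cyclic group generated by σ acting on R equals π (equivalently, the cycle type of σ as a permutation of the n roots, counting fixed points as parts of size 1, is π). Then the natural density of the set of primes p such that the reduction of f modulo p is squarefree and the multiset of degrees of its monic irreducible factors over ℤ/pℤ equals π exists and equals c_π; that is, #{p ≤ N prime : the factorization condition holds} divided by #{p ≤ N prime} tends to c_π as N → ∞. -/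

import Mathlib

namespace FrobeniusDensity

section HolomorphicIntegral

open MeasureTheory Set Metric

/-- A dominated integral of functions holomorphic in a parameter is holomorphic. -/
theorem differentiableOn_integral_of_dominated {α : Type*} [MeasurableSpace α] {μ : Measure α}
    {f : ℂ → α → ℂ} {U : Set ℂ} (hU : IsOpen U)
    (hd : ∀ x, DifferentiableOn ℂ (fun s ↦ f s x) U)
    (hm : ∀ s ∈ U, AEStronglyMeasurable (f s) μ)
    (hb : ∀ s₀ ∈ U, ∃ ε > 0, ∃ g : α → ℝ, Integrable g μ ∧ ∀ s ∈ ball s₀ ε, ∀ x, ‖f s x‖ ≤ g x) :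
    DifferentiableOn ℂ (fun s ↦ ∫ x, f s x ∂μ) U := by
  intro s₀ hs₀
  obtain ⟨ε, hε, g, hg, hfg⟩ := hb s₀ hs₀
  obtain ⟨δ, hδ, hδU⟩ := Metric.isOpen_iff.mp hU s₀ hs₀
  set r := min ε δ with hr
  have hr0 : 0 < r := lt_min hε hδ
  have hrU : ball s₀ r ⊆ U := (ball_subset_ball (min_le_right _ _)).trans hδU
  have hder : ∀ x, ∀ s ∈ ball s₀ (r / 2), ‖deriv (fun s ↦ f s x) s‖ ≤ g x / (r / 4) := by
    intro x s hs
    have hsub : closedBall s (r / 4) ⊆ ball s₀ r := by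
      intro z hz
      rw [mem_closedBall] at hz
      rw [mem_ball] at hs ⊢
      linarith [dist_triangle z s s₀]
    refine Complex.norm_deriv_le_of_forall_mem_sphere_norm_le (by positivity) ?_ fun z hz ↦ ?_
    · refine DifferentiableOn.diffContOnCl ?_
      refine (hd x).mono ((closure_ball_subset_closedBall).trans (hsub.trans hrU))
    · exact hfg z (ball_subset_ball (min_le_left _ _) (hsub (sphere_subset_closedBall hz))) x
  have hU' : U ∈ nhds s₀ := hU.mem_nhds hs₀
  have hmeas : AEStronglyMeasurable (fun x ↦ deriv (fun s ↦ f s x) s₀) μ := by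
    obtain ⟨u, hu, hu'⟩ : ∃ u : ℕ → ℝ, (∀ n, 0 < u n ∧ u n < r) ∧
        Filter.Tendsto u Filter.atTop (nhds 0) := by
      obtain ⟨u, _, hu, hu'⟩ := exists_seq_strictAnti_tendsto' hr0
      exact ⟨u, hu, hu'⟩
    have hmem : ∀ n, s₀ + (u n : ℂ) ∈ U := fun n ↦ hrU (by
      simp [abs_of_pos (hu n).1, (hu n).2])
    refine aestronglyMeasurable_of_tendsto_ae Filter.atTop
      (f := fun n x ↦ (u n : ℂ)⁻¹ • (f (s₀ + u n) x - f s₀ x)) (fun n ↦ ?_) ?_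
    · exact ((hm _ (hmem n)).sub (hm _ hs₀)).const_smul ((u n : ℂ)⁻¹)
    · refine Filter.Eventually.of_forall fun x ↦ ?_
      have h1 := ((hd x).differentiableAt hU').hasDerivAt.tendsto_slope_zero
      refine h1.comp (tendsto_nhdsWithin_iff.mpr ⟨?_, ?_⟩)
      · exact_mod_cast (Complex.continuous_ofReal.tendsto 0).comp hu'
      · exact Filter.Eventually.of_forall fun n ↦ by simpa using (hu n).1.ne'
  refine (hasDerivAt_integral_of_dominated_loc_of_deriv_le (F := f)
    (F' := fun s x ↦ deriv (fun s ↦ f s x) s) (bound := fun x ↦ g x / (r / 4))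
    (ball_mem_nhds s₀ (half_pos hr0)) ?_ ?_ hmeas ?_ ?_ ?_).2.differentiableAt
      |>.differentiableWithinAt
  · filter_upwards [hU'] with s hs using hm s hs
  · exact hg.mono' (hm _ hs₀) (Filter.Eventually.of_forall (hfg s₀ (mem_ball_self hε)))
  · exact Filter.Eventually.of_forall hder
  · exact hg.div_const _
  · refine Filter.Eventually.of_forall fun x s hs ↦ ?_
    exact ((hd x).differentiableAt (hU.mem_nhds
      (hrU (ball_subset_ball (by linarith) hs)))).hasDerivAt

end HolomorphicIntegral

section HomogeneousWeight

open MeasureTheory Set Metric Module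

variable {V : Type*} [NormedAddCommGroup V] [NormedSpace ℝ V]

/-- A bounded weight `w`, homogeneous of degree zero, together with a size function `N`,
homogeneous of degree `dim V`, both varying slowly at infinity. -/
structure IsHomogeneousWeight [MeasurableSpace V] (w N : V → ℝ) : Prop where
  measurable_weight : Measurable w
  measurable_size : Measurable N
  weight_nonneg : ∀ x, 0 ≤ w x
  weight_le_one : ∀ x, w x ≤ 1
  weight_smul : ∀ (t : ℝ) (x : V), 0 < t → w (t • x) = w x
  size_smul : ∀ (t : ℝ) (x : V), 0 < t → N (t • x) = t ^ finrank ℝ V * N x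
  slow : ∀ δ : ℝ, ∃ c C R : ℝ, 0 < c ∧ 0 < R ∧ ∀ x y, R ≤ ‖x‖ → ‖x - y‖ ≤ δ →
    (w x = 0 ∧ w y = 0) ∨ (c * ‖x‖ ^ finrank ℝ V ≤ N x ∧ c * ‖x‖ ^ finrank ℝ V ≤ N y ∧
      |Real.log (N y) - Real.log (N x)| ≤ C / ‖x‖ ∧ |w y - w x| ≤ C / ‖x‖)

namespace IsHomogeneousWeight

variable [MeasurableSpace V] {w N : V → ℝ}

/-- The measure on `ℝ` obtained by pushing forward the weight along the size. -/
noncomputable def sizeMeasure (μ : Measure V) (w N : V → ℝ) : Measure ℝ :=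
  (μ.withDensity fun x ↦ ENNReal.ofReal (w x)).map N

variable {μ : Measure V}

theorem sizeMeasure_apply (h : IsHomogeneousWeight w N) {s : Set ℝ} (hs : MeasurableSet s) :
    sizeMeasure μ w N s = ∫⁻ x in N ⁻¹' s, ENNReal.ofReal (w x) ∂μ := by
  rw [sizeMeasure, Measure.map_apply h.measurable_size hs,
    withDensity_apply _ (h.measurable_size hs)]

/-- The function summed over the lattice. -/
noncomputable def term (w N : V → ℝ) (s : ℂ) (x : V) : ℂ := w x * (N x : ℂ) ^ (-s)

/-- The part of `term` supported on points of size larger than one. -/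
noncomputable def truncTerm (w N : V → ℝ) (s : ℂ) (x : V) : ℂ :=
  (N ⁻¹' Ioi 1).indicator (term w N s) x

theorem measurable_term (h : IsHomogeneousWeight w N) (s : ℂ) : Measurable (term w N s) :=
  (Complex.measurable_ofReal.comp h.measurable_weight).mul
    ((Complex.measurable_ofReal.comp h.measurable_size).pow_const _)

theorem measurable_truncTerm (h : IsHomogeneousWeight w N) (s : ℂ) :
    Measurable (truncTerm w N s) :=
  (h.measurable_term s).indicator (h.measurable_size measurableSet_Ioi)

variable [BorelSpace V] [FiniteDimensional ℝ V] [μ.IsAddHaarMeasure]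

theorem sizeMeasure_Iic [Nontrivial V] (h : IsHomogeneousWeight w N) {T : ℝ} (hT : 0 < T) :
    sizeMeasure μ w N (Iic T) = ENNReal.ofReal T * sizeMeasure μ w N (Iic 1) := by
  rw [h.sizeMeasure_apply measurableSet_Iic, h.sizeMeasure_apply measurableSet_Iic]
  set n := finrank ℝ V
  have hn : n ≠ 0 := finrank_pos.ne'
  set t := T ^ (n : ℝ)⁻¹
  have ht : 0 < t := by positivity
  have htn : t ^ n = T := Real.rpow_inv_natCast_pow hT.le hn
  have hm : Measurable (fun x ↦ ENNReal.ofReal (w x)) := h.measurable_weight.ennreal_ofReal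
  have key : ∫⁻ x in N ⁻¹' Iic 1, ENNReal.ofReal (w x) ∂μ
      = ENNReal.ofReal T⁻¹ * ∫⁻ x in N ⁻¹' Iic T, ENNReal.ofReal (w x) ∂μ := by
    rw [← lintegral_indicator (h.measurable_size measurableSet_Iic),
      ← lintegral_indicator (h.measurable_size measurableSet_Iic)]
    have h1 : ∀ x, (N ⁻¹' Iic 1).indicator (fun x ↦ ENNReal.ofReal (w x)) x
        = (N ⁻¹' Iic T).indicator (fun x ↦ ENNReal.ofReal (w x)) (t • x) := by
      intro x
      simp only [indicator, mem_preimage, mem_Iic, h.weight_smul t x ht, h.size_smul t x ht]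
      rw [show t ^ finrank ℝ V = T from htn]
      congr 1
      rw [mul_le_iff_le_one_right hT]
    simp_rw [h1]
    rw [← lintegral_map (f := (N ⁻¹' Iic T).indicator (fun x ↦ ENNReal.ofReal (w x)))
      (g := (t • ·)) (hm.indicator (h.measurable_size measurableSet_Iic))
      (measurable_const_smul t), Measure.map_addHaar_smul μ ht.ne', lintegral_smul_measure,
      show t ^ finrank ℝ V = T from htn, abs_of_pos (by positivity)]
    rfl
  rw [key, ← mul_assoc, ← ENNReal.ofReal_mul hT.le, mul_inv_cancel₀ hT.ne', ENNReal.ofReal_one,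
    one_mul]

theorem sizeMeasure_Iic_one_ne_top [Nontrivial V] (h : IsHomogeneousWeight w N) :
    sizeMeasure μ w N (Iic 1) ≠ ⊤ := by
  obtain ⟨c, C, R, hc, hR, hcR⟩ := h.slow 0
  rw [h.sizeMeasure_apply measurableSet_Iic]
  have hn : 0 < finrank ℝ V := finrank_pos
  set ρ := max R (max 1 c⁻¹)
  have hbound : ∀ x ∈ N ⁻¹' Iic 1, ENNReal.ofReal (w x) ≤
      (closedBall (0 : V) ρ).indicator 1 x := by
    intro x hx
    by_cases hxρ : x ∈ closedBall (0 : V) ρ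
    · simpa [indicator_of_mem hxρ] using h.weight_le_one x
    · rw [indicator_of_notMem hxρ]
      have hx' : ρ < ‖x‖ := by simpa using hxρ
      have h1 : R ≤ ‖x‖ := (le_max_left _ _).trans hx'.le
      have h2 : 1 ≤ ‖x‖ := ((le_max_left _ _).trans (le_max_right _ _)).trans hx'.le
      have h3 : c⁻¹ < ‖x‖ := ((le_max_right _ _).trans (le_max_right _ _)).trans_lt hx'
      rcases hcR x x h1 (by simp) with h0 | h0
      · simp [h0.1]
      · exfalso
        have h4 : ‖x‖ ≤ ‖x‖ ^ finrank ℝ V := le_self_pow₀ h2 hn.ne'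
        have h5 : c * c⁻¹ < c * ‖x‖ := by gcongr
        rw [mul_inv_cancel₀ hc.ne'] at h5
        have h6 : c * ‖x‖ ≤ c * ‖x‖ ^ finrank ℝ V := by gcongr
        have : N x ≤ 1 := hx
        linarith [h0.1]
  refine ne_top_of_le_ne_top ?_ (setLIntegral_mono'
    (h.measurable_size measurableSet_Iic) hbound)
  refine ne_top_of_le_ne_top ?_ (setLIntegral_le_lintegral _ _)
  rw [lintegral_indicator_one measurableSet_closedBall]
  exact measure_closedBall_lt_top.ne

/-- The residue attached to a weight. -/
noncomputable def residue (μ : Measure V) (w N : V → ℝ) : ℝ :=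
  (sizeMeasure μ w N (Iic 1)).toReal

theorem sizeMeasure_restrict [Nontrivial V] (h : IsHomogeneousWeight w N) :
    (sizeMeasure μ w N).restrict (Ioi 1)
      = ENNReal.ofReal (residue μ w N) • (volume : Measure ℝ).restrict (Ioi 1) := by
  have hfin := h.sizeMeasure_Iic_one_ne_top (μ := μ)
  have key : ∀ a b : ℝ, (sizeMeasure μ w N).restrict (Ioi 1) (Ioc a b)
      = (ENNReal.ofReal (residue μ w N) • (volume : Measure ℝ).restrict (Ioi 1)) (Ioc a b) := by
    intro a b
    rw [Measure.smul_apply, Measure.restrict_apply measurableSet_Ioc,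
      Measure.restrict_apply measurableSet_Ioc, Ioc_inter_Ioi, Real.volume_Ioc]
    set a' := a ⊔ 1
    rw [residue, ENNReal.ofReal_toReal hfin, smul_eq_mul]
    rcases le_total b a' with hb | hb
    · rw [Ioc_eq_empty (not_lt.mpr hb), measure_empty, ENNReal.ofReal_of_nonpos (by linarith),
        mul_zero]
    · have ha' : 0 < a' := zero_lt_one.trans_le le_sup_right
      have hIoc : Ioc a' b = Iic b \ Iic a' := by
        ext x; simp [and_comm]
      rw [hIoc, measure_sdiff (Iic_subset_Iic.mpr hb) measurableSet_Iic.nullMeasurableSet,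
        h.sizeMeasure_Iic (ha'.trans_le hb), h.sizeMeasure_Iic ha',
        ENNReal.ofReal_sub _ ha'.le, mul_comm, mul_comm (ENNReal.ofReal a'), ← ENNReal.mul_sub]
      · exact fun _ _ ↦ hfin
      · rw [h.sizeMeasure_Iic ha']
        exact ENNReal.mul_ne_top ENNReal.ofReal_ne_top hfin
  refine Measure.ext_of_Ioc' _ _ (fun a b _ ↦ ?_) fun a b _ ↦ key a b
  rw [key, Measure.smul_apply, smul_eq_mul, Measure.restrict_apply measurableSet_Ioc,
    Ioc_inter_Ioi, Real.volume_Ioc]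
  exact ENNReal.mul_ne_top ENNReal.ofReal_ne_top ENNReal.ofReal_ne_top

theorem integrable_truncTerm [Nontrivial V] (h : IsHomogeneousWeight w N) {s : ℂ} (hs : 1 < s.re) :
    Integrable (truncTerm w N s) μ ∧
      ∫ x, truncTerm w N s x ∂μ = residue μ w N / (s - 1) := by
  have hms : MeasurableSet (N ⁻¹' Ioi 1) := h.measurable_size measurableSet_Ioi
  have hw : Measurable (fun x ↦ (w x).toNNReal) := h.measurable_weight.real_toNNReal
  have e1 : ∀ x, truncTerm w N s x
      = (w x).toNNReal • ((Ioi (1 : ℝ)).indicator (fun t : ℝ ↦ (t : ℂ) ^ (-s)) (N x)) := by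
    intro x
    by_cases hx : 1 < N x
    · simp [truncTerm, term, indicator, hx, NNReal.smul_def,
        Real.coe_toNNReal _ (h.weight_nonneg x)]
    · simp [truncTerm, indicator, hx]
  have h_int : Integrable ((Ioi (1 : ℝ)).indicator (fun t : ℝ ↦ (t : ℂ) ^ (-s)))
      (sizeMeasure μ w N) := by
    rw [integrable_indicator_iff measurableSet_Ioi, IntegrableOn, h.sizeMeasure_restrict]
    exact (integrableOn_Ioi_cpow_of_lt (by simpa using hs) zero_lt_one).smul_measure
      ENNReal.ofReal_ne_top
  have hd : (fun x ↦ ENNReal.ofReal (w x)) = fun x ↦ (((w x).toNNReal : NNReal) : ENNReal) := rfl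
  simp only [funext e1]
  constructor
  · rw [sizeMeasure, integrable_map_measure h_int.aestronglyMeasurable
      h.measurable_size.aemeasurable, hd, integrable_withDensity_iff_integrable_smul hw] at h_int
    exact h_int
  · have h2 := integral_withDensity_eq_integral_smul (μ := μ) hw
      (fun x ↦ (Ioi (1 : ℝ)).indicator (fun t : ℝ ↦ (t : ℂ) ^ (-s)) (N x))
    rw [← h2, ← hd, ← integral_map (μ := μ.withDensity fun x ↦ ENNReal.ofReal (w x))
      h.measurable_size.aemeasurable h_int.aestronglyMeasurable]
    change ∫ y, _ ∂(sizeMeasure μ w N) = _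
    rw [integral_indicator measurableSet_Ioi, h.sizeMeasure_restrict, integral_smul_measure,
      integral_Ioi_cpow_of_lt (by simpa using hs) zero_lt_one,
      ENNReal.toReal_ofReal (show 0 ≤ residue μ w N from ENNReal.toReal_nonneg)]
    have : s - 1 ≠ 0 := by
      intro h0
      have := congrArg Complex.re h0
      simp at this; linarith
    have h3 : -s + 1 ≠ 0 := by
      intro h0; apply this; linear_combination -h0
    simp
    field_simp
    ring

end IsHomogeneousWeight

end HomogeneousWeight

section LatticeSum

open MeasureTheory Set Metric Module

theorem norm_exp_sub_exp_le {a b : ℂ} {r : ℝ} (ha : a.re ≤ r) (hb : b.re ≤ r) :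
    ‖Complex.exp a - Complex.exp b‖ ≤ Real.exp r * ‖a - b‖ := by
  refine (convex_halfSpace_re_le r).norm_image_sub_le_of_norm_deriv_le (f := Complex.exp)
    (fun _ _ ↦ Complex.differentiableAt_exp) (fun z hz ↦ ?_) hb ha
  rw [Complex.deriv_exp, Complex.norm_exp]
  exact Real.exp_le_exp.mpr hz

theorem norm_cpow_neg_sub_cpow_neg_le {A x y σ : ℝ} {s : ℂ} (hA : 1 ≤ A) (hx : A ≤ x) (hy : A ≤ y)
    (hσ : σ ≤ s.re) (hσ0 : 0 ≤ σ) :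
    ‖(y : ℂ) ^ (-s) - (x : ℂ) ^ (-s)‖ ≤ A ^ (-σ) * (‖s‖ * |Real.log y - Real.log x|) := by
  have hx0 : 0 < x := by linarith
  have hy0 : 0 < y := by linarith
  have hre : ∀ z : ℝ, A ≤ z → ((Real.log z : ℂ) * -s).re ≤ Real.log A * -σ := by
    intro z hz
    have h1 : Real.log A ≤ Real.log z := Real.log_le_log (by linarith) hz
    have h2 : 0 ≤ Real.log A := Real.log_nonneg hA
    simp only [Complex.mul_re, Complex.ofReal_re, Complex.neg_re, Complex.ofReal_im, zero_mul,
      sub_zero]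
    nlinarith
  rw [Complex.cpow_def_of_ne_zero (by exact_mod_cast hy0.ne'),
    Complex.cpow_def_of_ne_zero (by exact_mod_cast hx0.ne'), ← Complex.ofReal_log hx0.le,
    ← Complex.ofReal_log hy0.le, Real.rpow_def_of_pos (by linarith)]
  refine (norm_exp_sub_exp_le (hre y hy) (hre x hx)).trans (le_of_eq ?_)
  rw [← sub_mul, norm_mul, norm_neg, ← Complex.ofReal_sub, Complex.norm_real, Real.norm_eq_abs]
  ring

namespace IsHomogeneousWeight

theorem differentiableAt_term {V : Type*} (w N : V → ℝ) {s : ℂ} (hs : s ≠ 0) (x : V) :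
    DifferentiableAt ℂ (fun s ↦ term w N s x) s := by
  unfold term
  exact (differentiableAt_id.neg.const_cpow (Or.inr (neg_ne_zero.mpr hs))).const_mul _

theorem differentiableAt_truncTerm {V : Type*} (w N : V → ℝ) {s : ℂ} (hs : s ≠ 0) (x : V) :
    DifferentiableAt ℂ (fun s ↦ truncTerm w N s x) s := by
  unfold truncTerm indicator
  split_ifs
  · exact differentiableAt_term w N hs x
  · exact differentiableAt_const _

variable {V : Type*} [NormedAddCommGroup V] [NormedSpace ℝ V] [MeasurableSpace V] {w N : V → ℝ}

theorem norm_term_le {s : ℂ} (h : IsHomogeneousWeight w N) (hs : 0 ≤ s.re) {x : V}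
    (hx : w x ≠ 0 → 1 ≤ N x) : ‖term w N s x‖ ≤ 1 := by
  by_cases hw : w x = 0
  · simp [term, hw]
  have h1 := hx hw
  rw [term, norm_mul, Complex.norm_real, Real.norm_of_nonneg (h.weight_nonneg x),
    Complex.norm_cpow_eq_rpow_re_of_pos (by linarith)]
  exact mul_le_one₀ (h.weight_le_one x) (by positivity)
    (Real.rpow_le_one_of_one_le_of_nonpos h1 (by simpa using hs))

theorem norm_truncTerm_le {s : ℂ} (h : IsHomogeneousWeight w N) (hs : 0 ≤ s.re) (x : V) :
    ‖truncTerm w N s x‖ ≤ 1 := by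
  by_cases hx : 1 < N x
  · rw [truncTerm, indicator_of_mem (by exact hx)]
    exact h.norm_term_le hs fun _ ↦ hx.le
  · rw [truncTerm, indicator_of_notMem (by exact hx)]
    simp

theorem exists_norm_term_sub_truncTerm_le [Nontrivial V] [FiniteDimensional ℝ V]
    (h : IsHomogeneousWeight w N) {φ : V → V} {δ : ℝ} (hφ : ∀ x, ‖x - φ x‖ ≤ δ)
    (hφN : ∀ x, w (φ x) ≠ 0 → 1 ≤ N (φ x)) {σ : ℝ} (hσ : 0 ≤ σ) (M : ℝ) :
    ∃ B : ℝ, ∀ s : ℂ, σ ≤ s.re → ‖s‖ ≤ M → ∀ x,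
      ‖term w N s (φ x) - truncTerm w N s x‖
        ≤ B * (1 + ‖x‖) ^ (-(finrank ℝ V * σ + 1) : ℝ) := by
  obtain ⟨c, C, R, hc, hR, hcR⟩ := h.slow δ
  set n := finrank ℝ V with hn
  have hn0 : 0 < n := finrank_pos
  set r : ℝ := n * σ + 1 with hr
  have hr0 : 0 < r := by positivity
  set R' := max R (c⁻¹ + 1) with hR'
  have hR'1 : c⁻¹ + 1 ≤ R' := le_max_right _ _
  have hc' : 0 < c⁻¹ := by positivity
  refine ⟨|C| * (1 + |M|) * c ^ (-σ) * 2 ^ r + 2 * (1 + R') ^ r, fun s hs hM x ↦ ?_⟩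
  have hs0 : 0 ≤ s.re := hσ.trans hs
  have hM0 : 0 ≤ M := (norm_nonneg s).trans hM
  have hx1 : 0 < 1 + ‖x‖ := by positivity
  have hpow : 0 < (1 + ‖x‖) ^ (-r) := by positivity
  rw [add_mul]
  rcases lt_or_ge ‖x‖ R' with hxR | hxR
  · have h1 : ‖term w N s (φ x) - truncTerm w N s x‖ ≤ 2 := by
      refine (norm_sub_le _ _).trans ?_
      linarith [h.norm_term_le hs0 (hφN x), h.norm_truncTerm_le hs0 x]
    have h2 : 1 ≤ (1 + R') ^ r * (1 + ‖x‖) ^ (-r) := by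
      rw [Real.rpow_neg hx1.le, ← div_eq_mul_inv, one_le_div (by positivity)]
      exact Real.rpow_le_rpow hx1.le (by linarith) hr0.le
    have h3 : 0 ≤ |C| * (1 + |M|) * c ^ (-σ) * 2 ^ r * (1 + ‖x‖) ^ (-r) := by positivity
    nlinarith
  · have h3 : 0 ≤ 2 * (1 + R') ^ r * (1 + ‖x‖) ^ (-r) := by
      have : 0 ≤ 1 + R' := by linarith
      positivity
    have hx0 : 1 < ‖x‖ := by linarith
    suffices h4 : ‖term w N s (φ x) - truncTerm w N s x‖ ≤
        |C| * (1 + |M|) * c ^ (-σ) * 2 ^ r * (1 + ‖x‖) ^ (-r) by linarith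
    rcases hcR x (φ x) ((le_max_left _ _).trans hxR) (hφ x) with ⟨h0, h0'⟩ | ⟨hNx, hNy, hlog, hw⟩
    · have h5 : truncTerm w N s x = 0 := by
        simp [truncTerm, indicator, term, h0]
      rw [h5]
      simp only [term, h0', Complex.ofReal_zero, zero_mul, sub_zero, norm_zero]
      positivity
    · set A := c * ‖x‖ ^ n with hA
      have hA1 : 1 < A := by
        have h5 : ‖x‖ ≤ ‖x‖ ^ n := le_self_pow₀ hx0.le hn0.ne'
        have h6 : c * (c⁻¹ + 1) ≤ c * ‖x‖ ^ n := by gcongr; linarith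
        rw [mul_add, mul_inv_cancel₀ hc.ne'] at h6
        linarith
      have hA0 : 0 < A := by linarith
      have e1 : truncTerm w N s x = term w N s x :=
        indicator_of_mem (show x ∈ N ⁻¹' Ioi (1 : ℝ) from hA1.trans_le hNx) _
      have e2 : term w N s (φ x) - term w N s x
          = ((w (φ x) - w x : ℝ) : ℂ) * (N (φ x) : ℂ) ^ (-s)
            + (w x : ℂ) * ((N (φ x) : ℂ) ^ (-s) - (N x : ℂ) ^ (-s)) := by
        simp only [term, Complex.ofReal_sub]; ring
      have hAσ : 0 < A ^ (-σ) := by positivity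
      have b1 : ‖((w (φ x) - w x : ℝ) : ℂ) * (N (φ x) : ℂ) ^ (-s)‖ ≤ |C| / ‖x‖ * A ^ (-σ) := by
        rw [norm_mul, Complex.norm_real, Real.norm_eq_abs,
          Complex.norm_cpow_eq_rpow_re_of_pos (hA0.trans_le hNy), Complex.neg_re]
        have h7 : C / ‖x‖ ≤ |C| / ‖x‖ := by gcongr; exact le_abs_self C
        have h8 : N (φ x) ^ (-s.re) ≤ A ^ (-σ) := by
          refine (Real.rpow_le_rpow_of_nonpos hA0 hNy (by linarith)).trans ?_
          exact Real.rpow_le_rpow_of_exponent_le hA1.le (by linarith)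
        exact mul_le_mul (hw.trans h7) h8
          (Real.rpow_nonneg (hA0.trans_le hNy).le _) (by positivity)
      have b2 : ‖(w x : ℂ) * ((N (φ x) : ℂ) ^ (-s) - (N x : ℂ) ^ (-s))‖
          ≤ A ^ (-σ) * (|M| * (|C| / ‖x‖)) := by
        rw [norm_mul, Complex.norm_real, Real.norm_of_nonneg (h.weight_nonneg x)]
        refine (mul_le_of_le_one_left (norm_nonneg _) (h.weight_le_one x)).trans ?_
        refine (norm_cpow_neg_sub_cpow_neg_le hA1.le hNx hNy hs hσ).trans ?_
        have h7 : C / ‖x‖ ≤ |C| / ‖x‖ := by gcongr; exact le_abs_self C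
        gcongr
        · exact hM.trans (le_abs_self M)
        · exact hlog.trans h7
      have e3 : A ^ (-σ) = c ^ (-σ) * ‖x‖ ^ (-(n * σ)) := by
        rw [hA, Real.mul_rpow hc.le (by positivity), ← Real.rpow_natCast ‖x‖ n,
          ← Real.rpow_mul (norm_nonneg x), mul_neg]
      have e4 : ‖x‖ ^ (-(n * σ)) / ‖x‖ = ‖x‖ ^ (-r) := by
        rw [hr, neg_add, Real.rpow_add (by linarith), Real.rpow_neg_one, div_eq_mul_inv]
      have b3 : ‖x‖ ^ (-r) ≤ 2 ^ r * (1 + ‖x‖) ^ (-r) := by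
        rw [Real.rpow_neg hx1.le, ← div_eq_mul_inv, ← Real.div_rpow zero_le_two hx1.le,
          Real.rpow_neg (norm_nonneg x), ← Real.inv_rpow (norm_nonneg x)]
        refine Real.rpow_le_rpow (by positivity) ?_ hr0.le
        rw [inv_le_iff_one_le_mul₀ (by linarith), div_mul_eq_mul_div, one_le_div hx1]
        linarith
      rw [e1, e2]
      calc _ ≤ |C| / ‖x‖ * A ^ (-σ) + A ^ (-σ) * (|M| * (|C| / ‖x‖)) :=
            (norm_add_le _ _).trans (add_le_add b1 b2)
        _ = |C| * (1 + |M|) * c ^ (-σ) * (‖x‖ ^ (-(n * σ)) / ‖x‖) := by rw [e3]; ring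
        _ ≤ |C| * (1 + |M|) * c ^ (-σ) * (2 ^ r * (1 + ‖x‖) ^ (-r)) := by
            rw [e4]; gcongr
        _ = _ := by ring

/-- The Dirichlet series attached to a slowly varying homogeneous weight on a lattice continues
beyond its line of convergence with at most a simple pole at `1`. -/
theorem exists_hasSum_lattice [Nontrivial V] [FiniteDimensional ℝ V] [BorelSpace V]
    (h : IsHomogeneousWeight w N) {ι : Type*} [Fintype ι] (b : Basis ι ℝ V)
    (hb : ∀ α ∈ Submodule.span ℤ (range b), w α ≠ 0 → 1 ≤ N α) :
    ∃ (κ : ℂ) (H : ℂ → ℂ), DifferentiableOn ℂ H {s | 1 - 1 / (finrank ℝ V : ℝ) < s.re} ∧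
      ∀ s : ℂ, 1 < s.re → HasSum (fun α : Submodule.span ℤ (range b) ↦ term w N s (α : V))
        (κ / (s - 1) + H s) := by
  set n := finrank ℝ V with hn
  have hn0 : 0 < n := finrank_pos
  let μ : Measure V := Measure.addHaar
  set φ : V → V := fun x ↦ (ZSpan.floor b x : V) with hφ
  set E : ℂ → V → ℂ := fun s x ↦ term w N s (φ x) - truncTerm w N s x with hE
  have hφm : Measurable φ := by
    have : φ = fun x ↦ ∑ i, (⌊b.repr x i⌋ : ℝ) • b i := by
      funext x
      change (ZSpan.floor b x : V) = _
      rw [← b.sum_repr (ZSpan.floor b x : V)]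
      simp [ZSpan.repr_floor_apply]
    rw [this]
    refine Finset.measurable_sum _ fun i _ ↦ ?_
    have hc : Measurable fun x ↦ b.repr x i :=
      ((b.coord i).continuous_of_finiteDimensional).measurable
    exact ((measurable_of_countable (fun k : ℤ ↦ (k : ℝ))).comp
      (Int.measurable_floor.comp hc)).smul_const _
  have hφδ : ∀ x, ‖x - φ x‖ ≤ ∑ i, ‖b i‖ := fun x ↦ ZSpan.norm_fract_le b x
  have hφN : ∀ x, w (φ x) ≠ 0 → 1 ≤ N (φ x) := fun x ↦ hb _ (ZSpan.floor b x).2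
  have hEm : ∀ s, Measurable (E s) := fun s ↦
    ((h.measurable_term s).comp hφm).sub (h.measurable_truncTerm s)
  set U : Set ℂ := {s | 1 - 1 / (n : ℝ) < s.re} with hU
  have hU0 : ∀ s ∈ U, 0 < s.re := by
    intro s hs
    have : 1 / (n : ℝ) ≤ 1 := by
      rw [div_le_one (by positivity)]; exact_mod_cast hn0
    have : 1 - 1 / (n : ℝ) < s.re := hs
    linarith
  have hdom : ∀ s₀ ∈ U, ∃ ε > 0, ∃ g : V → ℝ, Integrable g μ ∧
      ∀ s ∈ ball s₀ ε, ∀ x, ‖E s x‖ ≤ g x := by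
    intro s₀ hs₀
    have hs₀' : 1 - 1 / (n : ℝ) < s₀.re := hs₀
    set ε := (s₀.re - (1 - 1 / (n : ℝ))) / 2 with hε
    have hε0 : 0 < ε := by rw [hε]; linarith
    have h1n : 1 / (n : ℝ) ≤ 1 := by
      rw [div_le_one (by positivity)]; exact_mod_cast hn0
    have hσ : 0 ≤ s₀.re - ε := by rw [hε]; linarith
    obtain ⟨B, hB⟩ := h.exists_norm_term_sub_truncTerm_le hφδ hφN hσ (‖s₀‖ + ε)
    refine ⟨ε, hε0, _, (integrable_one_add_norm (μ := μ) (r := n * (s₀.re - ε) + 1) ?_).const_mul B,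
      fun s hs x ↦ hB s ?_ ?_ x⟩
    · have h2 : 1 - 1 / (n : ℝ) < s₀.re - ε := by rw [hε]; linarith
      have hnp : (0 : ℝ) < n := by exact_mod_cast hn0
      have h3 : (n : ℝ) * (1 - 1 / n) < n * (s₀.re - ε) := by gcongr
      rw [mul_sub, mul_one_div_cancel hnp.ne'] at h3
      rw [← hn]; linarith
    · have h4 := Complex.abs_re_le_norm (s - s₀)
      rw [mem_ball, dist_eq_norm] at hs
      rw [Complex.sub_re] at h4
      linarith [neg_abs_le (s.re - s₀.re)]
    · rw [mem_ball, dist_eq_norm] at hs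
      have := norm_add_le s₀ (s - s₀)
      rw [add_sub_cancel] at this
      linarith
  have hUo : IsOpen U := isOpen_lt continuous_const Complex.continuous_re
  have hEd : DifferentiableOn ℂ (fun s ↦ ∫ x, E s x ∂μ) U := by
    refine differentiableOn_integral_of_dominated hUo (fun x s hs ↦ ?_)
      (fun s _ ↦ (hEm s).aestronglyMeasurable) hdom
    have hs0 : s ≠ 0 := fun h0 ↦ by simpa [h0] using hU0 s hs
    exact ((differentiableAt_term w N hs0 (φ x)).sub
      (differentiableAt_truncTerm w N hs0 x)).differentiableWithinAt
  set v : ℝ := μ.real (ZSpan.fundamentalDomain b) with hv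
  have hv0 : v ≠ 0 := by
    rw [hv, measureReal_ne_zero_iff (ZSpan.fundamentalDomain_isBounded b).measure_lt_top.ne]
    exact ZSpan.measure_fundamentalDomain_ne_zero b
  refine ⟨(residue μ w N : ℂ) / v, fun s ↦ (∫ x, E s x ∂μ) / v, hEd.div_const _, fun s hs ↦ ?_⟩
  have hsU : s ∈ U := by
    have : 0 < 1 / (n : ℝ) := by positivity
    change 1 - 1 / (n : ℝ) < s.re
    linarith
  obtain ⟨hti, htv⟩ := h.integrable_truncTerm (μ := μ) hs
  have hEi : Integrable (E s) μ := by
    obtain ⟨ε, hε, g, hg, hgE⟩ := hdom s hsU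
    exact hg.mono' (hEm s).aestronglyMeasurable
      (Filter.Eventually.of_forall (hgE s (mem_ball_self hε)))
  have hGi : Integrable (fun x ↦ term w N s (φ x)) μ := by
    refine (hEi.add hti).congr (Filter.Eventually.of_forall fun x ↦ ?_)
    simp [hE]
  have hGv : ∫ x, term w N s (φ x) ∂μ = (∫ x, E s x ∂μ) + residue μ w N / (s - 1) := by
    rw [← htv, ← integral_add hEi hti]
    simp [hE]
  let S : Submodule.span ℤ (range b) → Set V := fun α ↦ φ ⁻¹' {(α : V)}
  have hSm : ∀ α, MeasurableSet (S α) := fun α ↦ hφm (measurableSet_singleton _)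
  have hSd : Pairwise (Function.onFun Disjoint S) := by
    intro α β hαβ
    refine Disjoint.preimage _ (disjoint_singleton.mpr ?_)
    exact fun h ↦ hαβ (Subtype.ext h)
  have hSu : ⋃ α, S α = univ := by
    refine eq_univ_of_forall fun x ↦ mem_iUnion.mpr ⟨ZSpan.floor b x, rfl⟩
  have hSv : ∀ α, μ.real (S α) = v := by
    intro α
    have : S α = (fun x ↦ x + -(α : V)) ⁻¹' ZSpan.fundamentalDomain b := by
      ext x
      simp only [S, φ, mem_preimage, mem_singleton_iff]
      rw [← ZSpan.fract_eq_self, ← sub_eq_add_neg]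
      rw [sub_eq_add_neg, ZSpan.fract_add_ZSpan b x (neg_mem α.2), ← sub_eq_add_neg,
        ZSpan.fract_apply]
      constructor
      · intro hx; rw [hx]
      · intro hx; exact sub_right_injective hx
    rw [this, Measure.real, measure_preimage_add_right]
    rfl
  have : Countable (Submodule.span ℤ (range b)) := inferInstance
  have hsum := hasSum_integral_iUnion (μ := μ) (f := fun x ↦ term w N s (φ x)) hSm hSd
    (by rw [hSu]; exact hGi.integrableOn)
  rw [hSu, setIntegral_univ, hGv] at hsum
  have hval : ∀ α, ∫ x in S α, term w N s (φ x) ∂μ = v * term w N s (α : V) := by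
    intro α
    rw [setIntegral_congr_fun (hSm α) (g := fun _ ↦ term w N s (α : V))
      (fun x (hx : φ x = α) ↦ by simp only [hx]), setIntegral_const, hSv]
    simp
  simp only [hval] at hsum
  have hvc : (v : ℂ) ≠ 0 := by exact_mod_cast hv0
  have := hsum.mul_left (v : ℂ)⁻¹
  simp only [inv_mul_cancel_left₀ hvc] at this
  convert! this using 1
  field_simp
  ring

end IsHomogeneousWeight

end LatticeSum

section UnitWeight

open scoped Classical
open NumberField NumberField.InfinitePlace NumberField.mixedEmbedding NumberField.Units
  NumberField.Units.dirichletUnitTheorem Module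

/-- The piecewise linear bump `max 0 (1 - |c|)`, whose integer translates sum to one. -/
noncomputable def tent (c : ℝ) : ℝ := max 0 (1 - |c|)

theorem tent_nonneg (c : ℝ) : 0 ≤ tent c := le_max_left _ _

theorem tent_le_one (c : ℝ) : tent c ≤ 1 := by
  unfold tent
  exact max_le zero_le_one (by linarith [abs_nonneg c])

theorem abs_lt_one_of_tent_ne_zero {c : ℝ} (h : tent c ≠ 0) : |c| < 1 := by
  by_contra! h1
  exact h (max_eq_left (by linarith))

theorem abs_tent_sub_tent_le (a b : ℝ) : |tent a - tent b| ≤ |a - b| := by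
  unfold tent
  refine (abs_max_sub_max_le_max _ _ _ _).trans ?_
  have h := abs_abs_sub_abs_le a b
  rw [sub_self, abs_zero, show 1 - |a| - (1 - |b|) = -(|a| - |b|) by ring, abs_neg]
  exact max_le (abs_nonneg _) h

theorem continuous_tent : Continuous tent := by
  unfold tent
  fun_prop

theorem sum_tent_add_intCast (c : ℝ) :
    ∑ k ∈ ({-⌊c⌋, -⌊c⌋ - 1} : Finset ℤ), tent (c + k) = 1 := by
  rw [Finset.sum_pair (by lia)]
  have h0 := Int.floor_le c
  have h1 := Int.lt_floor_add_one c
  unfold tent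
  push_cast
  rw [abs_of_nonneg (by linarith), abs_of_nonpos (by linarith), max_eq_right (by linarith),
    max_eq_right (by linarith)]
  ring

theorem tent_add_intCast_eq_zero {c : ℝ} {k : ℤ} (hk : k ∉ ({-⌊c⌋, -⌊c⌋ - 1} : Finset ℤ)) :
    tent (c + k) = 0 := by
  by_contra h
  have h2 := abs_lt.mp (abs_lt_one_of_tent_ne_zero h)
  have h0 := Int.floor_le c
  have h1 := Int.lt_floor_add_one c
  apply hk
  have h3 : ⌊c⌋ + k < 1 := by
    have : ((⌊c⌋ + k : ℤ) : ℝ) < (1 : ℤ) := by push_cast; linarith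
    exact_mod_cast this
  have h4 : -2 < ⌊c⌋ + k := by
    have : ((-2 : ℤ) : ℝ) < ((⌊c⌋ + k : ℤ) : ℝ) := by push_cast; linarith
    exact_mod_cast this
  simp only [Finset.mem_insert, Finset.mem_singleton]
  lia

theorem abs_prod_sub_prod_le_sum {ι : Type*} (s : Finset ι) (f g : ι → ℝ)
    (hf : ∀ i, |f i| ≤ 1) (hg : ∀ i, |g i| ≤ 1) :
    |∏ i ∈ s, f i - ∏ i ∈ s, g i| ≤ ∑ i ∈ s, |f i - g i| := by
  classical
  induction s using Finset.induction_on with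
  | empty => simp
  | insert a s ha ih =>
    rw [Finset.prod_insert ha, Finset.prod_insert ha, Finset.sum_insert ha]
    have h1 : |∏ i ∈ s, f i| ≤ 1 := by
      rw [Finset.abs_prod]
      exact Finset.prod_le_one (fun i _ ↦ abs_nonneg _) fun i _ ↦ hf i
    have e : f a * ∏ i ∈ s, f i - g a * ∏ i ∈ s, g i
        = (f a - g a) * ∏ i ∈ s, f i + g a * (∏ i ∈ s, f i - ∏ i ∈ s, g i) := by ring
    rw [e]
    refine (abs_add_le _ _).trans (add_le_add ?_ ?_)
    · rw [abs_mul]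
      exact mul_le_of_le_one_right (abs_nonneg _) h1
    · rw [abs_mul]
      exact (mul_le_of_le_one_left (abs_nonneg _) (hg a)).trans ih

variable (K : Type*) [Field K] [NumberField K]

/-- The real basis of the logarithmic space given by the system of fundamental units. -/
noncomputable abbrev logBasis : Basis (Fin (rank K)) ℝ (logSpace K) :=
  (basisUnitLattice K).ofZLatticeBasis ℝ _

/-- A compactly supported function on the logarithmic space, whose translates by the lattice of
units sum to one. -/
noncomputable def logBump (y : logSpace K) : ℝ := ∏ i, tent ((logBasis K).repr y i)

variable {K} in
/-- A smoothing of the indicator of the fundamental cone for the action of the units. -/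
noncomputable def unitWeight (x : mixedSpace K) : ℝ :=
  if mixedEmbedding.norm x = 0 then 0 else logBump K (logMap x)

theorem logBump_nonneg (y : logSpace K) : 0 ≤ logBump K y :=
  Finset.prod_nonneg fun _ _ ↦ tent_nonneg _

theorem logBump_le_one (y : logSpace K) : logBump K y ≤ 1 :=
  Finset.prod_le_one (fun _ _ ↦ tent_nonneg _) fun _ _ ↦ tent_le_one _

theorem exists_abs_logBump_sub_le :
    ∃ C : ℝ, 0 ≤ C ∧ ∀ y z : logSpace K, |logBump K y - logBump K z| ≤ C * ‖y - z‖ := by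
  let f : Fin (rank K) → (logSpace K →L[ℝ] ℝ) := fun i ↦
    LinearMap.toContinuousLinearMap ((logBasis K).coord i)
  refine ⟨∑ i, ‖f i‖, by positivity, fun y z ↦ ?_⟩
  have hb : ∀ c, |tent c| ≤ 1 := fun c ↦ by
    rw [abs_of_nonneg (tent_nonneg c)]; exact tent_le_one c
  refine (abs_prod_sub_prod_le_sum _ _ _ (fun _ ↦ hb _) fun _ ↦ hb _).trans ?_
  rw [Finset.sum_mul]
  refine Finset.sum_le_sum fun i _ ↦ (abs_tent_sub_tent_le _ _).trans ?_
  have : (logBasis K).repr y i - (logBasis K).repr z i = f i (y - z) := by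
    simp [f]
  rw [this]
  exact (f i).le_opNorm _

theorem exists_norm_le_of_logBump_ne_zero :
    ∃ M : ℝ, 0 ≤ M ∧ ∀ y : logSpace K, logBump K y ≠ 0 → ‖y‖ ≤ M := by
  refine ⟨∑ i, ‖logBasis K i‖, by positivity, fun y hy ↦ ?_⟩
  rw [← (logBasis K).sum_repr y]
  refine (norm_sum_le _ _).trans (Finset.sum_le_sum fun i _ ↦ ?_)
  rw [_root_.norm_smul, Real.norm_eq_abs]
  have := abs_lt_one_of_tent_ne_zero (Finset.prod_ne_zero_iff.mp hy i (Finset.mem_univ _))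
  exact mul_le_of_le_one_left (norm_nonneg _) this.le

variable {K}

theorem norm_ne_zero_of_unitWeight_ne_zero {x : mixedSpace K} (h : unitWeight x ≠ 0) :
    mixedEmbedding.norm x ≠ 0 := fun h0 ↦ h (by simp [unitWeight, h0])

theorem log_mixedEmbedding_norm {x : mixedSpace K} (hx : ∀ v, normAtPlace v x ≠ 0) :
    Real.log (mixedEmbedding.norm x) = ∑ v, mult v * Real.log (normAtPlace v x) := by
  rw [mixedEmbedding.norm_apply, Real.log_prod fun v _ ↦ pow_ne_zero _ (hx v)]
  simp_rw [Real.log_pow]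

theorem normAtPlace_le_norm (v : InfinitePlace K) (x : mixedSpace K) : normAtPlace v x ≤ ‖x‖ := by
  rw [norm_eq_sup'_normAtPlace]
  exact Finset.le_sup' (fun w ↦ normAtPlace w x) (Finset.mem_univ v)

theorem exists_normAtPlace_eq_norm (x : mixedSpace K) : ∃ v, normAtPlace v x = ‖x‖ := by
  rw [norm_eq_sup'_normAtPlace]
  obtain ⟨v, _, hv⟩ := Finset.exists_mem_eq_sup' Finset.univ_nonempty (fun w ↦ normAtPlace w x)
  exact ⟨v, hv.symm⟩

theorem abs_normAtPlace_sub_le (v : InfinitePlace K) (x y : mixedSpace K) :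
    |normAtPlace v x - normAtPlace v y| ≤ ‖x - y‖ := by
  have key : ∀ a b : mixedSpace K, normAtPlace v a - normAtPlace v b ≤ ‖a - b‖ := fun a b ↦ by
    have := normAtPlace_add_le v (a - b) b
    rw [sub_add_cancel] at this
    linarith [normAtPlace_le_norm v (a - b)]
  refine abs_sub_le_iff.mpr ⟨key x y, ?_⟩
  rw [norm_sub_rev]
  exact key y x

theorem sum_mult_real : ∑ v : InfinitePlace K, (mult v : ℝ) = finrank ℚ K := by
  rw [← Nat.cast_sum, sum_mult_eq]

variable (K) in
theorem exists_le_normAtPlace :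
    ∃ c : ℝ, 0 < c ∧ c ≤ 1 ∧ ∀ x : mixedSpace K, unitWeight x ≠ 0 →
      ∀ v, c * ‖x‖ ≤ normAtPlace v x := by
  classical
  obtain ⟨M, hM0, hM⟩ := exists_norm_le_of_logBump_ne_zero K
  set M' := (Fintype.card (InfinitePlace K)) * M with hM'
  have hcard : (1 : ℝ) ≤ Fintype.card (InfinitePlace K) := by
    exact_mod_cast Fintype.card_pos
  have hMM' : M ≤ M' := le_mul_of_one_le_left hM0 hcard
  have hM'0 : 0 ≤ M' := hM0.trans hMM'
  refine ⟨Real.exp (-(2 * M')), Real.exp_pos _, Real.exp_le_one_iff.mpr (by linarith),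
    fun x hx v ↦ ?_⟩
  have hn := norm_ne_zero_of_unitWeight_ne_zero hx
  have hv : ∀ v, normAtPlace v x ≠ 0 := mixedEmbedding.norm_ne_zero_iff.mp hn
  have hpos : ∀ v, 0 < normAtPlace v x := fun v ↦ (normAtPlace_nonneg v x).lt_of_ne' (hv v)
  set d : ℝ := (finrank ℚ K : ℝ)
  have hd : d ≠ 0 := by simp [d, finrank_pos.ne']
  set l : InfinitePlace K → ℝ := fun v ↦
    mult v * (Real.log (normAtPlace v x) - Real.log (mixedEmbedding.norm x) * d⁻¹) with hl
  have hsum : ∑ v, l v = 0 := by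
    simp only [hl, mul_sub, Finset.sum_sub_distrib, ← log_mixedEmbedding_norm hv]
    rw [← Finset.sum_mul, sum_mult_real]
    field_simp
    ring
  have hMx : ‖logMap x‖ ≤ M := by
    refine hM _ ?_
    rwa [unitWeight, if_neg hn] at hx
  have hl1 : ∀ v : {v : InfinitePlace K // v ≠ w₀}, |l v| ≤ M := fun v ↦
    (norm_le_pi_norm (logMap x) v).trans hMx
  have hl2 : ∀ v, |l v| ≤ M' := by
    intro v
    by_cases hv0 : v = w₀
    · have h3 : l v = -∑ u ∈ Finset.univ.erase v, l u := by
        rw [← Finset.add_sum_erase _ _ (Finset.mem_univ v)] at hsum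
        linarith
      rw [h3, abs_neg]
      refine (Finset.abs_sum_le_sum_abs _ _).trans ((Finset.sum_le_card_nsmul _ _ M ?_).trans ?_)
      · intro u hu
        exact hl1 ⟨u, fun h ↦ Finset.ne_of_mem_erase hu (h.trans hv0.symm)⟩
      · rw [nsmul_eq_mul, hM']
        gcongr
        exact Finset.card_le_univ _
    · exact (hl1 ⟨v, hv0⟩).trans hMM'
  have hl3 : ∀ v, |Real.log (normAtPlace v x) - Real.log (mixedEmbedding.norm x) * d⁻¹| ≤ M' := by
    intro v
    refine le_trans ?_ (hl2 v)
    rw [hl, abs_mul, abs_of_nonneg (by positivity : (0 : ℝ) ≤ mult v)]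
    exact le_mul_of_one_le_left (abs_nonneg _) one_le_mult
  obtain ⟨u, hu⟩ := exists_normAtPlace_eq_norm x
  rw [← hu]
  have h4 := abs_le.mp (hl3 u)
  have h5 := abs_le.mp (hl3 v)
  rw [← Real.exp_log (hpos u), ← Real.exp_log (hpos v), ← Real.exp_add]
  exact Real.exp_le_exp.mpr (by linarith)

theorem abs_log_sub_log_le {a b m : ℝ} (hm : 0 < m) (ha : m ≤ a) (hb : m ≤ b) :
    |Real.log a - Real.log b| ≤ |a - b| / m := by
  have key : ∀ a b : ℝ, m ≤ a → m ≤ b → Real.log a - Real.log b ≤ |a - b| / m := by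
    intro a b ha hb
    have ha0 := hm.trans_le ha
    have hb0 := hm.trans_le hb
    rw [← Real.log_div ha0.ne' hb0.ne']
    refine (Real.log_le_sub_one_of_pos (by positivity)).trans ?_
    rw [div_sub_one hb0.ne']
    refine (div_le_div_of_nonneg_right (le_abs_self _) hb0.le).trans ?_
    gcongr
  refine abs_sub_le_iff.mpr ⟨key a b ha hb, ?_⟩
  rw [abs_sub_comm]
  exact key b a hb ha

theorem pow_le_mixedEmbedding_norm {x : mixedSpace K} {m : ℝ} (hm : 0 ≤ m)
    (h : ∀ v, m ≤ normAtPlace v x) : m ^ finrank ℚ K ≤ mixedEmbedding.norm x := by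
  rw [mixedEmbedding.norm_apply, ← sum_mult_eq, ← Finset.prod_pow_eq_pow_sum]
  exact Finset.prod_le_prod (fun _ _ ↦ by positivity) fun v _ ↦ pow_le_pow_left₀ hm (h v) _

theorem abs_log_norm_sub_le {x y : mixedSpace K} {m : ℝ} (hm : 0 < m)
    (hx : ∀ v, m ≤ normAtPlace v x) (hy : ∀ v, m ≤ normAtPlace v y) :
    |Real.log (mixedEmbedding.norm y) - Real.log (mixedEmbedding.norm x)|
      ≤ finrank ℚ K * (‖x - y‖ / m) := by
  rw [log_mixedEmbedding_norm fun v ↦ (hm.trans_le (hx v)).ne',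
    log_mixedEmbedding_norm fun v ↦ (hm.trans_le (hy v)).ne', ← Finset.sum_sub_distrib,
    ← sum_mult_real, Finset.sum_mul]
  refine (Finset.abs_sum_le_sum_abs _ _).trans (Finset.sum_le_sum fun v _ ↦ ?_)
  rw [← mul_sub, abs_mul, abs_of_nonneg (by positivity : (0 : ℝ) ≤ mult v)]
  gcongr
  refine (abs_log_sub_log_le hm (hy v) (hx v)).trans ?_
  gcongr
  rw [norm_sub_rev]
  exact abs_normAtPlace_sub_le v y x

theorem norm_logMap_sub_le {x y : mixedSpace K} {m : ℝ} (hm : 0 < m)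
    (hx : ∀ v, m ≤ normAtPlace v x) (hy : ∀ v, m ≤ normAtPlace v y) :
    ‖logMap y - logMap x‖ ≤ 4 * (‖x - y‖ / m) := by
  refine (pi_norm_le_iff_of_nonneg (by positivity)).mpr fun v ↦ ?_
  have hd : (0 : ℝ) < finrank ℚ K := by exact_mod_cast finrank_pos
  have h1 := abs_log_norm_sub_le hm hx hy
  have h2 : |Real.log (normAtPlace v.1 y) - Real.log (normAtPlace v.1 x)| ≤ ‖x - y‖ / m := by
    refine (abs_log_sub_log_le hm (hy v) (hx v)).trans ?_
    gcongr
    rw [norm_sub_rev]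
    exact abs_normAtPlace_sub_le v.1 y x
  have h3 : (mult v.1 : ℝ) ≤ 2 := by
    unfold mult; split_ifs <;> norm_num
  rw [Pi.sub_apply, logMap_apply, logMap_apply, Real.norm_eq_abs, ← mul_sub, abs_mul,
    abs_of_nonneg (by positivity : (0 : ℝ) ≤ mult v.1)]
  have h4 : |Real.log (normAtPlace v.1 y) - Real.log (mixedEmbedding.norm y) * (finrank ℚ K : ℝ)⁻¹ -
      (Real.log (normAtPlace v.1 x) - Real.log (mixedEmbedding.norm x) * (finrank ℚ K : ℝ)⁻¹)|
      ≤ 2 * (‖x - y‖ / m) := by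
    have e : Real.log (normAtPlace v.1 y) - Real.log (mixedEmbedding.norm y) * (finrank ℚ K : ℝ)⁻¹ -
      (Real.log (normAtPlace v.1 x) - Real.log (mixedEmbedding.norm x) * (finrank ℚ K : ℝ)⁻¹)
      = (Real.log (normAtPlace v.1 y) - Real.log (normAtPlace v.1 x))
        - (Real.log (mixedEmbedding.norm y) - Real.log (mixedEmbedding.norm x))
          * (finrank ℚ K : ℝ)⁻¹ := by ring
    rw [e]
    refine (abs_sub _ _).trans ?_
    rw [abs_mul, abs_of_pos (inv_pos.mpr hd), ← div_eq_mul_inv]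
    have : |Real.log (mixedEmbedding.norm y) - Real.log (mixedEmbedding.norm x)| / finrank ℚ K
        ≤ ‖x - y‖ / m := by
      rw [div_le_iff₀' hd]; exact h1
    linarith
  calc _ ≤ 2 * (2 * (‖x - y‖ / m)) := mul_le_mul h3 h4 (abs_nonneg _) zero_le_two
    _ = _ := by ring

variable (K) in
theorem measurable_unitWeight : Measurable (unitWeight : mixedSpace K → ℝ) := by
  refine Measurable.ite (measurableSet_eq_fun (mixedEmbedding.continuous_norm K).measurable
    measurable_const) measurable_const ?_
  have h1 : Measurable (logMap : mixedSpace K → logSpace K) := by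
    unfold logMap
    refine measurable_pi_iff.mpr fun w ↦ measurable_const.mul ?_
    exact (continuous_normAtPlace _).measurable.log.sub <|
      (mixedEmbedding.continuous_norm _).measurable.log.mul measurable_const
  have h2 : Continuous (logBump K) := by
    unfold logBump
    refine continuous_finsetProd _ fun i _ ↦ continuous_tent.comp ?_
    exact ((logBasis K).coord i).continuous_of_finiteDimensional
  exact h2.measurable.comp h1

variable (K) in
theorem isHomogeneousWeight_unitWeight :
    IsHomogeneousWeight (unitWeight : mixedSpace K → ℝ) mixedEmbedding.norm where
  measurable_weight := measurable_unitWeight K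
  measurable_size := (mixedEmbedding.continuous_norm K).measurable
  weight_nonneg x := by
    unfold unitWeight
    split_ifs
    exacts [le_rfl, logBump_nonneg K _]
  weight_le_one x := by
    unfold unitWeight
    split_ifs
    exacts [zero_le_one, logBump_le_one K _]
  weight_smul t x ht := by
    have h1 : mixedEmbedding.norm (t • x) = 0 ↔ mixedEmbedding.norm x = 0 := by
      rw [mixedEmbedding.norm_smul, mul_eq_zero, or_iff_right]
      exact pow_ne_zero _ (abs_pos_of_pos ht).ne'
    unfold unitWeight
    simp only [h1]
    split_ifs with h
    · rfl
    · rw [logMap_real_smul h ht.ne']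
  size_smul t x ht := by
    rw [mixedEmbedding.norm_smul, abs_of_pos ht, mixedEmbedding.finrank]
  slow δ := by
    obtain ⟨c, hc, hc1, hcx⟩ := exists_le_normAtPlace K
    obtain ⟨C, hC0, hC⟩ := exists_abs_logBump_sub_le K
    set m := c / 4 with hm
    have hm0 : 0 < m := by positivity
    set d := finrank ℚ K
    refine ⟨m ^ d, (d + 4 * C) * (|δ| / m), 4 * |δ| / c + 1, by positivity, by positivity,
      fun x y hx hxy ↦ ?_⟩
    have hxy' : ‖x - y‖ ≤ |δ| := hxy.trans (le_abs_self δ)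
    have hx0 : 0 < ‖x‖ := lt_of_lt_of_le (by positivity) hx
    have hδ : 4 * |δ| ≤ c * ‖x‖ := by
      have : 4 * |δ| / c ≤ ‖x‖ := by linarith
      rwa [div_le_iff₀' hc] at this
    by_cases h0 : unitWeight x = 0 ∧ unitWeight y = 0
    · exact Or.inl h0
    right
    have key : (∀ v, m * ‖x‖ ≤ normAtPlace v x) ∧ ∀ v, m * ‖x‖ ≤ normAtPlace v y := by
      by_cases hwx : unitWeight x = 0
      · have hwy : unitWeight y ≠ 0 := fun h ↦ h0 ⟨hwx, h⟩
        have h1 : ‖x‖ - |δ| ≤ ‖y‖ := by linarith [norm_sub_norm_le x y]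
        have h2 : c * (‖x‖ - |δ|) ≤ c * ‖y‖ := by gcongr
        have h3 : c * |δ| ≤ |δ| := mul_le_of_le_one_left (abs_nonneg _) hc1
        constructor <;> intro v
        · have h4 := abs_le.mp (abs_normAtPlace_sub_le v x y)
          have h5 := hcx y hwy v
          rw [hm]; linarith
        · have h5 := hcx y hwy v
          have h6 : 0 < c * ‖x‖ := by positivity
          rw [hm]; linarith
      · constructor <;> intro v
        · have h5 := hcx x hwx v
          rw [hm]; linarith [abs_nonneg δ]
        · have h4 := abs_le.mp (abs_normAtPlace_sub_le v x y)
          have h5 := hcx x hwx v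
          rw [hm]; linarith [abs_nonneg δ]
    have hmx : 0 < m * ‖x‖ := by positivity
    have hNx := pow_le_mixedEmbedding_norm hmx.le key.1
    have hNy := pow_le_mixedEmbedding_norm hmx.le key.2
    have hq : ‖x - y‖ / (m * ‖x‖) ≤ |δ| / m / ‖x‖ := by
      rw [← div_div]; gcongr
    have hq0 : 0 ≤ |δ| / m / ‖x‖ := by positivity
    rw [mixedEmbedding.finrank, ← mul_pow]
    refine ⟨hNx, hNy, ?_, ?_⟩
    · refine (abs_log_norm_sub_le hmx key.1 key.2).trans ?_
      calc (d : ℝ) * (‖x - y‖ / (m * ‖x‖)) ≤ d * (|δ| / m / ‖x‖) := by gcongr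
        _ ≤ (d + 4 * C) * (|δ| / m / ‖x‖) := by gcongr; linarith
        _ = _ := by ring
    · have hx' : mixedEmbedding.norm x ≠ 0 := ((pow_pos hmx _).trans_le hNx).ne'
      have hy' : mixedEmbedding.norm y ≠ 0 := ((pow_pos hmx _).trans_le hNy).ne'
      rw [unitWeight, unitWeight, if_neg hx', if_neg hy']
      refine (hC _ _).trans ?_
      calc C * ‖logMap y - logMap x‖ ≤ C * (4 * (‖x - y‖ / (m * ‖x‖))) := by
            gcongr; exact norm_logMap_sub_le hmx key.1 key.2
        _ ≤ C * (4 * (|δ| / m / ‖x‖)) := by gcongr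
        _ ≤ (d + 4 * C) * (|δ| / m / ‖x‖) := by
            have : 0 ≤ (d : ℝ) * (|δ| / m / ‖x‖) := by positivity
            linarith
        _ = _ := by ring

end UnitWeight

section ZetaContinuation

open scoped Classical
open NumberField NumberField.InfinitePlace NumberField.mixedEmbedding NumberField.Units
  NumberField.Units.dirichletUnitTheorem Module
open scoped nonZeroDivisors

variable {K : Type*} [Field K]

/-- A generator of a principal ideal. -/
noncomputable def idealGenerator (I : Ideal (𝓞 K)) : 𝓞 K :=
  if h : Submodule.IsPrincipal I then h.1.choose else 0

theorem span_idealGenerator {I : Ideal (𝓞 K)} (h : Submodule.IsPrincipal I) :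
    Ideal.span {idealGenerator I} = I := by
  rw [idealGenerator, dif_pos h]
  exact h.1.choose_spec.symm

variable (K) [NumberField K]

/-- Dirichlet's unit theorem as a parametrization of the units. -/
noncomputable def unitsEquiv : torsion K × (Fin (rank K) → ℤ) ≃ (𝓞 K)ˣ :=
  Equiv.ofBijective (fun z ↦ z.1 * ∏ i, fundSystem K i ^ z.2 i)
    ⟨fun _ _ hab ↦ (exist_unique_eq_mul_prod K _).unique rfl hab,
      fun u ↦ (exist_unique_eq_mul_prod K u).exists.imp fun _ h ↦ h.symm⟩

variable {K}

theorem logBasis_repr_logMap_unitsEquiv_smul (z : torsion K × (Fin (rank K) → ℤ))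
    {x : mixedSpace K} (hx : mixedEmbedding.norm x ≠ 0) (i : Fin (rank K)) :
    (logBasis K).repr (logMap (unitsEquiv K z • x)) i = (logBasis K).repr (logMap x) i + z.2 i := by
  have h1 : logEmbedding K (Additive.ofMul (unitsEquiv K z)) = ∑ i, z.2 i • logBasis K i := by
    have : unitsEquiv K z = z.1 * ∏ i, fundSystem K i ^ z.2 i := rfl
    rw [this, ofMul_mul, map_add, logEmbedding_eq_zero_iff.mpr z.1.2, zero_add, ofMul_prod, map_sum]
    refine Finset.sum_congr rfl fun i _ ↦ ?_
    rw [ofMul_zpow, map_zsmul, logEmbedding_fundSystem, Basis.ofZLatticeBasis_apply]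
  rw [logMap_unit_smul _ hx, h1, map_add, Finsupp.add_apply, add_comm]
  simp only [map_sum, map_zsmul, Basis.repr_self, Finsupp.finsetSum_apply, Finsupp.smul_apply]
  congr 1
  simp [Finsupp.single_apply]

theorem hasSum_unitWeight_unit_smul {x : mixedSpace K} (hx : mixedEmbedding.norm x ≠ 0) :
    HasSum (fun u : (𝓞 K)ˣ ↦ unitWeight (u • x)) (torsionOrder K) := by
  have := Fintype.ofFinite (torsion K)
  rw [← (unitsEquiv K).hasSum_iff]
  set c := (logBasis K).repr (logMap x)
  have h1 : (fun u : (𝓞 K)ˣ ↦ unitWeight (u • x)) ∘ unitsEquiv K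
      = fun z ↦ ∏ i, tent (c i + z.2 i) := by
    funext z
    rw [Function.comp_apply, unitWeight, norm_unit_smul, if_neg hx, logBump]
    simp_rw [logBasis_repr_logMap_unitsEquiv_smul z hx]
    rfl
  rw [h1]
  let t : Fin (rank K) → Finset ℤ := fun i ↦ {-⌊c i⌋, -⌊c i⌋ - 1}
  have h2 := hasSum_sum_of_ne_finset_zero
    (f := fun z : torsion K × (Fin (rank K) → ℤ) ↦ ∏ i, tent (c i + z.2 i))
    (s := Finset.univ ×ˢ Fintype.piFinset t) (L := SummationFilter.unconditional _) (by
      intro z hz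
      simp only [Finset.mem_product, Finset.mem_univ, true_and, Fintype.mem_piFinset,
        not_forall] at hz
      obtain ⟨i, hi⟩ := hz
      exact Finset.prod_eq_zero (Finset.mem_univ i) (tent_add_intCast_eq_zero hi))
  convert h2 using 1
  rw [Finset.sum_product]
  simp only [← Finset.prod_univ_sum t fun i k ↦ tent (c i + k)]
  simp [t, -Finset.mem_insert, -Finset.mem_singleton, sum_tent_add_intCast, torsionOrder,
    Nat.card_eq_fintype_card]

theorem norm_mixedEmbedding_eq_absNorm (a : 𝓞 K) :
    mixedEmbedding.norm (mixedEmbedding K a) = (Ideal.absNorm (Ideal.span {a}) : ℝ) := by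
  rw [norm_eq_norm, Ideal.absNorm_span_singleton, ← Algebra.coe_norm_int, Nat.cast_natAbs]
  simp

/-- A generator of `J * I`, where `I` is an ideal in the class inverse to the one of `J`. -/
noncomputable def classGenerator (J : (Ideal (𝓞 K))⁰)
    (I : {I : (Ideal (𝓞 K))⁰ // ClassGroup.mk0 I = (ClassGroup.mk0 J)⁻¹}) : 𝓞 K :=
  idealGenerator ((J : Ideal (𝓞 K)) * I.1)

variable (J : (Ideal (𝓞 K))⁰)
  (I : {I : (Ideal (𝓞 K))⁰ // ClassGroup.mk0 I = (ClassGroup.mk0 J)⁻¹})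

theorem isPrincipal_mul_iff (I : (Ideal (𝓞 K))⁰) :
    Submodule.IsPrincipal ((J : Ideal (𝓞 K)) * (I : Ideal (𝓞 K))) ↔
      ClassGroup.mk0 I = (ClassGroup.mk0 J)⁻¹ := by
  have h : ClassGroup.mk0 (J * I) = 1 ↔
      Submodule.IsPrincipal ((J * I : (Ideal (𝓞 K))⁰) : Ideal (𝓞 K)) :=
    ClassGroup.mk0_eq_one_iff (SetLike.coe_mem (J * I))
  rw [_root_.map_mul, mul_eq_one_iff_inv_eq, eq_comm, Submonoid.coe_mul] at h
  exact h.symm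

theorem span_classGenerator : Ideal.span {classGenerator J I} = (J : Ideal (𝓞 K)) * I.1 :=
  span_idealGenerator ((isPrincipal_mul_iff J I.1).mpr I.2)

theorem classGenerator_mem : classGenerator J I ∈ (J : Ideal (𝓞 K)) := by
  have : classGenerator J I ∈ Ideal.span {classGenerator J I} := Ideal.mem_span_singleton_self _
  rw [span_classGenerator] at this
  exact (Ideal.mul_le_left : (J : Ideal (𝓞 K)) * (I.1 : Ideal (𝓞 K)) ≤ J) this

theorem classGenerator_ne_zero : classGenerator J I ≠ 0 := by
  intro h0
  have := span_classGenerator J I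
  rw [h0, Ideal.span_singleton_eq_bot.mpr rfl] at this
  exact mul_ne_zero (nonZeroDivisors.coe_ne_zero J) (nonZeroDivisors.coe_ne_zero I.1) this.symm

theorem exists_unit_mul_classGenerator_eq {a : 𝓞 K} (ha : a ∈ (J : Ideal (𝓞 K))) (ha0 : a ≠ 0) :
    ∃ I, ∃ u : (𝓞 K)ˣ, u * classGenerator J I = a := by
  obtain ⟨I, hI⟩ := Ideal.dvd_iff_le.mpr ((Ideal.span_singleton_le_iff_mem _).mpr ha)
  have hI0 : I ∈ (Ideal (𝓞 K))⁰ := by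
    rw [mem_nonZeroDivisors_iff_ne_zero]
    rintro rfl
    simp [ha0] at hI
  have hIC : ClassGroup.mk0 ⟨I, hI0⟩ = (ClassGroup.mk0 J)⁻¹ :=
    (isPrincipal_mul_iff J ⟨I, hI0⟩).mp ⟨a, hI.symm⟩
  have h2 : Ideal.span {classGenerator J ⟨_, hIC⟩} = Ideal.span {a} := by
    rw [span_classGenerator, hI]
  obtain ⟨u, hu⟩ := Ideal.span_singleton_eq_span_singleton.mp h2
  exact ⟨⟨_, hIC⟩, u, by rw [mul_comm, hu]⟩

theorem unit_mul_classGenerator_injective :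
    Function.Injective (fun z : {I : (Ideal (𝓞 K))⁰ // ClassGroup.mk0 I = (ClassGroup.mk0 J)⁻¹} ×
      (𝓞 K)ˣ ↦ (z.2 * classGenerator J z.1 : 𝓞 K)) := by
  intro y z h1
  simp only at h1
  have h2 : y.1 = z.1 := by
    have h3 : Ideal.span {classGenerator J y.1} = Ideal.span {classGenerator J z.1} := by
      rw [← Ideal.span_singleton_mul_left_unit y.2.isUnit, h1,
        Ideal.span_singleton_mul_left_unit z.2.isUnit]
    rw [span_classGenerator, span_classGenerator] at h3
    exact Subtype.ext (Subtype.ext (mul_left_cancel₀ (nonZeroDivisors.coe_ne_zero J) h3))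
  refine Prod.ext h2 (Units.ext ?_)
  rw [h2] at h1
  exact mul_right_cancel₀ (classGenerator_ne_zero J _) h1

theorem norm_classGenerator (u : (𝓞 K)ˣ) :
    mixedEmbedding.norm (mixedEmbedding K ((u * classGenerator J I : 𝓞 K) : K)) =
      (Ideal.absNorm (J : Ideal (𝓞 K)) : ℝ) * (Ideal.absNorm (I.1 : Ideal (𝓞 K)) : ℝ) := by
  rw [norm_mixedEmbedding_eq_absNorm, Ideal.span_singleton_mul_left_unit u.isUnit,
    span_classGenerator, _root_.map_mul, Nat.cast_mul]

theorem absNorm_coe_pos (I : (Ideal (𝓞 K))⁰) : 0 < Ideal.absNorm (I : Ideal (𝓞 K)) :=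
  Ideal.absNorm_pos_of_nonZeroDivisors I

theorem mem_span_idealLatticeBasis {x : mixedSpace K} :
    x ∈ Submodule.span ℤ (Set.range (fractionalIdealLatticeBasis K (FractionalIdeal.mk0 K J))) ↔
      ∃ a ∈ (J : Ideal (𝓞 K)), mixedEmbedding K (a : K) = x := by
  rw [mem_span_fractionalIdealLatticeBasis]
  simp [FractionalIdeal.coe_mk0, Set.mem_image, FractionalIdeal.mem_coeIdeal]

theorem exists_hasSum_class_lattice : ∃ (κ : ℂ) (H : ℂ → ℂ),
    DifferentiableOn ℂ H {s | 1 - 1 / (finrank ℚ K : ℝ) < s.re} ∧ ∀ s : ℂ, 1 < s.re →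
      HasSum (fun z : {I : (Ideal (𝓞 K))⁰ // ClassGroup.mk0 I = (ClassGroup.mk0 J)⁻¹} × (𝓞 K)ˣ ↦
        IsHomogeneousWeight.term unitWeight mixedEmbedding.norm s
          (mixedEmbedding K ((z.2 * classGenerator J z.1 : 𝓞 K) : K))) (κ / (s - 1) + H s) := by
  set b := fractionalIdealLatticeBasis K (FractionalIdeal.mk0 K J) with hb
  have hrange : ∀ x : mixedSpace K, x ∈ Submodule.span ℤ (Set.range b) → unitWeight x ≠ 0 →
      ∃ I, ∃ u : (𝓞 K)ˣ, mixedEmbedding K ((u * classGenerator J I : 𝓞 K) : K) = x := by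
    intro x hx hx0
    obtain ⟨a, ha, rfl⟩ := (mem_span_idealLatticeBasis J).mp hx
    obtain ⟨I, u, hu⟩ := exists_unit_mul_classGenerator_eq J ha (by
      rintro rfl
      exact hx0 (by simp [unitWeight]))
    exact ⟨I, u, by rw [hu]⟩
  obtain ⟨κ, H, hH, hs⟩ := (isHomogeneousWeight_unitWeight K).exists_hasSum_lattice b (by
    intro x hx hx0
    obtain ⟨I, u, rfl⟩ := hrange x hx hx0
    rw [norm_classGenerator]
    exact_mod_cast Nat.one_le_iff_ne_zero.mpr
        (mul_pos (absNorm_coe_pos J) (absNorm_coe_pos I.1)).ne')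
  rw [mixedEmbedding.finrank] at hH
  refine ⟨κ, H, hH, fun s h1 ↦ ?_⟩
  let φ : {I : (Ideal (𝓞 K))⁰ // ClassGroup.mk0 I = (ClassGroup.mk0 J)⁻¹} × (𝓞 K)ˣ →
      Submodule.span ℤ (Set.range b) := fun z ↦
    ⟨mixedEmbedding K ((z.2 * classGenerator J z.1 : 𝓞 K) : K),
      (mem_span_idealLatticeBasis J).mpr ⟨_, Ideal.mul_mem_left _ _ (classGenerator_mem J _), rfl⟩⟩
  have hinj : Function.Injective φ := fun y z hyz ↦ unit_mul_classGenerator_injective J <|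
    RingOfIntegers.coe_injective (mixedEmbedding_injective K (congrArg Subtype.val hyz))
  refine (hinj.hasSum_iff fun x hx ↦ ?_).mpr (hs s h1)
  have : unitWeight (x : mixedSpace K) = 0 := by
    by_contra h0
    obtain ⟨I, u, h⟩ := hrange x x.2 h0
    exact hx ⟨(I, u), Subtype.ext h⟩
  simp [IsHomogeneousWeight.term, this]

theorem hasSum_class_units (s : ℂ) :
    HasSum (fun u : (𝓞 K)ˣ ↦ IsHomogeneousWeight.term unitWeight mixedEmbedding.norm s
      (mixedEmbedding K ((u * classGenerator J I : 𝓞 K) : K)))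
      (torsionOrder K * (Ideal.absNorm (J : Ideal (𝓞 K)) : ℂ) ^ (-s) *
        (Ideal.absNorm (I.1 : Ideal (𝓞 K)) : ℂ) ^ (-s)) := by
  have h4 : mixedEmbedding.norm (mixedEmbedding K (classGenerator J I : K)) ≠ 0 := by
    have := norm_classGenerator J I 1
    rw [Units.val_one, one_mul] at this
    rw [this]
    exact_mod_cast (mul_pos (absNorm_coe_pos J) (absNorm_coe_pos I.1)).ne'
  have h5 := (Complex.hasSum_ofReal.mpr (hasSum_unitWeight_unit_smul h4)).mul_right
    ((Ideal.absNorm (J : Ideal (𝓞 K)) : ℂ) ^ (-s) * (Ideal.absNorm (I.1 : Ideal (𝓞 K)) : ℂ) ^ (-s))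
  rw [← mul_assoc] at h5
  refine h5.congr_fun fun u ↦ ?_
  rw [show ∀ x : mixedSpace K, IsHomogeneousWeight.term unitWeight mixedEmbedding.norm s x =
    (unitWeight x : ℂ) * (mixedEmbedding.norm x : ℂ) ^ (-s) from fun _ ↦ rfl,
    norm_classGenerator, unitSMul_smul, ← _root_.map_mul, ← _root_.map_mul]
  push_cast
  rw [Complex.natCast_mul_natCast_cpow]

variable (K) in
/-- The sum of `N(I)⁻ˢ` over the ideals in a given class. -/
theorem exists_hasSum_ideal_class (C : ClassGroup (𝓞 K)) : ∃ (κ : ℂ) (H : ℂ → ℂ),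
    DifferentiableOn ℂ H {s | 1 - 1 / (finrank ℚ K : ℝ) < s.re} ∧ ∀ s : ℂ, 1 < s.re →
      HasSum (fun I : {I : (Ideal (𝓞 K))⁰ // ClassGroup.mk0 I = C} ↦
        (Ideal.absNorm (I : Ideal (𝓞 K)) : ℂ) ^ (-s)) (κ / (s - 1) + H s) := by
  obtain ⟨J, hJ⟩ := ClassGroup.mk0_surjective C⁻¹
  obtain rfl : C = (ClassGroup.mk0 J)⁻¹ := by rw [hJ, inv_inv]
  obtain ⟨κ, H, hH, hs⟩ := exists_hasSum_class_lattice J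
  set NJ : ℂ := (Ideal.absNorm (J : Ideal (𝓞 K)) : ℂ) with hNJ
  have hNJ0 : NJ ≠ 0 := Nat.cast_ne_zero.mpr (absNorm_coe_pos J).ne'
  set w : ℂ := (torsionOrder K : ℂ)
  have hw0 : w ≠ 0 := Nat.cast_ne_zero.mpr (torsionOrder_ne_zero K)
  set f : ℂ → ℂ := fun s ↦ NJ ^ s / w
  have hf : Differentiable ℂ f := fun s ↦
    ((differentiableAt_id.const_cpow (Or.inl hNJ0))).div_const w
  refine ⟨f 1 * κ, fun s ↦ dslope f 1 s * κ + f s * H s, ?_, fun s h1 ↦ ?_⟩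
  · refine DifferentiableOn.add (DifferentiableOn.mul_const ?_ κ)
      (hf.differentiableOn.mul hH)
    exact ((Complex.differentiableOn_dslope Filter.univ_mem).mpr hf.differentiableOn).mono
      (Set.subset_univ _)
  have h3 := ((hs s h1).prod_fiberwise fun I ↦ hasSum_class_units J I s).mul_left (f s)
  have hs1 : s ≠ 1 := by rintro rfl; simp at h1
  have e1 : f s * (κ / (s - 1) + H s) = f 1 * κ / (s - 1) + (dslope f 1 s * κ + f s * H s) := by
    rw [dslope_of_ne _ hs1, slope_def_field]
    have := sub_ne_zero.mpr hs1
    field_simp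
    ring
  rw [e1] at h3
  refine h3.congr_fun fun I ↦ ?_
  have : NJ ^ s ≠ 0 := by simp [Complex.cpow_eq_zero_iff, hNJ0]
  change _ = NJ ^ s / w * (w * NJ ^ (-s) * _)
  rw [Complex.cpow_neg NJ]
  field_simp

variable (K) in
theorem exists_hasSum_ideal : ∃ (κ : ℂ) (H : ℂ → ℂ),
    DifferentiableOn ℂ H {s | 1 - 1 / (finrank ℚ K : ℝ) < s.re} ∧ ∀ s : ℂ, 1 < s.re →
      HasSum (fun I : (Ideal (𝓞 K))⁰ ↦ (Ideal.absNorm (I : Ideal (𝓞 K)) : ℂ) ^ (-s))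
        (κ / (s - 1) + H s) := by
  choose κ H hH hs using exists_hasSum_ideal_class K
  refine ⟨∑ C, κ C, fun s ↦ ∑ C, H C s, DifferentiableOn.fun_sum fun C _ ↦ hH C, fun s h1 ↦ ?_⟩
  rw [Finset.sum_div, ← Finset.sum_add_distrib]
  have h2 : ∀ C, HasSum ({I | ClassGroup.mk0 I = C}.indicator
      fun I : (Ideal (𝓞 K))⁰ ↦ (Ideal.absNorm (I : Ideal (𝓞 K)) : ℂ) ^ (-s))
      (κ C / (s - 1) + H C s) := fun C ↦ hasSum_subtype_iff_indicator.mp (hs C s h1)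
  have h3 := hasSum_sum fun C (_ : C ∈ Finset.univ) ↦ h2 C
  refine h3.congr_fun fun I ↦ ?_
  simp [Set.indicator_apply]

end ZetaContinuation

section IdealVonMangoldt

open NumberField Module
open scoped nonZeroDivisors

variable (K : Type*) [Field K] [NumberField K]

/-- The pairs `(P, k)`, standing for the power `P ^ (k + 1)` of the prime ideal `P`. -/
abbrev PrimePowerIndex := (_ : {P : Ideal (𝓞 K) // Prime P}) × ℕ

variable {K}

namespace PrimePowerIndex

/-- The prime power itself. -/
noncomputable def ideal (z : PrimePowerIndex K) : (Ideal (𝓞 K))⁰ :=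
  ⟨z.1.1 ^ (z.2 + 1), mem_nonZeroDivisors_iff_ne_zero.mpr (pow_ne_zero _ z.1.2.ne_zero)⟩

/-- The value of the von Mangoldt function. -/
noncomputable def weight (z : PrimePowerIndex K) : ℝ := Real.log (Ideal.absNorm z.1.1)

theorem weight_nonneg (z : PrimePowerIndex K) : 0 ≤ z.weight := Real.log_natCast_nonneg _

theorem one_lt_absNorm {P : Ideal (𝓞 K)} (hP : Prime P) : 1 < Ideal.absNorm P := by
  have h0 : Ideal.absNorm P ≠ 0 := by
    rw [Ne, Ideal.absNorm_eq_zero_iff]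
    exact hP.ne_zero
  have h1 : Ideal.absNorm P ≠ 1 := by
    rw [Ne, Ideal.absNorm_eq_one_iff]
    exact fun h ↦ hP.not_isUnit (Ideal.isUnit_iff.mpr h)
  lia

theorem ideal_injective : Function.Injective (ideal : PrimePowerIndex K → (Ideal (𝓞 K))⁰) := by
  rintro ⟨⟨P, hP⟩, k⟩ ⟨⟨Q, hQ⟩, l⟩ h
  have h1 : P ^ (k + 1) = Q ^ (l + 1) := congrArg Subtype.val h
  have h2 : P = Q := by
    have : P ∣ Q := hP.dvd_of_dvd_pow (h1 ▸ dvd_pow_self P (Nat.succ_ne_zero k))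
    exact associated_iff_eq.mp (hP.associated_of_dvd hQ this)
  subst h2
  have h3 : k = l := by
    have h4 := congrArg Ideal.absNorm h1
    rw [map_pow, map_pow] at h4
    have := Nat.pow_right_injective (one_lt_absNorm hP) h4
    lia
  rw [h3]

theorem weight_le_log_absNorm (z : PrimePowerIndex K) :
    z.weight ≤ Real.log (Ideal.absNorm (z.ideal : Ideal (𝓞 K))) := by
  have h1 := one_lt_absNorm z.1.2
  unfold weight ideal
  simp only [map_pow]
  gcongr
  exact_mod_cast Nat.le_self_pow (Nat.succ_ne_zero _) _

theorem exists_finset (I : (Ideal (𝓞 K))⁰) : ∃ T : Finset (PrimePowerIndex K),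
    (∀ z, z ∈ T ↔ (z.ideal : Ideal (𝓞 K)) ∣ I) ∧
      ∑ z ∈ T, z.weight = Real.log (Ideal.absNorm (I : Ideal (𝓞 K))) := by
  classical
  have hI : (I : Ideal (𝓞 K)) ≠ 0 := nonZeroDivisors.coe_ne_zero I
  set F := UniqueFactorizationMonoid.normalizedFactors (I : Ideal (𝓞 K)) with hF
  have hp : ∀ P ∈ F.toFinset, Prime P := fun P h ↦
    UniqueFactorizationMonoid.prime_of_normalized_factor P (Multiset.mem_toFinset.mp h)
  have hdvd : ∀ P : Ideal (𝓞 K), Prime P → ∀ k, P ^ k ∣ I ↔ k ≤ F.count P := by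
    intro P hP k
    rw [pow_dvd_iff_le_emultiplicity,
      UniqueFactorizationMonoid.emultiplicity_eq_count_normalizedFactors hP.irreducible hI,
      normalize_eq, Nat.cast_le]
  refine ⟨(F.toFinset.subtype Prime).sigma fun P ↦ Finset.range (F.count P.1), fun z ↦ ?_, ?_⟩
  · rw [Finset.mem_sigma, Finset.mem_subtype, Finset.mem_range, Multiset.mem_toFinset]
    change _ ↔ z.1.1 ^ (z.2 + 1) ∣ _
    rw [hdvd _ z.1.2, ← Multiset.count_pos]
    lia
  · rw [Finset.sum_sigma]
    simp only [weight, Finset.sum_const, Finset.card_range]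
    rw [Finset.sum_subtype_of_mem (fun P ↦ F.count P • Real.log (Ideal.absNorm P)) hp]
    have h1 : (I : Ideal (𝓞 K)) = ∏ P ∈ F.toFinset, P ^ F.count P := by
      rw [← Finset.prod_multiset_count, Ideal.prod_normalizedFactors_eq_self hI]
    conv_rhs => rw [h1]
    rw [map_prod, Nat.cast_prod, Real.log_prod]
    · simp
    · intro P hP
      have := one_lt_absNorm (hp P hP)
      rw [map_pow]
      positivity

end PrimePowerIndex

open PrimePowerIndex

theorem hasSum_mul_prod {ι κ : Type*} {f : ι → ℂ} {g : κ → ℂ} {a b : ℂ} (hf : HasSum f a)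
    (hg : HasSum g b) : HasSum (fun x : ι × κ ↦ f x.1 * g x.2) (a * b) :=
  hf.mul hg (summable_mul_of_summable_norm hf.summable.norm hg.summable.norm)

/-- The identity `-ζ' = L * ζ`, in terms of sums over ideals. -/
theorem hasSum_log_absNorm {s Z L : ℂ}
    (hZ : HasSum (fun I : (Ideal (𝓞 K))⁰ ↦ (Ideal.absNorm (I : Ideal (𝓞 K)) : ℂ) ^ (-s)) Z)
    (hL : HasSum (fun z : PrimePowerIndex K ↦
      (z.weight : ℂ) * (Ideal.absNorm (z.ideal : Ideal (𝓞 K)) : ℂ) ^ (-s)) L) :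
    HasSum (fun I : (Ideal (𝓞 K))⁰ ↦ (Real.log (Ideal.absNorm (I : Ideal (𝓞 K))) : ℂ) *
      (Ideal.absNorm (I : Ideal (𝓞 K)) : ℂ) ^ (-s)) (L * Z) := by
  have h1 := hasSum_mul_prod hL hZ
  let m : PrimePowerIndex K × (Ideal (𝓞 K))⁰ → (Ideal (𝓞 K))⁰ := fun x ↦ x.1.ideal * x.2
  rw [← (Equiv.sigmaFiberEquiv m).hasSum_iff] at h1
  refine h1.sigma fun I ↦ ?_
  obtain ⟨T, hT, hsum⟩ := exists_finset I
  have hmem : ∀ x : {x // m x = I}, x.1.1 ∈ T := by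
    rintro ⟨x, rfl⟩
    rw [hT]
    exact ⟨x.2, rfl⟩
  let e : {x // m x = I} ≃ T := Equiv.ofBijective (fun x ↦ ⟨x.1.1, hmem x⟩) (by
    constructor
    · rintro ⟨⟨z, A⟩, hx⟩ ⟨⟨y, B⟩, hy⟩ h
      obtain rfl : z = y := congrArg Subtype.val h
      have h3 : z.ideal * A = z.ideal * B := hx.trans hy.symm
      have h4 : A = B := Subtype.ext <|
        mul_left_cancel₀ (nonZeroDivisors.coe_ne_zero z.ideal) (congrArg Subtype.val h3)
      subst h4
      rfl
    · rintro ⟨z, hz⟩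
      obtain ⟨B, hB⟩ := (hT z).mp hz
      have hB0 : B ≠ 0 := by
        rintro rfl
        rw [mul_zero] at hB
        exact nonZeroDivisors.coe_ne_zero I hB
      exact ⟨⟨(z, ⟨B, mem_nonZeroDivisors_iff_ne_zero.mpr hB0⟩), Subtype.ext hB.symm⟩, rfl⟩)
  have h5 := (T.hasSum fun z ↦ (z.weight : ℂ)).mul_right
    ((Ideal.absNorm (I : Ideal (𝓞 K)) : ℂ) ^ (-s))
  rw [← Complex.ofReal_sum, hsum] at h5
  replace h5 := e.hasSum_iff.mpr h5
  refine h5.congr_fun fun x ↦ ?_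
  obtain ⟨x, rfl⟩ := x
  change (x.1.weight : ℂ) * _ * _ = x.1.weight * _
  rw [mul_assoc, ← Complex.natCast_mul_natCast_cpow, ← Nat.cast_mul, ← map_mul]
  rfl

end IdealVonMangoldt

section ZetaLogDeriv

open NumberField Module Filter Topology
open scoped nonZeroDivisors

/-- The coefficients of the Dirichlet series `∑ g t * N t ^ (-s)`. -/
noncomputable def pushCoeff {T : Type*} (N : T → ℕ) (g : T → ℝ) (n : ℕ) : ℝ :=
  ∑' t : N ⁻¹' {n}, g t

theorem pushCoeff_nonneg {T : Type*} {N : T → ℕ} {g : T → ℝ} (hg : ∀ t, 0 ≤ g t) (n : ℕ) :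
    0 ≤ pushCoeff N g n := tsum_nonneg fun _ ↦ hg _

theorem lseriesHasSum_pushCoeff {T : Type*} {N : T → ℕ} {g : T → ℝ} {s A : ℂ} (hN : ∀ t, N t ≠ 0)
    (h : HasSum (fun t ↦ (g t : ℂ) * (N t : ℂ) ^ (-s)) A) :
    LSeriesHasSum (fun n ↦ (pushCoeff N g n : ℂ)) s A := by
  refine (h.tsum_fiberwise N).congr_fun fun n ↦ ?_
  rw [LSeries.term_def]
  split_ifs with hn
  · have : IsEmpty (N ⁻¹' {n}) := ⟨fun t ↦ hN t.1 (t.2.trans hn)⟩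
    simp
  · rw [pushCoeff, Complex.ofReal_tsum, div_eq_mul_inv, ← Complex.cpow_neg, ← tsum_mul_right]
    refine tsum_congr fun t ↦ ?_
    rw [show N t = n from t.2]

variable (K : Type*) [Field K] [NumberField K]

/-- The coefficients of the Dedekind zeta function. -/
noncomputable def zetaCoeff : ℕ → ℝ :=
  pushCoeff (fun I : (Ideal (𝓞 K))⁰ ↦ Ideal.absNorm (I : Ideal (𝓞 K))) fun _ ↦ 1

/-- The coefficients of minus the logarithmic derivative of the Dedekind zeta function. -/
noncomputable def mangoldtCoeff : ℕ → ℝ :=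
  pushCoeff (fun z : PrimePowerIndex K ↦ Ideal.absNorm (z.ideal : Ideal (𝓞 K)))
    PrimePowerIndex.weight

theorem mangoldtCoeff_nonneg (n : ℕ) : 0 ≤ mangoldtCoeff K n :=
  pushCoeff_nonneg PrimePowerIndex.weight_nonneg n

theorem lseries_zetaCoeff_eq_dedekindZeta (s : ℂ) :
    LSeries (fun n ↦ (zetaCoeff K n : ℂ)) s = dedekindZeta K s := by
  refine LSeries_congr (fun {n} hn ↦ ?_) s
  rw [zetaCoeff, pushCoeff, tsum_const, nsmul_one]
  simp only [Complex.ofReal_natCast]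
  congr 1
  refine Nat.card_congr (Equiv.ofBijective (fun I ↦ ⟨I.1.1, I.2⟩) ⟨fun I J h ↦ ?_, fun I ↦ ?_⟩)
  · have h' : (I.1 : Ideal (𝓞 K)) = J.1 :=
      congrArg (fun x : {I : Ideal (𝓞 K) // Ideal.absNorm I = n} ↦ x.1) h
    exact Subtype.ext (Subtype.ext h')
  · refine ⟨⟨⟨I.1, mem_nonZeroDivisors_iff_ne_zero.mpr ?_⟩, I.2⟩, rfl⟩
    intro h0
    apply hn
    rw [← I.2, h0]
    exact Ideal.absNorm_bot

theorem hasSum_weight {s : ℂ} (hs : 1 < s.re) : ∃ L : ℂ, HasSum (fun z : PrimePowerIndex K ↦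
    (z.weight : ℂ) * (Ideal.absNorm (z.ideal : Ideal (𝓞 K)) : ℂ) ^ (-s)) L := by
  obtain ⟨κ, H, -, hZ⟩ := exists_hasSum_ideal K
  set ε := (s.re - 1) / 2 with hε
  have hε0 : 0 < ε := by rw [hε]; linarith
  have h1 := (hZ ((s.re - ε : ℝ) : ℂ) (by rw [Complex.ofReal_re]; linarith)).summable.norm
  have h2 := (h1.mul_left ε⁻¹).comp_injective PrimePowerIndex.ideal_injective
  refine ⟨_, (Summable.of_norm_bounded h2 fun z ↦ ?_).hasSum⟩
  have hpos : (0 : ℝ) < Ideal.absNorm (z.ideal : Ideal (𝓞 K)) := by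
    exact_mod_cast absNorm_coe_pos z.ideal
  rw [Function.comp_apply, norm_mul, Complex.norm_real, Real.norm_of_nonneg z.weight_nonneg,
    Complex.norm_natCast_cpow_of_pos (absNorm_coe_pos _),
    Complex.norm_natCast_cpow_of_pos (absNorm_coe_pos _)]
  have h3 := z.weight_le_log_absNorm.trans (Real.log_le_rpow_div hpos.le hε0)
  calc _ ≤ (Ideal.absNorm (z.ideal : Ideal (𝓞 K)) : ℝ) ^ ε / ε *
        (Ideal.absNorm (z.ideal : Ideal (𝓞 K)) : ℝ) ^ (-s).re := by gcongr
    _ = _ := by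
      rw [div_mul_eq_mul_div, ← Real.rpow_add hpos, div_eq_inv_mul]
      congr 2
      simp
      ring

/-- The logarithmic derivative of the (completed at `1`) Dedekind zeta function. -/
theorem exists_deriv_eq_mangoldt : ∃ G : ℂ → ℂ,
    DifferentiableOn ℂ G {s | 1 - 1 / (finrank ℚ K : ℝ) < s.re} ∧ G 1 ≠ 0 ∧
    ∀ s : ℂ, 1 < s.re → LSeriesSummable (fun n ↦ (mangoldtCoeff K n : ℂ)) s ∧
      deriv G s = G s * (1 / (s - 1) - LSeries (fun n ↦ (mangoldtCoeff K n : ℂ)) s) := by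
  obtain ⟨κ, H, hH, hZ⟩ := exists_hasSum_ideal K
  have hpos : ∀ I : (Ideal (𝓞 K))⁰, Ideal.absNorm (I : Ideal (𝓞 K)) ≠ 0 := fun I ↦
    (absNorm_coe_pos I).ne'
  have hζ : ∀ s : ℂ, 1 < s.re →
      LSeriesHasSum (fun n ↦ (zetaCoeff K n : ℂ)) s (κ / (s - 1) + H s) := fun s hs ↦
    lseriesHasSum_pushCoeff hpos (by simpa using hZ s hs)
  have hd : (0 : ℝ) < finrank ℚ K := by exact_mod_cast finrank_pos
  have hopen : IsOpen {s : ℂ | 1 - 1 / (finrank ℚ K : ℝ) < s.re} :=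
    isOpen_lt continuous_const Complex.continuous_re
  have hmem : ∀ s : ℂ, 1 ≤ s.re → s ∈ {s : ℂ | 1 - 1 / (finrank ℚ K : ℝ) < s.re} := fun s hs ↦ by
    have : 0 < 1 / (finrank ℚ K : ℝ) := by positivity
    change _ < s.re
    linarith
  have habs : LSeries.abscissaOfAbsConv (fun n ↦ (zetaCoeff K n : ℂ)) ≤ (1 : ℝ) :=
    LSeries.abscissaOfAbsConv_le_of_forall_lt_LSeriesSummable fun y hy ↦
      (hζ y (by simpa using hy)).LSeriesSummable
  refine ⟨fun s ↦ κ + (s - 1) * H s, ?_, ?_, fun s hs ↦ ?_⟩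
  · exact (differentiableOn_const _).add ((by fun_prop : DifferentiableOn ℂ (· - (1 : ℂ)) _).mul hH)
  · have h1 := tendsto_sub_one_mul_dedekindZeta_nhdsGT K
    have hH1 : ContinuousAt H 1 :=
      (hH.differentiableAt (hopen.mem_nhds (hmem 1 le_rfl))).continuousAt
    have hc : Tendsto (fun s : ℝ ↦ (s : ℂ)) (𝓝[>] 1) (𝓝 1) :=
      tendsto_nhdsWithin_of_tendsto_nhds (by
        simpa using (Complex.continuous_ofReal.tendsto (1 : ℝ)))
    have h2 : Tendsto (fun s : ℝ ↦ κ + ((s : ℂ) - 1) * H s) (𝓝[>] 1) (𝓝 (κ + (1 - 1) * H 1)) :=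
      tendsto_const_nhds.add ((hc.sub_const 1).mul (hH1.tendsto.comp hc))
    have h3 := tendsto_nhds_unique (h2.congr' ?_) h1
    · simp only [h3]
      exact_mod_cast dedekindZeta_residue_ne_zero K
    · filter_upwards [self_mem_nhdsWithin] with s hs
      have hs' : 1 < (s : ℂ).re := by simpa using hs
      rw [← lseries_zetaCoeff_eq_dedekindZeta, (hζ s hs').LSeries_eq]
      have : (s : ℂ) - 1 ≠ 0 := by
        intro h
        rw [sub_eq_zero.mp h] at hs'
        simp at hs'
      field_simp
  · obtain ⟨L, hL⟩ := hasSum_weight K hs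
    have hL' : LSeriesHasSum (fun n ↦ (mangoldtCoeff K n : ℂ)) s L :=
      lseriesHasSum_pushCoeff (fun z ↦ hpos z.ideal) hL
    have hs1 : s - 1 ≠ 0 := by
      intro h
      rw [sub_eq_zero.mp h] at hs
      simp at hs
    have hlog : LSeriesHasSum (LSeries.logMul fun n ↦ (zetaCoeff K n : ℂ)) s
        (L * (κ / (s - 1) + H s)) := by
      have := lseriesHasSum_pushCoeff hpos (hasSum_log_absNorm (hZ s hs) hL)
      convert this using 1
      funext n
      rw [LSeries.logMul, zetaCoeff, pushCoeff, pushCoeff, ← Complex.natCast_log,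
        ← Complex.ofReal_mul, ← tsum_mul_left]
      congr 1
      refine tsum_congr fun I ↦ ?_
      rw [mul_one, show Ideal.absNorm (I.1 : Ideal (𝓞 K)) = n from I.2]
    have hder : HasDerivAt (LSeries fun n ↦ (zetaCoeff K n : ℂ))
        (-(L * (κ / (s - 1) + H s))) s := by
      rw [← hlog.LSeries_eq]
      exact LSeries_hasDerivAt (habs.trans_lt (by exact_mod_cast hs))
    refine ⟨hL'.LSeriesSummable, ?_⟩
    have h4 : (fun s ↦ κ + (s - 1) * H s) =ᶠ[𝓝 s]
        fun s ↦ (s - 1) * LSeries (fun n ↦ (zetaCoeff K n : ℂ)) s := by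
      filter_upwards [(isOpen_lt continuous_const Complex.continuous_re).mem_nhds hs] with w hw
      have hw1 : w - 1 ≠ 0 := by
        intro h
        have hw : 1 < w.re := hw
        rw [sub_eq_zero.mp h] at hw
        simp at hw
      rw [(hζ w hw).LSeries_eq]
      field_simp
    have h5 := (((hasDerivAt_id s).sub_const 1).mul hder).congr_of_eventuallyEq h4
    rw [h5.deriv, (hζ s hs).LSeries_eq, hL'.LSeries_eq]
    simp only [id]
    field_simp
    ring

end ZetaLogDeriv

section Nonvanishing

open Filter Topology

theorem eventually_ne_zero_and_tendsto_mul_logDeriv {G : ℂ → ℂ} {w : ℂ} (hG : AnalyticAt ℂ G w)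
    (h : analyticOrderAt G w ≠ ⊤) :
    (∀ᶠ ε : ℝ in 𝓝[>] 0, G (w + ε) ≠ 0) ∧
    Tendsto (fun ε : ℝ ↦ (ε : ℂ) * (deriv G (w + ε) / G (w + ε))) (𝓝[>] 0)
      (𝓝 (analyticOrderNatAt G w : ℂ)) := by
  obtain ⟨g, hg, hgw, hGg⟩ := hG.analyticOrderAt_ne_top.mp h
  set m := analyticOrderNatAt G w
  have hc : Tendsto (fun ε : ℝ ↦ w + (ε : ℂ)) (𝓝[>] 0) (𝓝 w) :=
    tendsto_nhdsWithin_of_tendsto_nhds (by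
      simpa using (Complex.continuous_ofReal.tendsto (0 : ℝ)).const_add w)
  have hc0 : Tendsto (fun ε : ℝ ↦ (ε : ℂ)) (𝓝[>] 0) (𝓝 0) :=
    tendsto_nhdsWithin_of_tendsto_nhds (by
      simpa using (Complex.continuous_ofReal.tendsto (0 : ℝ)))
  have hne : ∀ᶠ z in 𝓝 w, g z ≠ 0 := hg.continuousAt.eventually_ne hgw
  have hev := hc.eventually (hGg.eventually_nhds.and (hne.and hg.eventually_analyticAt))
  have hkey : ∀ᶠ ε : ℝ in 𝓝[>] 0, G (w + ε) ≠ 0 ∧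
      (m : ℂ) + ε * (deriv g (w + ε) / g (w + ε)) =
        (ε : ℂ) * (deriv G (w + ε) / G (w + ε)) := by
    filter_upwards [hev, self_mem_nhdsWithin] with ε ⟨h1, h2, h3⟩ (h4 : 0 < ε)
    have h5 : (ε : ℂ) ≠ 0 := by exact_mod_cast h4.ne'
    have h6 : G (w + ε) = (ε : ℂ) ^ m * g (w + ε) := by simpa using h1.self_of_nhds
    refine ⟨by rw [h6]; exact mul_ne_zero (pow_ne_zero _ h5) h2, ?_⟩
    have h7 : logDeriv G (w + ε) = m / ε + logDeriv g (w + ε) := by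
      have hlog : logDeriv G (w + ε) = logDeriv (fun z ↦ (z - w) ^ m * g z) (w + ε) := by
        rw [logDeriv_apply, logDeriv_apply, EventuallyEq.deriv_eq
          (f := fun z ↦ (z - w) ^ m * g z) (h1.mono fun z hz ↦ by simpa using hz), h6]
        simp
      rw [hlog, logDeriv_mul (w + (ε : ℂ)) (by simpa using pow_ne_zero m h5) h2 (by fun_prop)
        h3.differentiableAt]
      congr 1
      rw [logDeriv_fun_pow (by fun_prop), logDeriv_apply]
      simp [div_eq_mul_inv]
    rw [logDeriv_apply, logDeriv_apply] at h7
    rw [h7]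
    field_simp
  refine ⟨hkey.mono fun _ h ↦ h.1, ?_⟩
  refine Tendsto.congr' (hkey.mono fun _ h ↦ h.2) ?_
  have h8 : Tendsto (fun z ↦ deriv g z / g z) (𝓝 w) (𝓝 (deriv g w / g w)) :=
    hg.deriv.continuousAt.div hg.continuousAt hgw
  simpa using (hc0.mul (h8.comp hc)).const_add (m : ℂ)

theorem re_three_four_one_nonneg {c : ℝ} (hc : 0 ≤ c) (n : ℕ) (x t : ℝ) :
    0 ≤ (3 * LSeries.term (fun _ ↦ (c : ℂ)) x n + 4 * LSeries.term (fun _ ↦ (c : ℂ))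
      (x + t * Complex.I) n +
        LSeries.term (fun _ ↦ (c : ℂ)) (x + (2 * t : ℝ) * Complex.I) n).re := by
  rcases Nat.eq_zero_or_pos n with rfl | hn
  · simp
  have hn0 : (n : ℂ) ≠ 0 := Nat.cast_ne_zero.mpr hn.ne'
  set u : ℂ := (n : ℂ) ^ (-(t * Complex.I)) with hu
  have hu1 : ‖u‖ = 1 := by
    rw [hu, Complex.norm_natCast_cpow_of_pos hn]
    simp
  have h2 : (n : ℂ) ^ (-((2 * t : ℝ) * Complex.I)) = u ^ 2 := by
    rw [hu, ← Complex.cpow_nat_mul]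
    congr 1
    push_cast
    ring
  have h3 : (n : ℂ) ^ (-(x : ℂ)) = ((n : ℝ) ^ (-x) : ℝ) := by
    rw [Complex.ofReal_cpow n.cast_nonneg]
    push_cast
    rfl
  have hterm (s : ℂ) : LSeries.term (fun _ ↦ (c : ℂ)) (x + s) n =
      ((c * (n : ℝ) ^ (-x) : ℝ) : ℂ) * (n : ℂ) ^ (-s) := by
    rw [LSeries.term_of_ne_zero hn.ne', div_eq_mul_inv, ← Complex.cpow_neg, neg_add,
      Complex.cpow_add _ _ hn0, h3]
    push_cast
    ring
  have h0 := hterm 0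
  rw [neg_zero, Complex.cpow_zero, add_zero, mul_one] at h0
  rw [h0, hterm, hterm, h2, ← hu]
  have h4 : u.re ^ 2 + u.im ^ 2 = 1 := by
    have := Complex.sq_norm u
    rw [hu1, Complex.normSq_apply] at this
    nlinarith
  set a := c * (n : ℝ) ^ (-x) with ha
  have ha0 : 0 ≤ a := by positivity
  have : (3 * (a : ℂ) + 4 * ((a : ℂ) * u) + a * u ^ 2).re =
      a * (2 * (u.re + 1) ^ 2) := by
    simp only [Complex.add_re, Complex.mul_re, Complex.re_ofNat, Complex.im_ofNat, Complex.mul_im,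
      Complex.ofReal_re, Complex.ofReal_im, pow_two]
    linear_combination -a * h4
  rw [this]
  positivity

/-- A Dirichlet series with nonnegative coefficients that is minus a logarithmic derivative, up to
a simple pole at `1`, extends continuously to `1 ≤ re s` up to this pole. -/
theorem exists_continuousOn_lseries {c : ℕ → ℝ} (hc : ∀ n, 0 ≤ c n) {G : ℂ → ℂ} {θ : ℝ}
    (hθ : θ < 1) (hG : DifferentiableOn ℂ G {s | θ < s.re}) (hG1 : G 1 ≠ 0)
    (hsum : ∀ s : ℂ, 1 < s.re → LSeriesSummable (fun n ↦ (c n : ℂ)) s)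
    (hder : ∀ s : ℂ, 1 < s.re →
      deriv G s = G s * (1 / (s - 1) - LSeries (fun n ↦ (c n : ℂ)) s)) :
    ∃ F : ℂ → ℂ, ContinuousOn F {s | 1 ≤ s.re} ∧
      ∀ s : ℂ, 1 < s.re → LSeries (fun n ↦ (c n : ℂ)) s = 1 / (s - 1) + F s := by
  set L := LSeries (fun n ↦ (c n : ℂ)) with hL
  have hopen : IsOpen {s : ℂ | θ < s.re} := isOpen_lt continuous_const Complex.continuous_re
  have hconv : IsPreconnected {s : ℂ | θ < s.re} := (convex_halfSpace_re_gt θ).isPreconnected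
  have han : AnalyticOnNhd ℂ G {s | θ < s.re} := hG.analyticOnNhd hopen
  have hmem : ∀ s : ℂ, 1 ≤ s.re → s ∈ {s : ℂ | θ < s.re} := fun s hs ↦ hθ.trans_le hs
  have hord : ∀ s : ℂ, 1 ≤ s.re → analyticOrderAt G s ≠ ⊤ := fun s hs ↦
    han.analyticOrderAt_ne_top_of_isPreconnected hconv (hmem 1 le_rfl) (hmem s hs) (by
      rw [(han 1 (hmem 1 le_rfl)).analyticOrderAt_eq_zero.mpr hG1]
      simp)
  have hnat : ∀ s : ℂ, 1 ≤ s.re → analyticOrderNatAt G s = 0 → G s ≠ 0 := fun s hs h0 ↦ by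
    rw [← (han s (hmem s hs)).analyticOrderAt_eq_zero,
      ← Nat.cast_analyticOrderNatAt (hord s hs), h0]
    rfl
  have hL' : ∀ s : ℂ, 1 ≤ s.re → Tendsto (fun ε : ℝ ↦ (ε : ℂ) * (1 / (s + ε - 1) - L (s + ε)))
      (𝓝[>] 0) (𝓝 (analyticOrderNatAt G s : ℂ)) := fun s hs ↦ by
    obtain ⟨h1, h2⟩ := eventually_ne_zero_and_tendsto_mul_logDeriv (han s (hmem s hs)) (hord s hs)
    refine h2.congr' ?_
    filter_upwards [h1, self_mem_nhdsWithin] with ε h3 (h4 : 0 < ε)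
    rw [hder (s + ε) (by simp; linarith), mul_div_cancel_left₀ _ h3]
  have hc0 : Tendsto (fun ε : ℝ ↦ (ε : ℂ)) (𝓝[>] 0) (𝓝 0) :=
    tendsto_nhdsWithin_of_tendsto_nhds (by
      simpa using (Complex.continuous_ofReal.tendsto (0 : ℝ)))
  have hpole : ∀ s : ℂ, s ≠ 1 → Tendsto (fun ε : ℝ ↦ (ε : ℂ) * (1 / (s + ε - 1))) (𝓝[>] 0)
      (𝓝 0) := fun s hs ↦ by
    have h1 : Tendsto (fun ε : ℝ ↦ s + (ε : ℂ) - 1) (𝓝[>] 0) (𝓝 (s - 1)) := by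
      simpa using (hc0.const_add s).sub_const 1
    simpa using hc0.mul (h1.inv₀ (sub_ne_zero.mpr hs))
  have hLlim : ∀ s : ℂ, 1 ≤ s.re → s ≠ 1 → Tendsto (fun ε : ℝ ↦ (ε : ℂ) * L (s + ε)) (𝓝[>] 0)
      (𝓝 (-(analyticOrderNatAt G s : ℂ))) := fun s hs hs1 ↦ by
    have := (hpole s hs1).sub (hL' s hs)
    rw [zero_sub] at this
    refine this.congr fun ε ↦ ?_
    ring
  have hL1 : Tendsto (fun ε : ℝ ↦ (ε : ℂ) * L (1 + ε)) (𝓝[>] 0) (𝓝 1) := by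
    have h0 : analyticOrderNatAt G 1 = 0 := by
      rw [analyticOrderNatAt, (han 1 (hmem 1 le_rfl)).analyticOrderAt_eq_zero.mpr hG1]
      rfl
    have := (hL' 1 le_rfl).const_sub 1
    rw [h0, Nat.cast_zero, sub_zero] at this
    refine this.congr' ?_
    filter_upwards [self_mem_nhdsWithin] with ε (h4 : 0 < ε)
    have h5 : (ε : ℂ) ≠ 0 := by exact_mod_cast h4.ne'
    have h6 : (1 : ℂ) + ε - 1 = ε := by ring
    rw [h6]
    field_simp
    ring
  have hLcont : ∀ s : ℂ, 1 < s.re → ContinuousAt L s := fun s hs ↦ by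
    have habs : LSeries.abscissaOfAbsConv (fun n ↦ (c n : ℂ)) ≤ (1 : ℝ) :=
      LSeries.abscissaOfAbsConv_le_of_forall_lt_LSeriesSummable fun y hy ↦
        hsum y (by simpa using hy)
    exact (LSeries_hasDerivAt (habs.trans_lt (by exact_mod_cast hs))).continuousAt
  have hG0 : ∀ s : ℂ, 1 ≤ s.re → G s ≠ 0 := fun s hs ↦ by
    rcases eq_or_ne s 1 with rfl | hs1
    · exact hG1
    refine hnat s hs ?_
    rcases hs.lt_or_eq with hlt | heq
    · have h1 : Tendsto (fun ε : ℝ ↦ (ε : ℂ) * L (s + ε)) (𝓝[>] 0) (𝓝 0) := by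
        have h2 : Tendsto (fun ε : ℝ ↦ s + (ε : ℂ)) (𝓝[>] 0) (𝓝 s) := by
          simpa using hc0.const_add s
        simpa using hc0.mul ((hLcont s hlt).tendsto.comp h2)
      have := tendsto_nhds_unique (hLlim s hs hs1) h1
      rw [neg_eq_zero] at this
      exact_mod_cast this
    · have hst : s = 1 + s.im * Complex.I := by
        conv_lhs => rw [← Complex.re_add_im s, ← heq, Complex.ofReal_one]
      set t := s.im
      have ht : t ≠ 0 := fun h ↦ hs1 (by rw [hst, h]; simp)
      set s' : ℂ := 1 + (2 * t : ℝ) * Complex.I with hs'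
      have hs'1 : s' ≠ 1 := by
        rw [hs']
        simpa using ht
      have h3 := ((hL1.const_mul 3).add ((hLlim s hs hs1).const_mul 4)).add
        (hLlim s' (by simp [hs']) hs'1)
      have h4 := (Complex.continuous_re.tendsto _).comp h3
      have h5 := ge_of_tendsto (b := 0) h4 ?_
      · simp at h5
        have h6 : (4 * analyticOrderNatAt G s : ℝ) ≤ 3 := by
          have : (0 : ℝ) ≤ analyticOrderNatAt G s' := Nat.cast_nonneg _
          linarith
        have h7 : 4 * analyticOrderNatAt G s ≤ 3 := by exact_mod_cast h6
        omega
      · filter_upwards [self_mem_nhdsWithin] with ε (hε : 0 < ε)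
        have hS : ∀ w : ℂ, 1 ≤ w.re →
            HasSum (LSeries.term (fun n ↦ (c n : ℂ)) (w + ε)) (L (w + ε)) :=
          fun w hw ↦ (hsum _ (by simp; linarith)).LSeriesHasSum
        have h8 := (((hS 1 le_rfl).mul_left 3).add ((hS s hs).mul_left 4)).add
          (hS s' (by simp [hs']))
        have h9 := (Complex.hasSum_re h8).nonneg fun n ↦ by
          have := re_three_four_one_nonneg (hc n) n (1 + ε) t
          have e1 : ((1 + ε : ℝ) : ℂ) = 1 + ε := by push_cast; rfl
          have e2 : ((1 + ε : ℝ) : ℂ) + t * Complex.I = s + ε := by rw [hst]; push_cast; ring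
          have e3 : ((1 + ε : ℝ) : ℂ) + (2 * t : ℝ) * Complex.I = s' + ε := by
            rw [hs']; push_cast; ring
          rw [e2, e3, e1] at this
          simpa only [LSeries.term_def] using this
        have h10 : (3 * ((ε : ℂ) * L (1 + ε)) + 4 * ((ε : ℂ) * L (s + ε)) + (ε : ℂ) * L (s' + ε)) =
            (ε : ℂ) * (3 * L (1 + ε) + 4 * L (s + ε) + L (s' + ε)) := by ring
        rw [Function.comp_apply, h10, Complex.re_ofReal_mul]
        positivity
  refine ⟨fun s ↦ -(deriv G s / G s), fun s hs ↦ ?_, fun s hs ↦ ?_⟩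
  · have ha := han s (hmem s hs)
    exact (ha.deriv.continuousAt.div ha.continuousAt (hG0 s hs)).neg.continuousWithinAt
  · change L s = 1 / (s - 1) + -(deriv G s / G s)
    rw [hder s hs, mul_div_cancel_left₀ _ (hG0 s hs.le)]
    ring

variable (K : Type*) [Field K] [NumberField K]

theorem lseriesSummable_mangoldtCoeff {s : ℂ} (hs : 1 < s.re) :
    LSeriesSummable (fun n ↦ (mangoldtCoeff K n : ℂ)) s := by
  obtain ⟨G, -, -, h⟩ := exists_deriv_eq_mangoldt K
  exact (h s hs).1

theorem exists_continuousOn_lseries_mangoldtCoeff :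
    ∃ F : ℂ → ℂ, ContinuousOn F {s | 1 ≤ s.re} ∧
      ∀ s : ℂ, 1 < s.re → LSeries (fun n ↦ (mangoldtCoeff K n : ℂ)) s = 1 / (s - 1) + F s := by
  obtain ⟨G, hG, hG1, h⟩ := exists_deriv_eq_mangoldt K
  have hd : (0 : ℝ) < Module.finrank ℚ K := by exact_mod_cast Module.finrank_pos
  exact exists_continuousOn_lseries (mangoldtCoeff_nonneg K) (sub_lt_self _ (by positivity)) hG hG1
    (fun s hs ↦ (h s hs).1) fun s hs ↦ (h s hs).2

end Nonvanishing

section Chebyshev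

open NumberField Module
open scoped ArithmeticFunction.vonMangoldt

variable (K : Type*) [Field K] [NumberField K]

/-- The number of ideals of norm `p`; for a prime number `p` these are the primes of degree one
above `p`. -/
noncomputable def degreeOneCount (p : ℕ) : ℕ :=
  Nat.card {P : Ideal (𝓞 K) // Ideal.absNorm P = p}

variable {K} in
theorem prime_of_absNorm_eq {p : ℕ} (hp : p.Prime) {P : Ideal (𝓞 K)} (h : Ideal.absNorm P = p) :
    Prime P := by
  have h0 : P ≠ ⊥ := by
    rintro rfl
    rw [Ideal.absNorm_bot] at h
    exact hp.ne_zero h.symm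
  have : P.IsPrime := Ideal.isPrime_of_irreducible_absNorm (by rw [h]; exact hp)
  exact Ideal.prime_of_isPrime h0 this

theorem mangoldtCoeff_prime {p : ℕ} (hp : p.Prime) :
    mangoldtCoeff K p = degreeOneCount K p * Real.log p := by
  have hnorm : ∀ z : PrimePowerIndex K, Ideal.absNorm (z.ideal : Ideal (𝓞 K)) =
      Ideal.absNorm z.1.1 ^ (z.2 + 1) := fun z ↦ map_pow _ _ _
  have key : ∀ z : PrimePowerIndex K, Ideal.absNorm (z.ideal : Ideal (𝓞 K)) = p →
      z.2 = 0 ∧ Ideal.absNorm z.1.1 = p := fun z hz ↦ by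
    rw [hnorm] at hz
    have h1 : z.2 + 1 = 1 := Nat.Prime.eq_one_of_pow (hz ▸ hp)
    rw [h1, pow_one] at hz
    exact ⟨by lia, hz⟩
  rw [mangoldtCoeff, pushCoeff]
  have hw : ∀ z : (fun z : PrimePowerIndex K ↦ Ideal.absNorm (z.ideal : Ideal (𝓞 K))) ⁻¹' {p},
      z.1.weight = Real.log p := fun z ↦ by
    rw [PrimePowerIndex.weight, (key z.1 z.2).2]
  rw [tsum_congr hw, tsum_const, nsmul_eq_mul, degreeOneCount]
  congr 2
  refine Nat.card_congr (Equiv.ofBijective (fun z ↦ ⟨z.1.1.1, (key z.1 z.2).2⟩)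
    ⟨fun z w h ↦ ?_, fun P ↦ ?_⟩)
  · have h1 : z.1.1.1 = w.1.1.1 :=
      congrArg (fun x : {I : Ideal (𝓞 K) // Ideal.absNorm I = p} ↦ x.1) h
    exact Subtype.ext (Sigma.ext (Subtype.ext h1)
      (heq_of_eq ((key z.1 z.2).1.trans (key w.1 w.2).1.symm)))
  · refine ⟨⟨⟨⟨P.1, prime_of_absNorm_eq hp P.2⟩, 0⟩, ?_⟩, rfl⟩
    change Ideal.absNorm _ = p
    rw [hnorm, zero_add, pow_one, P.2]

theorem mangoldtCoeff_le (n : ℕ) : mangoldtCoeff K n ≤ finrank ℚ K * Λ n := by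
  classical
  have hnorm : ∀ z : PrimePowerIndex K, Ideal.absNorm (z.ideal : Ideal (𝓞 K)) =
      Ideal.absNorm z.1.1 ^ (z.2 + 1) := fun z ↦ map_pow _ _ _
  have hnn : (0 : ℝ) ≤ finrank ℚ K * Λ n :=
    mul_nonneg (Nat.cast_nonneg _) ArithmeticFunction.vonMangoldt_nonneg
  refine Real.tsum_le_of_sum_le (fun z ↦ z.1.weight_nonneg) fun S ↦ ?_
  rcases S.eq_empty_or_nonempty with rfl | ⟨z₀, -⟩
  · simpa using hnn
  have hz : ∀ z : (fun z : PrimePowerIndex K ↦ Ideal.absNorm (z.ideal : Ideal (𝓞 K))) ⁻¹' {n},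
      Ideal.absNorm z.1.1.1 ^ (z.1.2 + 1) = n := fun z ↦ (hnorm z.1).symm.trans z.2
  have hmax : ∀ P : {P : Ideal (𝓞 K) // Prime P}, P.1.IsMaximal := fun P ↦
    (Ideal.isPrime_of_prime P.2).isMaximal P.2.ne_zero
  have := hmax z₀.1.1
  obtain ⟨p, f, hf, hpP, hp, hN⟩ := Ideal.exists_prime_and_absNorm_eq_pow z₀.1.1.1
  have hn : n = p ^ (f * (z₀.1.2 + 1)) := (hz z₀).symm.trans (by rw [hN, pow_mul])
  have hΛ : Λ n = Real.log p := by
    rw [hn, ArithmeticFunction.vonMangoldt_apply_pow (by positivity),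
      ArithmeticFunction.vonMangoldt_apply_prime hp]
  set I : Ideal (𝓞 K) := Ideal.span {(p : 𝓞 K)} with hI
  have hIN : Ideal.absNorm I = p ^ finrank ℚ K := by
    rw [hI, Ideal.absNorm_span_singleton, ← RingOfIntegers.rank K]
    have := Algebra.norm_algebraMap (S := 𝓞 K) (p : ℤ)
    rw [map_natCast] at this
    rw [this, Int.natAbs_pow, Int.natAbs_natCast]
  have hdvd : ∀ z : (fun z : PrimePowerIndex K ↦ Ideal.absNorm (z.ideal : Ideal (𝓞 K))) ⁻¹' {n},
      z.1.1.1 ∣ I := fun z ↦ by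
    have := hmax z.1.1
    rw [Ideal.dvd_iff_le, hI, Ideal.span_singleton_le_iff_mem]
    have h1 : ((Ideal.absNorm z.1.1.1 ^ (z.1.2 + 1) : ℕ) : 𝓞 K) ∈ z.1.1.1 := by
      rw [pow_succ, Nat.cast_mul]
      exact Ideal.mul_mem_left _ _ (Ideal.absNorm_mem _)
    rw [(hz z).trans hn, Nat.cast_pow] at h1
    exact Ideal.IsPrime.mem_of_pow_mem inferInstance _ h1
  have hinj : Set.InjOn (fun z : (fun z : PrimePowerIndex K ↦
      Ideal.absNorm (z.ideal : Ideal (𝓞 K))) ⁻¹' {n} ↦ z.1.1.1) S := by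
    intro z _ w _ (h : z.1.1.1 = w.1.1.1)
    have h1 := (hz z).trans (hz w).symm
    rw [h] at h1
    have h2 := Nat.pow_right_injective (PrimePowerIndex.one_lt_absNorm w.1.1.2) h1
    exact Subtype.ext (Sigma.ext (Subtype.ext h) (heq_of_eq (by lia)))
  have hprod : ∏ z ∈ S, z.1.1.1 ∣ I := by
    refine (Finset.prod_image (f := fun P : Ideal (𝓞 K) ↦ P) hinj).symm.dvd.trans ?_
    refine Finset.prod_primes_dvd _ (fun P hP ↦ ?_) fun P hP ↦ ?_
    · obtain ⟨z, -, rfl⟩ := Finset.mem_image.mp hP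
      exact z.1.1.2
    · obtain ⟨z, -, rfl⟩ := Finset.mem_image.mp hP
      exact hdvd z
  have hle : ∏ z ∈ S, Ideal.absNorm z.1.1.1 ≤ p ^ finrank ℚ K := by
    rw [← hIN, ← map_prod]
    exact Nat.le_of_dvd (by rw [hIN]; exact pow_pos hp.pos _) (map_dvd _ hprod)
  have hpos : ∀ z ∈ S, (Ideal.absNorm z.1.1.1 : ℝ) ≠ 0 := fun z _ ↦
    Nat.cast_ne_zero.mpr (pos_of_gt (PrimePowerIndex.one_lt_absNorm z.1.1.2)).ne'
  calc ∑ z ∈ S, z.1.weight = Real.log (∏ z ∈ S, (Ideal.absNorm z.1.1.1 : ℝ)) :=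
        (Real.log_prod hpos).symm
    _ ≤ Real.log ((p : ℝ) ^ finrank ℚ K) := by
        refine Real.log_le_log (Finset.prod_pos fun z hz ↦
          lt_of_le_of_ne (Nat.cast_nonneg _) (hpos z hz).symm) ?_
        exact_mod_cast hle
    _ = _ := by rw [Real.log_pow, hΛ]

end Chebyshev

section Tauberian

open Filter Topology MeasureTheory Real
open scoped FourierTransform ContDiff

theorem exists_fourier_kernel : ∃ η : ℝ → ℂ, Continuous η ∧ HasCompactSupport η ∧
    Continuous (𝓕 η) ∧ Integrable (𝓕 η) ∧ Integrable (fun x ↦ |x| * ‖𝓕 η x‖) ∧ ∫ x, 𝓕 η x = 1 := by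
  obtain ⟨g, -, hg, hsm, -, hg0⟩ := exists_contDiff_tsupport_subset (E := ℝ) (n := ⊤)
    (univ_mem : Set.univ ∈ 𝓝 (0 : ℝ))
  have hsm' : ContDiff ℝ ∞ (fun x ↦ (g x : ℂ)) := Complex.ofRealCLM.contDiff.comp hsm
  have hg' : HasCompactSupport (fun x ↦ (g x : ℂ)) := hg.comp_left Complex.ofReal_zero
  set f := hg'.toSchwartzMap hsm' with hf
  have hcoe : (f : ℝ → ℂ) = fun x ↦ (g x : ℂ) := rfl
  have hF : 𝓕 (fun x ↦ (g x : ℂ)) = (𝓕 f : SchwartzMap ℝ ℂ) := by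
    rw [SchwartzMap.fourier_coe, hcoe]
  refine ⟨fun x ↦ (g x : ℂ), hsm'.continuous, hg', ?_, ?_, ?_, ?_⟩
  · rw [hF]
    exact (𝓕 f).continuous
  · rw [hF]
    exact (𝓕 f).integrable
  · rw [hF]
    exact ((𝓕 f).integrable_pow_mul volume 1).congr
      (ae_of_all _ fun x ↦ by simp only [pow_one, Real.norm_eq_abs])
  · have h1 : 𝓕⁻ (𝓕 f) = f := by simp
    have h2 : (𝓕⁻ (𝓕 f) : SchwartzMap ℝ ℂ) 0 = 1 := by
      rw [h1, hcoe]
      simp [hg0]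
    rw [SchwartzMap.fourierInv_coe, Real.fourierInv_eq'] at h2
    rw [hF, ← h2]
    simp

variable {h : ℝ → ℝ} {D : ℂ → ℂ} {B : ℝ}

theorem integrable_mul_exp_neg (hm : Measurable h) (h0 : ∀ t < 0, h t = 0)
    (hB : ∀ t, |h t| ≤ B) {ε : ℝ} (hε : 0 < ε) :
    Integrable fun t ↦ (h t : ℂ) * (Real.exp (-ε * t) : ℝ) := by
  have h1 : Integrable (Set.indicator (Set.Ioi 0) fun t ↦ B * Real.exp (-ε * t)) :=
    IntegrableOn.integrable_indicator ((exp_neg_integrableOn_Ioi 0 hε).const_mul B)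
      measurableSet_Ioi
  refine h1.mono' (by fun_prop) ?_
  have h2 : ∀ᵐ t : ℝ, t ≠ 0 := Measure.ae_ne volume 0
  filter_upwards [h2] with t ht
  rcases lt_or_gt_of_ne ht with ht | ht
  · rw [h0 t ht]
    simp [ht.le]
  · rw [Set.indicator_of_mem (Set.mem_Ioi.mpr ht), norm_mul, Complex.norm_real, Complex.norm_real,
      norm_of_nonneg (exp_pos _).le]
    gcongr
    exact hB t

theorem integral_mul_fourier_eq (hm : Measurable h) (h0 : ∀ t < 0, h t = 0)
    (hB : ∀ t, |h t| ≤ B)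
    (hL : ∀ z : ℂ, 0 < z.re → ∫ t, (h t : ℂ) * Complex.exp (-(z * t)) = D z)
    {η : ℝ → ℂ} (hη : Integrable η) {ε : ℝ} (hε : 0 < ε) (T : ℝ) :
    ∫ t, (h t : ℂ) * (Real.exp (-ε * t) : ℝ) * 𝓕 η (T - t) =
      𝓕 (fun v : ℝ ↦ η v * D (ε - 2 * π * v * Complex.I)) T := by
  simp_rw [Real.fourier_real_eq_integral_exp_smul, smul_eq_mul]
  simp_rw [← integral_const_mul]
  rw [integral_integral_swap]
  · refine integral_congr_ae (ae_of_all _ fun v ↦ ?_)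
    simp only
    rw [← hL _ (by simpa using hε), ← integral_const_mul, ← integral_const_mul]
    refine integral_congr_ae (ae_of_all _ fun t ↦ ?_)
    have h3 : Complex.exp (((-2 * π * v * (T - t) : ℝ) : ℂ) * Complex.I) * (Real.exp (-ε * t) : ℝ) =
        Complex.exp (((-2 * π * v * T : ℝ) : ℂ) * Complex.I) *
          Complex.exp (-((ε - 2 * π * v * Complex.I) * t)) := by
      rw [Complex.ofReal_exp, ← Complex.exp_add, ← Complex.exp_add]
      congr 1
      push_cast
      ring
    simp only
    linear_combination (h t : ℂ) * η v * h3
  · have h4 := (integrable_mul_exp_neg hm h0 hB hε).mul_prod hη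
    refine (h4.bdd_mul (c := 1) (f := fun z : ℝ × ℝ ↦
      Complex.exp (((-2 * π * z.2 * (T - z.1) : ℝ) : ℂ) * Complex.I))
      (by fun_prop) (ae_of_all _ fun z ↦ (Complex.norm_exp_ofReal_mul_I _).le)).congr
      (ae_of_all _ fun z ↦ ?_)
    simp only [Function.uncurry]
    ring

theorem tendsto_integral_mul_fourier (hm : Measurable h) (h0 : ∀ t < 0, h t = 0)
    (hB : ∀ t, |h t| ≤ B) (hD : ContinuousOn D {z | 0 ≤ z.re})
    (hL : ∀ z : ℂ, 0 < z.re → ∫ t, (h t : ℂ) * Complex.exp (-(z * t)) = D z)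
    {η : ℝ → ℂ} (hη : Continuous η) (hηc : HasCompactSupport η) (hF : Integrable (𝓕 η))
    (hFc : Continuous (𝓕 η)) :
    Tendsto (fun T ↦ ∫ t, (h t : ℂ) * 𝓕 η (T - t)) atTop (𝓝 0) := by
  have hηi : Integrable η := hη.integrable_of_hasCompactSupport hηc
  have hB0 : 0 ≤ B := (abs_nonneg _).trans (hB 0)
  have hDc : ContinuousOn (fun x : ℝ × ℝ ↦ D (x.1 - 2 * π * x.2 * Complex.I))
      {x | 0 ≤ x.1} := hD.comp (by fun_prop) fun x hx ↦ by
    simpa using hx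
  have key : ∀ T, ∫ t, (h t : ℂ) * 𝓕 η (T - t) =
      𝓕 (fun v : ℝ ↦ η v * D ((0 : ℝ) - 2 * π * v * Complex.I)) T := fun T ↦ by
    have l1 : Tendsto (fun ε : ℝ ↦ ∫ t, (h t : ℂ) * (Real.exp (-ε * t) : ℝ) * 𝓕 η (T - t)) (𝓝[>] 0)
        (𝓝 (∫ t, (h t : ℂ) * 𝓕 η (T - t))) := by
      refine tendsto_integral_filter_of_dominated_convergence (fun t ↦ B * ‖𝓕 η (T - t)‖)
        (Eventually.of_forall fun ε ↦ by fun_prop) ?_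
        ((hF.comp_sub_left T).norm.const_mul B) (ae_of_all _ fun t ↦ ?_)
      · filter_upwards [self_mem_nhdsWithin] with ε (hε : 0 < ε)
        refine ae_of_all _ fun t ↦ ?_
        rw [norm_mul, norm_mul, Complex.norm_real, Complex.norm_real, norm_of_nonneg (exp_pos _).le]
        gcongr
        rcases lt_or_ge t 0 with ht | ht
        · rw [h0 t ht]
          simpa using hB0
        · refine (mul_le_of_le_one_right (norm_nonneg _) ?_).trans (hB t)
          rw [Real.exp_le_one_iff]
          nlinarith
      · have hc : Continuous fun ε : ℝ ↦ (h t : ℂ) * (Real.exp (-ε * t) : ℝ) * 𝓕 η (T - t) := by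
          fun_prop
        have := (hc.tendsto 0).mono_left (nhdsWithin_le_nhds (s := Set.Ioi 0))
        simpa using this
    have l2 : Tendsto (fun ε : ℝ ↦ 𝓕 (fun v : ℝ ↦ η v * D (ε - 2 * π * v * Complex.I)) T) (𝓝[>] 0)
        (𝓝 (𝓕 (fun v : ℝ ↦ η v * D ((0 : ℝ) - 2 * π * v * Complex.I)) T)) := by
      simp_rw [Real.fourier_real_eq_integral_exp_smul, smul_eq_mul]
      obtain ⟨C, hC⟩ := (isCompact_Icc.prod hηc).exists_bound_of_continuousOn
        (hDc.mono fun x hx ↦ hx.1.1 : ContinuousOn _ (Set.Icc (0 : ℝ) 1 ×ˢ tsupport η))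
      have hmem : ∀ᶠ ε : ℝ in 𝓝[>] 0, ε ∈ Set.Icc (0 : ℝ) 1 :=
        Icc_mem_nhdsGT one_pos
      refine tendsto_integral_filter_of_dominated_convergence (fun v ↦ ‖η v‖ * C) ?_ ?_
        (hηi.norm.mul_const C) (ae_of_all _ fun v ↦ ?_)
      · filter_upwards [hmem] with ε hε
        have : Continuous fun v : ℝ ↦ D (ε - 2 * π * v * Complex.I) :=
          hDc.comp_continuous (f := fun v : ℝ ↦ (ε, v)) (by fun_prop) fun v ↦ hε.1
        exact ((by fun_prop : Continuous fun v : ℝ ↦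
          Complex.exp (((-2 * π * v * T : ℝ) : ℂ) * Complex.I)).mul
          (hη.mul this)).aestronglyMeasurable
      · filter_upwards [hmem] with ε hε
        refine ae_of_all _ fun v ↦ ?_
        rw [norm_mul, norm_mul, Complex.norm_exp_ofReal_mul_I, one_mul]
        by_cases hv : v ∈ tsupport η
        · gcongr
          exact hC (ε, v) ⟨hε, hv⟩
        · rw [image_eq_zero_of_notMem_tsupport hv]
          simp
      · refine Tendsto.const_mul _ (Tendsto.const_mul _ ?_)
        have h5 := hDc (0, v) (le_refl (0 : ℝ))
        refine Tendsto.comp (g := fun x : ℝ × ℝ ↦ D (x.1 - 2 * π * x.2 * Complex.I))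
          (f := fun ε : ℝ ↦ (ε, v)) h5 (tendsto_nhdsWithin_iff.mpr ⟨?_, ?_⟩)
        · exact ((Continuous.prodMk continuous_id continuous_const).tendsto (0 : ℝ)).mono_left
            nhdsWithin_le_nhds
        · filter_upwards [hmem] with ε hε using hε.1
    refine tendsto_nhds_unique l1 (l2.congr' ?_)
    filter_upwards [self_mem_nhdsWithin] with ε (hε : 0 < ε)
    exact (integral_mul_fourier_eq hm h0 hB hL hηi hε T).symm
  simp_rw [key]
  exact (Real.zero_at_infty_fourier _).mono_left atTop_le_cocompact

theorem exists_eventually_abs_le : ∃ C : ℝ, 0 ≤ C ∧ ∀ (h : ℝ → ℝ) (D : ℂ → ℂ) (B M : ℝ),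
    Measurable h → (∀ t < 0, h t = 0) → (∀ t, |h t| ≤ B) → 0 < M →
    (∀ s t, 0 ≤ s → s ≤ t → |h t - h s| ≤ M * (t - s)) → ContinuousOn D {z | 0 ≤ z.re} →
    (∀ z : ℂ, 0 < z.re → ∫ t, (h t : ℂ) * Complex.exp (-(z * t)) = D z) →
    ∀ δ > 0, ∀ᶠ T in atTop, |h T| ≤ M * C + δ := by
  obtain ⟨η, hη, hηc, hFc, hF, hF1, h_int⟩ := exists_fourier_kernel
  refine ⟨∫ x, |x| * ‖𝓕 η x‖, integral_nonneg fun _ ↦ by positivity,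
    fun h D B M hm h0 hB hM hlip hD hL δ hδ ↦ ?_⟩
  have h1 := tendsto_integral_mul_fourier hm h0 hB hD hL hη hηc hF hFc
  filter_upwards [eventually_ge_atTop 0, eventually_ge_atTop (B / M),
    (tendsto_zero_iff_norm_tendsto_zero.mp h1).eventually_le_const hδ] with T hT hTB hTδ
  have hI : Integrable fun t ↦ (h t : ℂ) * 𝓕 η (T - t) :=
    (hF.comp_sub_left T).bdd_mul (c := B) (by fun_prop) (ae_of_all _ fun t ↦ by
      rw [Complex.norm_real]
      exact hB t)
  have h2 : (h T : ℂ) = ∫ t, (h T : ℂ) * 𝓕 η (T - t) := by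
    rw [integral_const_mul, integral_sub_left_eq_self (𝓕 η) volume T, h_int, mul_one]
  have h3 : ‖(h T : ℂ) - ∫ t, (h t : ℂ) * 𝓕 η (T - t)‖ ≤ M * ∫ x, |x| * ‖𝓕 η x‖ := by
    conv_lhs => rw [h2]
    rw [← integral_sub ((hF.comp_sub_left T).const_mul _) hI, ← integral_const_mul,
      ← integral_sub_left_eq_self (fun x ↦ M * (|x| * ‖𝓕 η x‖)) volume T]
    refine norm_integral_le_of_norm_le ((hF1.const_mul M).comp_sub_left T) (ae_of_all _ fun t ↦ ?_)
    rw [← sub_mul, norm_mul, ← Complex.ofReal_sub, Complex.norm_real, ← mul_assoc]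
    gcongr
    rw [Real.norm_eq_abs]
    rcases lt_or_ge t 0 with ht | ht
    · rw [h0 t ht, sub_zero]
      have h4 : T ≤ |T - t| := (by linarith : T ≤ T - t).trans (le_abs_self _)
      calc |h T| ≤ B := hB T
        _ ≤ M * T := by rwa [div_le_iff₀' hM] at hTB
        _ ≤ _ := by gcongr
    · rcases le_total t T with htT | htT
      · rw [abs_of_nonneg (sub_nonneg.mpr htT)]
        exact hlip t T ht htT
      · rw [abs_sub_comm, abs_sub_comm T, abs_of_nonneg (sub_nonneg.mpr htT)]
        exact hlip T t hT htT
  calc |h T| = ‖(h T : ℂ)‖ := by rw [Complex.norm_real, Real.norm_eq_abs]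
    _ = ‖((h T : ℂ) - ∫ t, (h t : ℂ) * 𝓕 η (T - t)) + ∫ t, (h t : ℂ) * 𝓕 η (T - t)‖ := by
      rw [sub_add_cancel]
    _ ≤ _ := (norm_add_le _ _).trans (add_le_add h3 hTδ)

/-- A Tauberian theorem: a bounded function that is Lipschitz on `[0, ∞)` tends to zero if its
Laplace transform extends continuously to the imaginary axis. -/
theorem tendsto_zero_of_laplace {M : ℝ} (hm : Measurable h) (h0 : ∀ t < 0, h t = 0)
    (hB : ∀ t, |h t| ≤ B) (hM : 0 < M)
    (hlip : ∀ s t, 0 ≤ s → s ≤ t → |h t - h s| ≤ M * (t - s))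
    (hD : ContinuousOn D {z | 0 ≤ z.re})
    (hL : ∀ z : ℂ, 0 < z.re → ∫ t, (h t : ℂ) * Complex.exp (-(z * t)) = D z) :
    Tendsto h atTop (𝓝 0) := by
  obtain ⟨C, hC, hmain⟩ := exists_eventually_abs_le
  rw [tendsto_zero_iff_abs_tendsto_zero, Metric.tendsto_atTop']
  intro δ hδ
  set l : ℝ := (M * C + 1) * 3 / δ with hl
  have hl0 : 0 < l := by positivity
  have h1 := hmain (fun t ↦ h (t / l)) (fun z ↦ l * D (l * z)) B (M / l)
    (hm.comp (measurable_id.div_const l)) (fun t ht ↦ h0 _ (div_neg_of_neg_of_pos ht hl0))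
    (fun t ↦ hB _) (by positivity) (fun s t hs hst ↦ by
      refine (hlip (s / l) (t / l) (by positivity) (by gcongr)).trans (le_of_eq ?_)
      field_simp) (continuousOn_const.mul (hD.comp (by fun_prop) fun z (hz : 0 ≤ z.re) ↦ by
        simpa using mul_nonneg hl0.le hz)) (fun z hz ↦ by
      rw [← hL (l * z) (by simpa using mul_pos hl0 hz)]
      have := Measure.integral_comp_div (fun t : ℝ ↦ (h t : ℂ) * Complex.exp (-(l * z * t))) l
      rw [abs_of_pos hl0, Complex.real_smul] at this
      rw [← this]
      refine integral_congr_ae (ae_of_all _ fun t ↦ ?_)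
      have hl1 : (l : ℂ) ≠ 0 := by exact_mod_cast hl0.ne'
      simp only
      congr 3
      push_cast
      field_simp) (δ / 3) (by positivity)
  obtain ⟨N, hN⟩ := eventually_atTop.mp h1
  refine ⟨N / l, fun T hT ↦ ?_⟩
  have h2 := hN (T * l) (by
    have := (div_lt_iff₀ hl0).mp hT
    exact this.le)
  simp only [mul_div_cancel_right₀ _ hl0.ne'] at h2
  rw [Function.comp_apply, dist_zero_right, norm_abs_eq_norm, Real.norm_eq_abs]
  have h3 : M / l * C ≤ δ / 3 := by
    rw [hl]
    field_simp
    linarith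
  linarith

end Tauberian

section WienerIkehara

open Filter Topology MeasureTheory Real Finset

/-- The summatory function of an arithmetic function. -/
noncomputable def summatory (c : ℕ → ℝ) (x : ℝ) : ℝ := ∑ n ∈ Ioc 0 ⌊x⌋₊, c n

/-- The integral of the summatory function. -/
noncomputable def rieszSum (c : ℕ → ℝ) (x : ℝ) : ℝ := ∑ n ∈ Ioc 0 ⌊x⌋₊, c n * (x - n)

variable {c : ℕ → ℝ}

theorem rieszSum_eq {x : ℝ} {N : ℕ} (h : ⌊x⌋₊ ≤ N) :
    rieszSum c x = ∑ n ∈ Ioc 0 N, c n * max (x - n) 0 := by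
  rw [rieszSum, ← sum_subset (Ioc_subset_Ioc_right h) (fun n hn hn' ↦ ?_)]
  · refine sum_congr rfl fun n hn ↦ ?_
    rw [mem_Ioc, Nat.le_floor_iff' (by grind)] at hn
    rw [max_eq_left (by linarith)]
  · have h1 : ⌊x⌋₊ < n := by grind
    have h2 := Nat.lt_of_floor_lt h1
    rw [max_eq_right (by linarith), mul_zero]

theorem summatory_eq {x : ℝ} {N : ℕ} (h : ⌊x⌋₊ ≤ N) :
    summatory c x = ∑ n ∈ Ioc 0 N, if (n : ℝ) ≤ x then c n else 0 := by
  rw [summatory, ← sum_filter]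
  refine sum_congr (Finset.ext fun n ↦ ?_) fun _ _ ↦ rfl
  rw [mem_filter, mem_Ioc, mem_Ioc]
  constructor
  · rintro ⟨h1, h2⟩
    exact ⟨⟨h1, h2.trans h⟩, (Nat.le_floor_iff' h1.ne').mp h2⟩
  · rintro ⟨⟨h1, -⟩, h2⟩
    exact ⟨h1, (Nat.le_floor_iff' h1.ne').mpr h2⟩

theorem sub_mul_summatory_le (hc : ∀ n, 0 ≤ c n) {x y : ℝ} (h : x ≤ y) :
    (y - x) * summatory c x ≤ rieszSum c y - rieszSum c x := by
  rw [rieszSum_eq le_rfl, rieszSum_eq (Nat.floor_mono h), summatory_eq (Nat.floor_mono h), mul_sum,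
    ← sum_sub_distrib]
  refine sum_le_sum fun n _ ↦ ?_
  have := hc n
  rw [← mul_sub]
  split_ifs with hn
  · rw [max_eq_left (by linarith), max_eq_left (by linarith)]
    nlinarith
  · rw [mul_zero]
    exact mul_nonneg this (sub_nonneg.mpr (max_le_max_right _ (by linarith)))

theorem rieszSum_sub_le (hc : ∀ n, 0 ≤ c n) {x y : ℝ} (h : x ≤ y) :
    rieszSum c y - rieszSum c x ≤ (y - x) * summatory c y := by
  rw [rieszSum_eq le_rfl, rieszSum_eq (Nat.floor_mono h), summatory, mul_sum,
    ← sum_sub_distrib]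
  refine sum_le_sum fun n hn ↦ ?_
  rw [mem_Ioc, Nat.le_floor_iff' (by grind)] at hn
  rw [← mul_sub, mul_comm]
  refine mul_le_mul_of_nonneg_right ?_ (hc n)
  rw [max_eq_left (by linarith)]
  linarith [le_max_left (x - n) 0]

theorem summatory_nonneg (hc : ∀ n, 0 ≤ c n) (x : ℝ) : 0 ≤ summatory c x :=
  sum_nonneg fun n _ ↦ hc n

theorem rieszSum_of_lt_one {x : ℝ} (hx : x < 1) : rieszSum c x = 0 := by
  rw [rieszSum, Nat.floor_eq_zero.mpr hx]
  simp

theorem rieszSum_nonneg (hc : ∀ n, 0 ≤ c n) (x : ℝ) : 0 ≤ rieszSum c x := by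
  rw [rieszSum_eq le_rfl]
  exact sum_nonneg fun n _ ↦ mul_nonneg (hc n) (le_max_right _ _)

theorem measurable_rieszSum : Measurable (rieszSum c) := by
  have : Measurable fun z : ℕ × ℝ ↦ ∑ n ∈ Ioc 0 z.1, c n * (z.2 - n) :=
    measurable_from_prod_countable_right fun m ↦
      Finset.measurable_fun_sum (Ioc 0 m) (f := fun n (y : ℝ) ↦ c n * (y - n))
        fun n _ ↦ by fun_prop
  exact this.comp (Nat.measurable_floor.prodMk measurable_id)

/-- The normalized integral of the summatory function, in a logarithmic variable. -/
noncomputable def logRiesz (c : ℕ → ℝ) (t : ℝ) : ℝ := exp (-(2 * t)) * rieszSum c (exp t)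

theorem measurable_logRiesz : Measurable (logRiesz c) := by
  have := (measurable_rieszSum (c := c)).comp measurable_exp
  unfold logRiesz
  exact Measurable.mul (by fun_prop) this

theorem logRiesz_of_neg {t : ℝ} (ht : t < 0) : logRiesz c t = 0 := by
  rw [logRiesz, rieszSum_of_lt_one (exp_lt_one_iff.mpr ht), mul_zero]

theorem logRiesz_nonneg (hc : ∀ n, 0 ≤ c n) (t : ℝ) : 0 ≤ logRiesz c t :=
  mul_nonneg (exp_pos _).le (rieszSum_nonneg hc _)

theorem exp_neg_two_mul (t : ℝ) : exp (-(2 * t)) = (exp t ^ 2)⁻¹ := by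
  rw [Real.exp_neg, ← Real.exp_nat_mul]
  norm_num

variable {C : ℝ}

theorem rieszSum_le (hc : ∀ n, 0 ≤ c n) (hC : ∀ x, 0 ≤ x → summatory c x ≤ C * x) {x : ℝ}
    (hx : 0 ≤ x) : rieszSum c x ≤ C * x ^ 2 := by
  have h1 := rieszSum_sub_le hc hx
  rw [rieszSum_of_lt_one zero_lt_one, sub_zero, sub_zero] at h1
  nlinarith [hC x hx]

theorem logRiesz_le (hc : ∀ n, 0 ≤ c n) (hC : ∀ x, 0 ≤ x → summatory c x ≤ C * x) (t : ℝ) :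
    logRiesz c t ≤ C := by
  rw [logRiesz, exp_neg_two_mul, inv_mul_le_iff₀ (by positivity), mul_comm]
  exact rieszSum_le hc hC (exp_pos t).le

theorem abs_logRiesz_sub_le (hc : ∀ n, 0 ≤ c n) (hC : ∀ x, 0 ≤ x → summatory c x ≤ C * x)
    {s t : ℝ} (hst : s ≤ t) : |logRiesz c t - logRiesz c s| ≤ 2 * C * (t - s) := by
  have hC0 : 0 ≤ C := by simpa using (summatory_nonneg hc 1).trans (hC 1 zero_le_one)
  set a := exp s with ha
  set b := exp t with hb
  have ha0 : 0 < a := exp_pos s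
  have hb0 : 0 < b := exp_pos t
  have hab : a ≤ b := exp_le_exp.mpr hst
  have h1 := sub_mul_summatory_le hc hab
  have h2 := rieszSum_sub_le hc hab
  have h3 := hC b hb0.le
  have h4 := rieszSum_le hc hC ha0.le
  have h5 := rieszSum_nonneg hc a
  have h6 := mul_nonneg (sub_nonneg.mpr hab) (summatory_nonneg hc a)
  have hexp : b - a ≤ b * (t - s) := by
    have : a = b * exp (s - t) := by rw [ha, hb, ← exp_add]; ring_nf
    have h7 := add_one_le_exp (s - t)
    rw [this]
    nlinarith
  rw [logRiesz, logRiesz, exp_neg_two_mul, exp_neg_two_mul, ← ha, ← hb]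
  set S := rieszSum c a
  set S' := rieszSum c b
  have hS : S / a ^ 2 ≤ C := by rwa [div_le_iff₀ (by positivity)]
  have e1 : (b ^ 2)⁻¹ * S' - (a ^ 2)⁻¹ * S =
      (S' - S) / b ^ 2 - (S / a ^ 2) * ((b ^ 2 - a ^ 2) / b ^ 2) := by
    field_simp
    ring
  have e2 : (S' - S) / b ^ 2 ≤ C * (t - s) := by
    rw [div_le_iff₀ (by positivity)]
    calc S' - S ≤ (b - a) * summatory c b := h2
      _ ≤ (b * (t - s)) * (C * b) := by
        gcongr
        exact summatory_nonneg hc b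
      _ = _ := by ring
  have e3 : 0 ≤ (S' - S) / b ^ 2 := div_nonneg (h6.trans h1) (by positivity)
  have e4 : (b ^ 2 - a ^ 2) / b ^ 2 ≤ 2 * (t - s) := by
    rw [div_le_iff₀ (by positivity)]
    nlinarith [mul_nonneg hb0.le (sub_nonneg.mpr hst)]
  have e5 : 0 ≤ (b ^ 2 - a ^ 2) / b ^ 2 := div_nonneg (by nlinarith) (by positivity)
  have e6 : (S / a ^ 2) * ((b ^ 2 - a ^ 2) / b ^ 2) ≤ C * (2 * (t - s)) := by gcongr
  have e7 : 0 ≤ (S / a ^ 2) * ((b ^ 2 - a ^ 2) / b ^ 2) := by positivity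
  have e8 : 0 ≤ C * (t - s) := mul_nonneg hC0 (sub_nonneg.mpr hst)
  rw [e1, abs_le]
  constructor <;> linarith

/-- The contribution of a single coefficient to `logRiesz`. -/
noncomputable def logRieszTerm (c : ℕ → ℝ) (n : ℕ) (t : ℝ) : ℝ :=
  if n = 0 then 0 else (Set.Ioi (log n)).indicator (fun t ↦ c n * (exp (-t) - n * exp (-(2 * t)))) t

theorem hasSum_logRieszTerm (t : ℝ) : HasSum (fun n ↦ logRieszTerm c n t) (logRiesz c t) := by
  have h1 : logRiesz c t = ∑ n ∈ Ioc 0 ⌊exp t⌋₊, logRieszTerm c n t := by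
    rw [logRiesz, rieszSum, mul_sum]
    refine sum_congr rfl fun n hn ↦ ?_
    have hn0 : n ≠ 0 := by grind
    rw [mem_Ioc, Nat.le_floor_iff' hn0, ← log_le_iff_le_exp (by positivity)] at hn
    have e : exp (-t) = exp (-(2 * t)) * exp t := by rw [← exp_add]; ring_nf
    rw [logRieszTerm, if_neg hn0]
    rcases hn.2.lt_or_eq with h | h
    · rw [Set.indicator_of_mem (Set.mem_Ioi.mpr h), e]
      ring
    · rw [Set.indicator_of_notMem (by simp [h]), ← h, exp_log (by positivity)]
      ring
  rw [h1]
  refine hasSum_sum_of_ne_finset_zero fun n hn ↦ ?_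
  rw [logRieszTerm]
  split_ifs with hn0
  · rfl
  · refine Set.indicator_of_notMem (fun h ↦ hn ?_) _
    rw [mem_Ioc, Nat.le_floor_iff' hn0, ← log_le_iff_le_exp (by positivity)]
    exact ⟨by lia, (Set.mem_Ioi.mp h).le⟩

theorem logRieszTerm_nonneg (hc : ∀ n, 0 ≤ c n) (n : ℕ) (t : ℝ) : 0 ≤ logRieszTerm c n t := by
  rw [logRieszTerm]
  split_ifs with hn0
  · rfl
  · refine Set.indicator_nonneg (fun t ht ↦ mul_nonneg (hc n) ?_) t
    have h1 := (log_le_iff_le_exp (by positivity)).mp (Set.mem_Ioi.mp ht).le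
    have e : exp (-t) = exp t * exp (-(2 * t)) := by rw [← exp_add]; ring_nf
    rw [e, ← sub_mul]
    exact mul_nonneg (by linarith) (exp_pos _).le

theorem integrable_logRieszTerm_and_integral (n : ℕ) {z : ℂ} (hz : 0 < z.re) :
    Integrable (fun t ↦ (logRieszTerm c n t : ℂ) * Complex.exp (-(z * t))) ∧
    ∫ t, (logRieszTerm c n t : ℂ) * Complex.exp (-(z * t)) =
      LSeries.term (fun n ↦ (c n : ℂ)) (1 + z) n * (1 / ((1 + z) * (2 + z))) := by
  rcases eq_or_ne n 0 with rfl | hn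
  · simp [logRieszTerm]
  have hn0 : (n : ℂ) ≠ 0 := Nat.cast_ne_zero.mpr hn
  have h1 : (fun t : ℝ ↦ (logRieszTerm c n t : ℂ) * Complex.exp (-(z * t))) =
      (Set.Ioi (log n)).indicator (fun t : ℝ ↦ (c n : ℂ) * (Complex.exp (-(1 + z) * t) -
        n * Complex.exp (-(2 + z) * t))) := by
    funext t
    rw [logRieszTerm, if_neg hn]
    by_cases ht : t ∈ Set.Ioi (log n)
    · rw [Set.indicator_of_mem ht, Set.indicator_of_mem ht]
      push_cast
      rw [mul_assoc, sub_mul, mul_assoc, ← Complex.exp_add, ← Complex.exp_add]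
      ring_nf
    · rw [Set.indicator_of_notMem ht, Set.indicator_of_notMem ht, Complex.ofReal_zero, zero_mul]
  have hr1 : (-(1 + z)).re < 0 := by simp; linarith
  have hr2 : (-(2 + z)).re < 0 := by simp; linarith
  have hz1 : 1 + z ≠ 0 := fun h ↦ by rw [h] at hr1; simp at hr1
  have hz2 : 2 + z ≠ 0 := fun h ↦ by rw [h] at hr2; simp at hr2
  have hI1 := integrableOn_exp_mul_complex_Ioi hr1 (log n)
  have hI2 := (integrableOn_exp_mul_complex_Ioi hr2 (log n)).const_mul (n : ℂ)
  rw [h1]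
  constructor
  · exact IntegrableOn.integrable_indicator ((hI1.sub hI2).const_mul _) measurableSet_Ioi
  · rw [integral_indicator measurableSet_Ioi, integral_const_mul, integral_sub hI1 hI2,
      integral_const_mul, integral_exp_mul_complex_Ioi hr1, integral_exp_mul_complex_Ioi hr2,
      LSeries.term_of_ne_zero hn, div_eq_mul_inv (c n : ℂ), ← Complex.cpow_neg]
    have e (a : ℂ) : Complex.exp (a * (log n : ℝ)) = (n : ℂ) ^ a := by
      rw [Complex.cpow_def_of_ne_zero hn0, Complex.natCast_log, mul_comm]
    have e2 : (n : ℂ) ^ (-(1 + z)) = n * (n : ℂ) ^ (-(2 + z)) := by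
      rw [show -(1 + z) = 1 + -(2 + z) by ring, Complex.cpow_add _ _ hn0, Complex.cpow_one]
    rw [e, e, e2]
    field_simp
    ring

theorem integral_logRiesz (hc : ∀ n, 0 ≤ c n)
    (hsum : ∀ s : ℂ, 1 < s.re → LSeriesSummable (fun n ↦ (c n : ℂ)) s) {z : ℂ} (hz : 0 < z.re) :
    ∫ t, (logRiesz c t : ℂ) * Complex.exp (-(z * t)) =
      LSeries (fun n ↦ (c n : ℂ)) (1 + z) * (1 / ((1 + z) * (2 + z))) := by
  have hre : 0 < ((z.re : ℝ) : ℂ).re := by simpa using hz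
  have h1 := hasSum_integral_of_summable_integral_norm
    (F := fun n (t : ℝ) ↦ (logRieszTerm c n t : ℂ) * Complex.exp (-(z * t))) (μ := volume)
    (fun n ↦ (integrable_logRieszTerm_and_integral n hz).1) ?_
  · have h2 := h1.congr_fun fun n ↦ ((integrable_logRieszTerm_and_integral n hz).2).symm
    have h3 := ((hsum (1 + z) (by simpa using hz)).LSeriesHasSum.mul_right
      (1 / ((1 + z) * (2 + z)))).unique h2
    rw [h3]
    refine integral_congr_ae (ae_of_all _ fun t ↦ ?_)
    simp only
    rw [tsum_mul_right, ← Complex.ofReal_tsum, (hasSum_logRieszTerm t).tsum_eq]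
  · have h4 := (hsum (1 + (z.re : ℝ)) (by simpa using hz)).mul_right
      (1 / ((1 + ((z.re : ℝ) : ℂ)) * (2 + (z.re : ℝ))))
    rw [← Complex.summable_ofReal]
    refine h4.congr fun n ↦ ?_
    rw [← (integrable_logRieszTerm_and_integral n hre).2, ← integral_complex_ofReal]
    refine integral_congr_ae (ae_of_all _ fun t ↦ ?_)
    simp only
    rw [norm_mul, Complex.norm_real, norm_of_nonneg (logRieszTerm_nonneg hc n t),
      Complex.norm_exp]
    push_cast
    simp

/-- The Wiener–Ikehara theorem, under a Chebyshev type bound. -/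
theorem tendsto_summatory_div (hc : ∀ n, 0 ≤ c n) (hC : ∀ x, 0 ≤ x → summatory c x ≤ C * x)
    (hsum : ∀ s : ℂ, 1 < s.re → LSeriesSummable (fun n ↦ (c n : ℂ)) s) {F : ℂ → ℂ}
    (hF : ContinuousOn F {s | 1 ≤ s.re})
    (hL : ∀ s : ℂ, 1 < s.re → LSeries (fun n ↦ (c n : ℂ)) s = 1 / (s - 1) + F s) :
    Tendsto (fun x ↦ summatory c x / x) atTop (𝓝 1) := by
  have hC0 : 0 ≤ C := by simpa using (summatory_nonneg hc 1).trans (hC 1 zero_le_one)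
  set h : ℝ → ℝ := fun t ↦ logRiesz c t - (Set.Ici 0).indicator (fun _ ↦ 1 / 2) t with hh
  have hne : ∀ z : ℂ, 0 ≤ z.re → ∀ a : ℕ, 0 < a → (a : ℂ) + z ≠ 0 := fun z hz a ha h0 ↦ by
    have h1 := congrArg Complex.re h0
    have h2 : (0 : ℝ) < a := by exact_mod_cast ha
    simp at h1
    linarith
  have hlim : Tendsto h atTop (𝓝 0) := by
    have hexp : ∀ z : ℂ, 0 < z.re →
        IntegrableOn (fun t : ℝ ↦ Complex.exp (-z * t)) (Set.Ioi 0) := fun z hz ↦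
      integrableOn_exp_mul_complex_Ioi (by simpa using hz) 0
    refine tendsto_zero_of_laplace (B := C + 1 / 2) (M := 2 * C + 1)
      (D := fun z ↦ F (1 + z) / ((1 + z) * (2 + z)) - (3 + z) / (2 * ((1 + z) * (2 + z))))
      (measurable_logRiesz.sub (measurable_const.indicator measurableSet_Ici)) (fun t ht ↦ ?_)
      (fun t ↦ ?_) (by positivity) (fun s t hs hst ↦ ?_) ?_ (fun z hz ↦ ?_)
    · rw [hh]
      simp only
      rw [logRiesz_of_neg ht, Set.indicator_of_notMem (by simpa using ht), sub_zero]
    · have h1 := logRiesz_nonneg hc t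
      have h2 := logRiesz_le hc hC t
      have h3 : 0 ≤ (Set.Ici (0 : ℝ)).indicator (fun _ ↦ (1 / 2 : ℝ)) t :=
        Set.indicator_nonneg (by norm_num) t
      have h4 : (Set.Ici (0 : ℝ)).indicator (fun _ ↦ (1 / 2 : ℝ)) t ≤ 1 / 2 :=
        Set.indicator_le_self' (by norm_num) t
      rw [hh, abs_le]
      constructor <;> linarith
    · rw [hh]
      simp only
      rw [Set.indicator_of_mem (Set.mem_Ici.mpr hs), Set.indicator_of_mem
        (Set.mem_Ici.mpr (hs.trans hst)), sub_sub_sub_cancel_right]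
      refine (abs_logRiesz_sub_le hc hC hst).trans ?_
      gcongr
      linarith
    · have hF' : ContinuousOn (fun z : ℂ ↦ F (1 + z)) {z | 0 ≤ z.re} :=
        hF.comp (by fun_prop) fun z (hz : 0 ≤ z.re) ↦ by simpa using hz
      have hd : ∀ z : ℂ, 0 ≤ z.re → (1 + z) * (2 + z) ≠ 0 := fun z hz ↦
        mul_ne_zero (by simpa using hne z hz 1 one_pos) (by simpa using hne z hz 2 two_pos)
      exact (hF'.div (by fun_prop) hd).sub (ContinuousOn.div (by fun_prop) (by fun_prop)
        fun z hz ↦ mul_ne_zero two_ne_zero (hd z hz))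
    · have hz0 : z ≠ 0 := fun h ↦ by simp [h] at hz
      have h1 : Integrable fun t : ℝ ↦ (logRiesz c t : ℂ) * Complex.exp (-(z * t)) := by
        refine (integrable_mul_exp_neg measurable_logRiesz (fun t ↦ logRiesz_of_neg)
          (fun t ↦ (abs_of_nonneg (logRiesz_nonneg hc t)).trans_le (logRiesz_le hc hC t)) hz).mono
          ?_ (ae_of_all _ fun t ↦ ?_)
        · have := measurable_logRiesz (c := c)
          fun_prop
        · rw [norm_mul, norm_mul, Complex.norm_exp, Complex.norm_real (Real.exp _),
            norm_of_nonneg (exp_pos _).le]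
          simp
      have h2 : (fun t : ℝ ↦ (((Set.Ici (0 : ℝ)).indicator (fun _ ↦ (1 / 2 : ℝ)) t : ℝ) : ℂ) *
          Complex.exp (-(z * t))) =
          (Set.Ici 0).indicator fun t : ℝ ↦ 1 / 2 * Complex.exp (-z * t) := by
        funext t
        by_cases ht : t ∈ Set.Ici (0 : ℝ)
        · rw [Set.indicator_of_mem ht, Set.indicator_of_mem ht]
          push_cast
          ring_nf
        · rw [Set.indicator_of_notMem ht, Set.indicator_of_notMem ht, Complex.ofReal_zero, zero_mul]
      have h3 : Integrable fun t : ℝ ↦ (((Set.Ici (0 : ℝ)).indicator (fun _ ↦ (1 / 2 : ℝ)) t : ℝ) :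
          ℂ) * Complex.exp (-(z * t)) := by
        rw [h2]
        refine IntegrableOn.integrable_indicator ?_ measurableSet_Ici
        rw [integrableOn_Ici_iff_integrableOn_Ioi]
        exact (hexp z hz).const_mul _
      have h4 : ∫ t : ℝ, (((Set.Ici (0 : ℝ)).indicator (fun _ ↦ (1 / 2 : ℝ)) t : ℝ) : ℂ) *
          Complex.exp (-(z * t)) = 1 / (2 * z) := by
        rw [h2, integral_indicator measurableSet_Ici, integral_Ici_eq_integral_Ioi,
          integral_const_mul, integral_exp_mul_complex_Ioi (by simpa using hz)]
        simp
        field_simp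
      simp only [hh, Complex.ofReal_sub, sub_mul]
      rw [integral_sub h1 h3, h4, integral_logRiesz hc hsum hz, hL _ (by simpa using hz)]
      have h5 : 1 + z ≠ 0 := by simpa using hne z hz.le 1 one_pos
      have h6 : 2 + z ≠ 0 := by simpa using hne z hz.le 2 two_pos
      rw [add_sub_cancel_left]
      field_simp
      ring
  have hlim2 : Tendsto (logRiesz c) atTop (𝓝 (1 / 2)) := by
    have := (hlim.add_const (1 / 2)).congr' (f₂ := logRiesz c) (by
      filter_upwards [eventually_ge_atTop 0] with t ht
      rw [hh]
      simp only
      rw [Set.indicator_of_mem (Set.mem_Ici.mpr ht), sub_add_cancel])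
    simpa using this
  have hlim3 : Tendsto (fun x ↦ rieszSum c x / x ^ 2) atTop (𝓝 (1 / 2)) := by
    refine (hlim2.comp tendsto_log_atTop).congr' ?_
    filter_upwards [eventually_gt_atTop 0] with x hx
    rw [Function.comp_apply, logRiesz, exp_neg_two_mul, exp_log hx]
    ring
  have hlim4 : ∀ a : ℝ, 0 < a →
      Tendsto (fun x ↦ rieszSum c (a * x) / x ^ 2) atTop (𝓝 (a ^ 2 / 2)) := fun a ha ↦ by
    have h1 := (hlim3.comp (tendsto_id.const_mul_atTop ha)).const_mul (a ^ 2)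
    rw [mul_one_div] at h1
    refine h1.congr fun x ↦ ?_
    simp only [Function.comp_apply, id, mul_pow]
    field_simp
  have hkey : ∀ a : ℝ, 0 < a → a ≠ 1 → Tendsto (fun x ↦ (rieszSum c (a * x) - rieszSum c x) /
      ((a - 1) * x ^ 2)) atTop (𝓝 ((a + 1) / 2)) := fun a ha ha1 ↦ by
    have ha' : a - 1 ≠ 0 := sub_ne_zero.mpr ha1
    have h1 := ((hlim4 a ha).sub hlim3).div_const (a - 1)
    have e : (a ^ 2 / 2 - 1 / 2) / (a - 1) = (a + 1) / 2 := by field_simp; ring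
    rw [e] at h1
    refine h1.congr fun x ↦ ?_
    rw [← sub_div, div_div, mul_comm (x ^ 2)]
  rw [tendsto_order]
  constructor
  · intro b hb
    obtain ⟨a, ha0, ha1, hab⟩ : ∃ a : ℝ, 0 < a ∧ a < 1 ∧ b < (a + 1) / 2 :=
      ⟨max (1 / 2) b, by positivity, by simp; constructor <;> linarith, by
        have := le_max_right (1 / 2) b
        linarith⟩
    filter_upwards [(hkey a ha0 ha1.ne).eventually_const_lt hab, eventually_gt_atTop 0] with x h1 hx
    refine h1.trans_le ?_
    have h2 := rieszSum_sub_le hc (by nlinarith : a * x ≤ x)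
    rw [← neg_div_neg_eq, div_le_div_iff₀ (by nlinarith [pow_pos hx 2]) hx]
    nlinarith
  · intro b hb
    obtain ⟨a, ha1, hab⟩ : ∃ a : ℝ, 1 < a ∧ (a + 1) / 2 < b := ⟨b, hb, by linarith⟩
    filter_upwards [(hkey a (by linarith) ha1.ne').eventually_lt_const hab,
      eventually_gt_atTop 0] with x h1 hx
    refine lt_of_le_of_lt ?_ h1
    have h2 := sub_mul_summatory_le hc (by nlinarith : x ≤ a * x)
    rw [div_le_div_iff₀ hx (by nlinarith [pow_pos hx 2])]
    nlinarith

end WienerIkehara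

section PrimeIdealTheorem

open Filter Topology NumberField Module Finset
open scoped ArithmeticFunction.vonMangoldt

variable (K : Type*) [Field K] [NumberField K]

theorem tendsto_summatory_mangoldtCoeff :
    Tendsto (fun x ↦ summatory (mangoldtCoeff K) x / x) atTop (𝓝 1) := by
  obtain ⟨F, hF, hL⟩ := exists_continuousOn_lseries_mangoldtCoeff K
  refine tendsto_summatory_div (C := finrank ℚ K * (Real.log 4 + 4)) (mangoldtCoeff_nonneg K)
    (fun x hx ↦ ?_) (fun s hs ↦ lseriesSummable_mangoldtCoeff K hs) hF hL
  calc summatory (mangoldtCoeff K) x ≤ finrank ℚ K * Chebyshev.psi x := by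
        rw [summatory, Chebyshev.psi, mul_sum]
        exact sum_le_sum fun n _ ↦ mangoldtCoeff_le K n
    _ ≤ _ := by
        rw [mul_assoc]
        gcongr
        exact Chebyshev.psi_le_const_mul_self hx

/-- The sum of `log p * a p` over the primes `p ≤ x`. -/
noncomputable def primeLogSum (a : ℕ → ℝ) (x : ℝ) : ℝ :=
  ∑ p ∈ Ioc 0 ⌊x⌋₊ with p.Prime, Real.log p * a p

theorem abs_summatory_sub_primeLogSum_le (x : ℝ) :
    |summatory (mangoldtCoeff K) x - primeLogSum (fun p ↦ degreeOneCount K p) x| ≤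
      finrank ℚ K * (Chebyshev.psi x - Chebyshev.theta x) := by
  have h1 : primeLogSum (fun p ↦ degreeOneCount K p) x =
      ∑ p ∈ Ioc 0 ⌊x⌋₊ with p.Prime, mangoldtCoeff K p :=
    sum_congr rfl fun p hp ↦ by rw [mangoldtCoeff_prime K (mem_filter.mp hp).2, mul_comm]
  have h2 : Chebyshev.theta x = ∑ p ∈ Ioc 0 ⌊x⌋₊ with p.Prime, Λ p :=
    sum_congr rfl fun p hp ↦
      (ArithmeticFunction.vonMangoldt_apply_prime (mem_filter.mp hp).2).symm
  rw [h1, h2, summatory, Chebyshev.psi, ← sum_filter_add_sum_filter_not (Ioc 0 ⌊x⌋₊) Nat.Prime,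
    ← sum_filter_add_sum_filter_not (Ioc 0 ⌊x⌋₊) Nat.Prime (fun n ↦ Λ n), add_sub_cancel_left,
    add_sub_cancel_left, abs_of_nonneg (sum_nonneg fun n _ ↦ mangoldtCoeff_nonneg K n), mul_sum]
  exact sum_le_sum fun n _ ↦ mangoldtCoeff_le K n

/-- The prime ideal theorem, for primes of degree one and in the weighted form. -/
theorem tendsto_primeLogSum_degreeOneCount :
    Tendsto (fun x ↦ primeLogSum (fun p ↦ degreeOneCount K p) x / x) atTop (𝓝 1) := by
  obtain ⟨C, hC⟩ := Chebyshev.psi_sub_theta_le_mul_sqrt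
  have hsmall : Tendsto (fun x : ℝ ↦ finrank ℚ K * C * (Real.sqrt x)⁻¹) atTop (𝓝 0) := by
    have := (tendsto_inv_atTop_zero.comp Real.tendsto_sqrt_atTop).const_mul (finrank ℚ K * C)
    simpa using this
  have hdiff : Tendsto (fun x ↦ summatory (mangoldtCoeff K) x / x -
      primeLogSum (fun p ↦ degreeOneCount K p) x / x) atTop (𝓝 0) := by
    refine squeeze_zero_norm' ?_ hsmall
    filter_upwards [eventually_gt_atTop 0] with x hx
    rw [← sub_div, norm_div, Real.norm_eq_abs, Real.norm_eq_abs, abs_of_pos hx, div_le_iff₀ hx]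
    refine (abs_summatory_sub_primeLogSum_le K x).trans ?_
    have h1 := hC x
    have h2 : (Real.sqrt x)⁻¹ * x = Real.sqrt x := by
      have := Real.sqrt_pos.mpr hx
      field_simp
      exact (Real.sq_sqrt hx.le).symm
    rw [mul_assoc, mul_assoc, h2]
    gcongr
  simpa using (tendsto_summatory_mangoldtCoeff K).sub hdiff

end PrimeIdealTheorem

section FrobeniusElement

open scoped Pointwise

/-- Every endomorphism of a finite field of characteristic `p` is a power of Frobenius. -/
theorem exists_ringHom_eq_pow {k : Type*} [Field k] [Finite k] (p : ℕ) [Fact p.Prime] [CharP k p]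
    (φ : k →+* k) : ∃ n : ℕ, ∀ x, φ x = x ^ p ^ n := by
  let := ZMod.algebra k p
  have := Fintype.ofFinite k
  let φ' : k →ₐ[ZMod p] k :=
    { φ with
      commutes' := DFunLike.congr_fun
        (Subsingleton.elim (φ.comp (algebraMap (ZMod p) k)) (algebraMap (ZMod p) k)) }
  obtain ⟨n, hn⟩ := (FiniteField.bijective_frobeniusAlgEquivOfAlgebraic_pow (ZMod p) k).2
    (AlgEquiv.ofBijective φ' (Finite.injective_iff_bijective.mp φ'.injective))
  refine ⟨n, fun x ↦ ?_⟩
  have h := DFunLike.congr_fun hn x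
  simp only [AlgEquiv.coe_pow, FiniteField.coe_frobeniusAlgEquivOfAlgebraic_iterate,
    ZMod.card] at h
  exact h.symm

/-- A domain in which `p = 0` and `x ^ p = x` for all `x` has exactly `p` elements. -/
theorem natCard_eq_of_pow_eq {k : Type*} [CommRing k] [IsDomain k] (p : ℕ) [hp : Fact p.Prime]
    (h0 : (p : k) = 0) (h : ∀ x : k, x ^ p = x) : Nat.card k = p := by
  have : CharP k p := (CharP.charP_iff_prime_eq_zero hp.out).mpr h0
  obtain ⟨P, hP⟩ : ∃ P : Polynomial k, P = Polynomial.X ^ p - Polynomial.X := ⟨_, rfl⟩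
  have hne : P ≠ 0 := by
    rw [hP]
    refine (Polynomial.monic_X_pow_sub ?_).ne_zero
    rw [Polynomial.degree_X]
    exact_mod_cast hp.out.one_lt
  have hroots : ∀ x : k, x ∈ P.roots := fun x ↦ by
    rw [Polynomial.mem_roots hne, Polynomial.IsRoot.def, hP, Polynomial.eval_sub,
      Polynomial.eval_pow, Polynomial.eval_X, h x, sub_self]
  classical
  have : Finite k := .of_injective
    (fun x ↦ (⟨x, Multiset.mem_toFinset.mpr (hroots x)⟩ : {x // x ∈ P.roots.toFinset}))
    fun x y hxy ↦ congrArg Subtype.val hxy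
  have := Fintype.ofFinite k
  refine le_antisymm ?_ ?_
  · rw [Nat.card_eq_fintype_card, ← Finset.card_univ]
    calc (Finset.univ : Finset k).card
        ≤ P.roots.toFinset.card :=
          Finset.card_le_card fun x _ ↦ Multiset.mem_toFinset.mpr (hroots x)
      _ ≤ P.roots.card := Multiset.toFinset_card_le _
      _ ≤ P.natDegree := Polynomial.card_roots' _
      _ ≤ p := by
          rw [hP]
          compute_degree
          exact (max_eq_left hp.out.one_le).le
  · calc p = Nat.card (ZMod p) := (Nat.card_zmod p).symm
      _ ≤ Nat.card k := Nat.card_le_card_of_injective _ (ZMod.castHom dvd_rfl k).injective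

variable {B C G : Type*} [CommRing B] [CommRing C] [Algebra C B] [Group G]
  [MulSemiringAction G B]

/-- `σ` induces the `p`-power map modulo `Q`. -/
def IsFrobenius (p : ℕ) (σ : G) (Q : Ideal B) : Prop := ∀ x : B, σ • x - x ^ p ∈ Q

variable {p : ℕ} {σ τ : G} {Q : Ideal B}

theorem IsFrobenius.smul (h : IsFrobenius p σ Q) (τ : G) :
    IsFrobenius p (τ * σ * τ⁻¹) (τ • Q) := fun x ↦ by
  rw [Ideal.mem_pointwise_smul_iff_inv_smul_mem]
  simpa [smul_sub, mul_smul] using h (τ⁻¹ • x)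

theorem IsFrobenius.eq (h : IsFrobenius p σ Q) (h' : IsFrobenius p τ Q)
    (hQ : ∀ g : G, (∀ x : B, g • x - x ∈ Q) → g = 1) : σ = τ := by
  refine mul_inv_eq_one.mp (hQ _ fun x ↦ ?_)
  simpa [mul_smul] using sub_mem (h (τ⁻¹ • x)) (h' (τ⁻¹ • x))

theorem IsFrobenius.pow_sub_mem (h : IsFrobenius p σ Q) (n : ℕ) (x : B) :
    σ ^ n • x - x ^ p ^ n ∈ Q := by
  induction n generalizing x with
  | zero => simp
  | succ n ih =>
    have h1 := ih (σ • x)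
    have h2 : (σ • x) ^ p ^ n - (x ^ p) ^ p ^ n ∈ Q :=
      Q.mem_of_dvd (sub_dvd_pow_sub_pow _ _ _) (h x)
    rw [pow_succ, mul_smul, pow_succ', pow_mul]
    simpa using add_mem h1 h2

theorem natCast_mem_smul (h : (p : B) ∈ Q) (τ : G) : (p : B) ∈ τ • Q := by
  rw [Ideal.mem_pointwise_smul_iff_inv_smul_mem]
  have : τ⁻¹ • (p : B) = p := map_natCast (MulSemiringAction.toRingHom G B τ⁻¹) p
  rwa [this]

end FrobeniusElement

section Counting

open scoped Pointwise

variable {B C G : Type*} [CommRing B] [CommRing C] [Algebra C B] [Group G]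
  [MulSemiringAction G B] {p : ℕ} {σ τ : G} {Q : Ideal B}

theorem exists_isFrobenius [Finite G] [Algebra.IsInvariant C B G] [SMulCommClass G C B]
    [Q.IsPrime] [Finite (B ⧸ Q)] (h : Nat.card (C ⧸ Q.under C) = p) :
    ∃ τ : G, IsFrobenius p τ Q := by
  obtain ⟨τ, hτ⟩ := IsArithFrobAt.exists_of_isInvariant C G Q
  refine ⟨τ, fun x ↦ ?_⟩
  have := hτ x
  rwa [h] at this

variable [hp : Fact p.Prime]

/-- The decomposition group of an unramified prime is generated by its Frobenius element. -/
theorem IsFrobenius.exists_pow_eq [Q.IsPrime] [Finite (B ⧸ Q)] (h : IsFrobenius p σ Q)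
    (hpQ : (p : B) ∈ Q) (hQ : ∀ g : G, (∀ x : B, g • x - x ∈ Q) → g = 1) (hτ : τ • Q = Q) :
    ∃ n : ℕ, τ = σ ^ n := by
  have hmax : Q.IsMaximal :=
    Ideal.Quotient.maximal_of_isField _ (Finite.isField_of_domain (B ⧸ Q))
  let := Ideal.Quotient.field Q
  have : CharP (B ⧸ Q) p := (CharP.charP_iff_prime_eq_zero hp.out).mpr (by
    rw [← map_natCast (Ideal.Quotient.mk Q)]
    exact Ideal.Quotient.eq_zero_iff_mem.mpr hpQ)
  obtain ⟨n, hn⟩ := exists_ringHom_eq_pow p (Ideal.quotientMap Q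
    (MulSemiringAction.toRingHom G B τ) fun x hx ↦ by
      rw [Ideal.mem_comap, ← hτ, Ideal.mem_pointwise_smul_iff_inv_smul_mem]
      simpa using hx)
  refine ⟨n, mul_inv_eq_one.mp (hQ _ fun x ↦ ?_)⟩
  have h1 : τ • (σ ^ n)⁻¹ • x - ((σ ^ n)⁻¹ • x) ^ p ^ n ∈ Q := by
    rw [← Ideal.Quotient.eq, map_pow]
    exact hn (Ideal.Quotient.mk Q ((σ ^ n)⁻¹ • x))
  have h2 := sub_mem h1 (h.pow_sub_mem n ((σ ^ n)⁻¹ • x))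
  simpa [mul_smul] using h2

theorem natCard_quotient_under {H : Subgroup G} [SMulCommClass H C B] [Q.IsPrime]
    (h : IsFrobenius p σ Q) (hpQ : (p : B) ∈ Q) (hσ : σ ∈ H) :
    Nat.card (C ⧸ Q.under C) = p := by
  refine natCard_eq_of_pow_eq p ?_ fun y ↦ ?_
  · rw [← map_natCast (Ideal.Quotient.mk _), Ideal.Quotient.eq_zero_iff_mem, Ideal.mem_comap,
      map_natCast]
    exact hpQ
  · obtain ⟨y, rfl⟩ := Ideal.Quotient.mk_surjective y
    rw [← map_pow, eq_comm, Ideal.Quotient.eq, Ideal.mem_comap, map_sub, map_pow]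
    have h1 : σ • algebraMap C B y = algebraMap C B y := smul_algebraMap (⟨σ, hσ⟩ : H) y
    have h2 := h (algebraMap C B y)
    rwa [h1] at h2

theorem under_int_eq [Q.IsPrime] (hpQ : (p : B) ∈ Q) : Q.under ℤ = Ideal.span {(p : ℤ)} := by
  have : (Ideal.span {(p : ℤ)}).IsMaximal :=
    PrincipalIdealRing.isMaximal_of_irreducible (Nat.prime_iff_prime_int.mp hp.out).irreducible
  refine (this.eq_of_le Ideal.IsPrime.ne_top' ?_).symm
  rw [Ideal.span_singleton_le_iff_mem, Ideal.mem_comap]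
  simpa using hpQ

/-- Let `G` act on `B` with an unramified prime `Q` above `p`, let `C` be the ring of invariants of
a subgroup `H`. Counting the primes of `C` with residue field of order `p`. -/
theorem card_mul_card_degreeOne [Finite G] [Algebra.IsInvariant ℤ B G] (H : Subgroup G)
    [Algebra.IsInvariant C B H] [SMulCommClass H C B] [FaithfulSMul C B]
    [Q.IsPrime] (hfin : ∀ P : Ideal B, (p : B) ∈ P → Finite (B ⧸ P))
    (hpQ : (p : B) ∈ Q) (hσ : IsFrobenius p σ Q)
    (hQ : ∀ g : G, (∀ x : B, g • x - x ∈ Q) → g = 1) :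
    Nat.card H * Nat.card {P : Ideal C // P.IsPrime ∧ Nat.card (C ⧸ P) = p} =
      Nat.card {τ : G // τ⁻¹ * σ * τ ∈ H} := by
  have hprime (τ : G) : (τ • Q).IsPrime := Ideal.IsPrime.smul τ
  have hfinite (τ : G) : Finite (B ⧸ τ • Q) := hfin _ (natCast_mem_smul hpQ τ)
  have := hfin Q hpQ
  have hfrob (τ : G) : IsFrobenius p (τ⁻¹ * σ * τ) (τ⁻¹ • Q) := by simpa using hσ.smul τ⁻¹
  have hinert (τ : G) : ∀ g : G, (∀ x : B, g • x - x ∈ τ⁻¹ • Q) → g = 1 := fun g hg ↦ by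
    have : τ * g * τ⁻¹ = 1 := hQ _ fun x ↦ by
      have := hg (τ⁻¹ • x)
      rw [Ideal.mem_pointwise_smul_iff_inv_smul_mem] at this
      simpa [smul_sub, mul_smul] using this
    exact conj_eq_one_iff.mp this
  let φ : {τ : G // τ⁻¹ * σ * τ ∈ H} → {P : Ideal C // P.IsPrime ∧ Nat.card (C ⧸ P) = p} := fun τ ↦
    ⟨(τ.1⁻¹ • Q).under C, inferInstance,
      natCard_quotient_under (H := H) (hfrob τ.1) (natCast_mem_smul hpQ _) τ.2⟩
  have hsurj : Function.Surjective φ := by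
    rintro ⟨P, hPp, hP⟩
    have := Algebra.IsInvariant.isIntegral C B H
    obtain ⟨⟨Q', hQ', ⟨rfl⟩⟩⟩ := Ideal.nonempty_primesOver (S := B) P
    obtain ⟨τ, rfl⟩ : ∃ τ : G, Q' = τ⁻¹ • Q := by
      have hp0 : (p : C ⧸ Q'.under C) = 0 := by
        have := Nat.finite_of_card_ne_zero (hP ▸ hp.out.ne_zero)
        have := Fintype.ofFinite (C ⧸ Q'.under C)
        rw [← hP, Nat.card_eq_fintype_card]
        exact Nat.cast_card_eq_zero _
      have hpQ' : (p : B) ∈ Q' := by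
        rw [← map_natCast (Ideal.Quotient.mk _), Ideal.Quotient.eq_zero_iff_mem, Ideal.mem_comap,
          map_natCast] at hp0
        exact hp0
      obtain ⟨g, hg⟩ := Algebra.IsInvariant.exists_smul_of_under_eq ℤ B G Q Q'
        ((under_int_eq hpQ).trans (under_int_eq hpQ').symm)
      exact ⟨g⁻¹, by rwa [inv_inv]⟩
    obtain ⟨h, hh⟩ := exists_isFrobenius (G := H) (C := C) (Q := τ⁻¹ • Q) hP
    have h1 : τ⁻¹ * σ * τ = h := (hfrob τ).eq (τ := (h : G)) hh (hinert τ)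
    exact ⟨⟨τ, h1 ▸ h.2⟩, rfl⟩
  have hfib (P) : Nat.card {τ // φ τ = P} = Nat.card H := by
    obtain ⟨⟨τ, hτ⟩, rfl⟩ := hsurj P
    have hmem (h : H) : (τ * h)⁻¹ * σ * (τ * h) ∈ H := by
      have := H.mul_mem (H.mul_mem (H.inv_mem h.2) hτ) h.2
      simpa [mul_assoc] using this
    have heq (h : H) : φ ⟨τ * h, hmem h⟩ = φ ⟨τ, hτ⟩ := by
      refine Subtype.ext ?_
      change ((τ * h)⁻¹ • Q).under C = (τ⁻¹ • Q).under C
      rw [mul_inv_rev, mul_smul]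
      exact (τ⁻¹ • Q).under_smul C h⁻¹
    refine (Nat.card_eq_of_bijective
      (fun h : H ↦ (⟨⟨τ * h, hmem h⟩, heq h⟩ : {τ' // φ τ' = φ ⟨τ, hτ⟩}))
        ⟨fun h₁ h₂ h ↦ ?_, ?_⟩).symm
    · simpa using h
    · rintro ⟨⟨τ', hτ'⟩, h⟩
      have h1 : (τ'⁻¹ • Q).under C = (τ⁻¹ • Q).under C := congrArg Subtype.val h
      obtain ⟨g, hg⟩ := Algebra.IsInvariant.exists_smul_of_under_eq C B H _ _ h1
      have h2 : (τ * (g : G) * τ'⁻¹) • Q = Q := by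
        have h5 : (g : G) • τ'⁻¹ • Q = τ⁻¹ • Q := hg.symm
        rw [mul_assoc, mul_smul, mul_smul, h5, smul_inv_smul]
      obtain ⟨n, hn⟩ := hσ.exists_pow_eq hpQ hQ h2
      have h3 : τ⁻¹ * τ' ∈ H := by
        have h4 : τ⁻¹ * τ' = (τ⁻¹ * σ * τ)⁻¹ ^ n * g := by
          have : τ' = (σ ^ n)⁻¹ * τ * g := by
            rw [← hn]
            group
          have h5 := conj_pow (a := τ⁻¹) (b := σ) (i := n)
          rw [inv_inv] at h5
          rw [this, inv_pow, h5]
          group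
        rw [h4]
        exact H.mul_mem (H.pow_mem (H.inv_mem hτ) n) g.2
      exact ⟨⟨_, h3⟩, by simp⟩
  have := Finite.of_surjective φ hsurj
  have := Fintype.ofFinite {P : Ideal C // P.IsPrime ∧ Nat.card (C ⧸ P) = p}
  rw [← Nat.card_congr (Equiv.sigmaFiberEquiv φ), Nat.card_sigma]
  simp only [hfib, Finset.sum_const, Finset.card_univ, Nat.card_eq_fintype_card, smul_eq_mul,
    mul_comm]

end Counting

section FixedField

open NumberField IntermediateField

variable {L : Type*} [Field L] [NumberField L]

theorem smulCommClass_fixedField (H : Subgroup (L ≃ₐ[ℚ] L)) :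
    SMulCommClass H (𝓞 (fixedField H)) (𝓞 L) where
  smul_comm h x y := by
    have : h • algebraMap (𝓞 (fixedField H)) (𝓞 L) x = algebraMap (𝓞 (fixedField H)) (𝓞 L) x :=
      RingOfIntegers.ext ((mem_fixedField_iff H _).mp x.1.2 h h.2)
    rw [Algebra.smul_def, Algebra.smul_def, smul_mul', this]

theorem isInvariant_fixedField (H : Subgroup (L ≃ₐ[ℚ] L)) :
    Algebra.IsInvariant (𝓞 (fixedField H)) (𝓞 L) H where
  isInvariant b hb := by
    have hmem : (b : L) ∈ fixedField H := (mem_fixedField_iff H _).mpr fun h hh ↦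
      congrArg (fun x : 𝓞 L ↦ (x : L)) (hb ⟨h, hh⟩)
    have h_int : IsIntegral ℤ (⟨b, hmem⟩ : fixedField H) :=
      (isIntegral_algHom_iff ((fixedField H).val.restrictScalars ℤ) Subtype.val_injective).mp
        (RingOfIntegers.isIntegral_coe b)
    exact ⟨⟨⟨b, hmem⟩, h_int⟩, RingOfIntegers.ext rfl⟩

theorem natCard_isPrime_eq_degreeOneCount (K : Type*) [Field K] [NumberField K] {p : ℕ}
    (hp : p.Prime) :
    Nat.card {P : Ideal (𝓞 K) // P.IsPrime ∧ Nat.card (𝓞 K ⧸ P) = p} = degreeOneCount K p := by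
  refine Nat.card_congr (Equiv.subtypeEquivRight fun P ↦ ?_)
  rw [Ideal.absNorm_apply, Submodule.cardQuot_apply]
  refine ⟨And.right, fun h ↦ ⟨?_, h⟩⟩
  refine Ideal.isPrime_of_prime (prime_of_absNorm_eq hp ?_)
  rwa [Ideal.absNorm_apply, Submodule.cardQuot_apply]

theorem card_mul_degreeOneCount [IsGalois ℚ L] (H : Subgroup (L ≃ₐ[ℚ] L)) {p : ℕ} (hp : p.Prime)
    {σ : L ≃ₐ[ℚ] L} {Q : Ideal (𝓞 L)} [Q.IsPrime] (hpQ : (p : 𝓞 L) ∈ Q) (hσ : IsFrobenius p σ Q)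
    (hQ : ∀ g : L ≃ₐ[ℚ] L, (∀ x : 𝓞 L, g • x - x ∈ Q) → g = 1) :
    Nat.card H * degreeOneCount (fixedField H) p =
      Nat.card {τ : L ≃ₐ[ℚ] L // τ⁻¹ * σ * τ ∈ H} := by
  have : Fact p.Prime := ⟨hp⟩
  have := smulCommClass_fixedField H
  have := isInvariant_fixedField H
  rw [← natCard_isPrime_eq_degreeOneCount _ hp]
  refine card_mul_card_degreeOne H (fun P hP ↦ P.finiteQuotientOfFreeOfNeBot ?_) hpQ hσ hQ
  rintro rfl
  rw [Ideal.mem_bot] at hP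
  exact hp.ne_zero (by exact_mod_cast hP)

end FixedField

section IntegralRoots

open NumberField Polynomial

variable {L : Type*} [Field L] {f : ℤ[X]}

theorem exists_integralRoots (hf : f.Monic) (hsep : (f.map (Int.castRingHom L)).Separable)
    (hsplit : (f.map (Int.castRingHom L)).Splits) :
    ∃ S : Finset (𝓞 L), f.map (Int.castRingHom (𝓞 L)) = ∏ r ∈ S, (X - C r) ∧
      ∀ x : L, x ∈ (f.map (Int.castRingHom L)).roots ↔ ∃ r ∈ S, (r : L) = x := by
  classical
  have hmon : (f.map (Int.castRingHom L)).Monic := hf.map _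
  have h_int (x : L) (hx : x ∈ (f.map (Int.castRingHom L)).roots) : IsIntegral ℤ x := by
    refine ⟨f, hf, ?_⟩
    rw [mem_roots hmon.ne_zero, IsRoot.def, eval_map] at hx
    exact hx
  set R := (f.map (Int.castRingHom L)).roots.toFinset with hR
  have hRint (x : R) : IsIntegral ℤ (x : L) := h_int x (Multiset.mem_toFinset.mp x.2)
  let e : R → 𝓞 L := fun x ↦ ⟨x, hRint x⟩
  have he : Function.Injective e := fun x y h ↦
    Subtype.ext (congrArg (fun z : 𝓞 L ↦ (z : L)) h)
  refine ⟨Finset.univ.image e, ?_, fun x ↦ ?_⟩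
  · refine map_injective (algebraMap (𝓞 L) L) RingOfIntegers.coe_injective ?_
    rw [Finset.prod_image fun x _ y _ h ↦ he h, Polynomial.map_prod, map_map]
    have h1 : (algebraMap (𝓞 L) L).comp (Int.castRingHom (𝓞 L)) = Int.castRingHom L :=
      RingHom.ext_int _ _
    have h2 : (R.val : Multiset L) = (f.map (Int.castRingHom L)).roots := by
      rw [hR, Multiset.toFinset_val, (nodup_roots hsep).dedup]
    rw [h1, hsplit.eq_prod_roots_of_monic hmon, ← h2]
    simp only [Polynomial.map_sub, map_X, map_C]
    exact (Finset.prod_coe_sort R fun x ↦ X - C x).symm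
  · rw [← Multiset.mem_toFinset, ← hR]
    simp only [Finset.mem_image, Finset.mem_univ, true_and]
    exact ⟨fun h ↦ ⟨e ⟨x, h⟩, ⟨_, rfl⟩, rfl⟩, fun ⟨r, ⟨y, hy⟩, hr⟩ ↦ by
      rw [← hr, ← hy]
      exact y.2⟩

variable [NumberField L]

theorem smul_mem_integralRoots {S : Finset (𝓞 L)}
    (hS : f.map (Int.castRingHom (𝓞 L)) = ∏ r ∈ S, (X - C r)) (g : L ≃ₐ[ℚ] L) {r : 𝓞 L}
    (hr : r ∈ S) : g • r ∈ S := by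
  have hiff (x : 𝓞 L) : x ∈ S ↔ (f.map (Int.castRingHom (𝓞 L))).eval x = 0 := by
    rw [hS, eval_prod, Finset.prod_eq_zero_iff]
    simp [sub_eq_zero]
  rw [hiff, eval_map] at hr ⊢
  have h1 : (MulSemiringAction.toRingHom (L ≃ₐ[ℚ] L) (𝓞 L) g).comp (Int.castRingHom (𝓞 L)) =
    Int.castRingHom (𝓞 L) := RingHom.ext_int _ _
  have h2 := hom_eval₂ f (Int.castRingHom (𝓞 L))
    (MulSemiringAction.toRingHom (L ≃ₐ[ℚ] L) (𝓞 L) g) r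
  rw [h1, hr, map_zero] at h2
  exact h2.symm

/-- The roots in `S` stay distinct modulo the primes above all but finitely many prime numbers. -/
theorem finite_setOf_sub_mem (S : Finset (𝓞 L)) :
    {p : ℕ | p.Prime ∧ ∃ Q : Ideal (𝓞 L), Q.IsPrime ∧ (p : 𝓞 L) ∈ Q ∧
      ∃ r ∈ S, ∃ s ∈ S, r ≠ s ∧ r - s ∈ Q}.Finite := by
  classical
  set δ := ∏ z ∈ S.offDiag, (z.1 - z.2) with hδ
  have hδ0 : δ ≠ 0 := Finset.prod_ne_zero_iff.mpr fun z hz ↦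
    sub_ne_zero.mpr (Finset.mem_offDiag.mp hz).2.2
  have hN : Ideal.absNorm (Ideal.span {δ}) ≠ 0 := by
    rwa [Ne, Ideal.absNorm_eq_zero_iff, Ideal.span_singleton_eq_bot]
  refine (Finset.finite_toSet (Ideal.absNorm (Ideal.span {δ})).primeFactors).subset ?_
  rintro p ⟨hp, Q, hQ, hpQ, r, hr, s, hs, hne, hrs⟩
  have hδQ : δ ∈ Q := by
    rw [hδ, ← Finset.mul_prod_erase _ _ (Finset.mem_offDiag.mpr ⟨hr, hs, hne⟩ : (r, s) ∈ S.offDiag)]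
    exact Q.mul_mem_right _ hrs
  have hNQ : ((Ideal.absNorm (Ideal.span {δ}) : ℕ) : 𝓞 L) ∈ Q :=
    (Ideal.span_singleton_le_iff_mem Q).mpr hδQ (Ideal.absNorm_mem _)
  refine Finset.mem_coe.mpr (Nat.mem_primeFactors.mpr ⟨hp, ?_, hN⟩)
  by_contra hdvd
  have hcop : IsCoprime (p : ℤ) (Ideal.absNorm (Ideal.span {δ}) : ℤ) :=
    Nat.isCoprime_iff_coprime.mpr ((Nat.Prime.coprime_iff_not_dvd hp).mpr hdvd)
  obtain ⟨a, b, hab⟩ := hcop.map (Int.castRingHom (𝓞 L))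
  refine hQ.ne_top ((Ideal.eq_top_iff_one Q).mpr ?_)
  rw [← hab]
  exact Q.add_mem (Q.mul_mem_left _ (by simpa using hpQ)) (Q.mul_mem_left _ (by simpa using hNQ))

theorem exists_isPrime_natCast_mem {p : ℕ} (hp : p.Prime) :
    ∃ Q : Ideal (𝓞 L), Q.IsPrime ∧ (p : 𝓞 L) ∈ Q := by
  have hprime : (Ideal.span {(p : ℤ)}).IsPrime :=
    (Ideal.span_singleton_prime (by exact_mod_cast hp.ne_zero)).mpr (Nat.prime_iff_prime_int.mp hp)
  obtain ⟨⟨Q, hQ, ⟨h⟩⟩⟩ := Ideal.nonempty_primesOver (S := 𝓞 L) (Ideal.span {(p : ℤ)})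
  refine ⟨Q, hQ, ?_⟩
  have : (p : ℤ) ∈ Q.under ℤ := h ▸ Ideal.mem_span_singleton_self _
  simpa [Ideal.mem_comap] using this

theorem exists_isFrobenius_gal [IsGalois ℚ L] {p : ℕ} (hp : p.Prime) {Q : Ideal (𝓞 L)}
    [Q.IsPrime] (hpQ : (p : 𝓞 L) ∈ Q) : ∃ σ : L ≃ₐ[ℚ] L, IsFrobenius p σ Q := by
  have : Fact p.Prime := ⟨hp⟩
  have : Finite (𝓞 L ⧸ Q) := Q.finiteQuotientOfFreeOfNeBot (by
    rintro rfl
    rw [Ideal.mem_bot] at hpQ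
    exact hp.ne_zero (by exact_mod_cast hpQ))
  refine exists_isFrobenius (C := ℤ) ?_
  rw [under_int_eq hpQ, Nat.card_congr (Int.quotientSpanNatEquivZMod p).toEquiv, Nat.card_zmod]

end IntegralRoots

section Factorization

open Polynomial

theorem exists_degrees_iff {F : Type*} [Field F] {h : F[X]} (P : Finset F[X])
    (hP : ∀ q ∈ P, q.Monic ∧ Irreducible q) (hprod : ∏ q ∈ P, q = h) (π : Multiset ℕ) :
    (∃ s : Multiset F[X], (∀ g ∈ s, g.Monic ∧ Irreducible g) ∧ s.prod = h ∧
      s.map natDegree = π) ↔ P.val.map natDegree = π := by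
  constructor
  · rintro ⟨s, hs, hsh, rfl⟩
    have hrel : Multiset.Rel Associated P.val s :=
      UniqueFactorizationMonoid.factors_unique (fun q hq ↦ (hP q hq).2) (fun q hq ↦ (hs q hq).2)
        ((Finset.prod_val P).trans (hprod.trans hsh.symm) ▸ .refl _)
    rw [Multiset.rel_eq.mp (hrel.mono fun a ha b hb hab ↦
      eq_of_monic_of_associated (hP a ha).1 (hs b hb).1 hab)]
  · exact fun h ↦ ⟨P.val, hP, (Finset.prod_val P).trans hprod, h⟩

variable {F k : Type*} [Field F] [Field k] [Algebra F k] {h : F[X]}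
  {T : Finset k}

theorem minpoly_dvd_of_map_eq (hT : h.map (algebraMap F k) = ∏ t ∈ T, (X - C t)) {t : k}
    (ht : t ∈ T) : minpoly F t ∣ h := by
  refine minpoly.dvd F t ?_
  rw [← eval_map_algebraMap, hT, eval_prod]
  exact Finset.prod_eq_zero ht (by simp)

variable [Algebra.IsAlgebraic F k]

theorem prod_minpoly_eq [DecidableEq F[X]] (hh : h.Monic)
    (hT : h.map (algebraMap F k) = ∏ t ∈ T, (X - C t)) :
    ∏ q ∈ T.image (minpoly F), q = h := by
  have hmon : ∀ q ∈ T.image (minpoly F), q.Monic ∧ Irreducible q := fun q hq ↦ by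
    obtain ⟨t, -, rfl⟩ := Finset.mem_image.mp hq
    exact ⟨minpoly.monic (Algebra.IsIntegral.isIntegral t),
      minpoly.irreducible (Algebra.IsIntegral.isIntegral t)⟩
  refine eq_of_monic_of_associated (monic_prod_of_monic _ _ fun q hq ↦ (hmon q hq).1) hh
    (associated_of_dvd_dvd ?_ ?_)
  · refine Finset.prod_dvd_of_coprime (fun q hq q' hq' hne ↦ ?_) fun q hq ↦ ?_
    · refine (Irreducible.coprime_iff_not_dvd (hmon q hq).2).mpr fun hdvd ↦ hne ?_
      exact eq_of_monic_of_associated (hmon q hq).1 (hmon q' hq').1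
        ((hmon q hq).2.associated_of_dvd (hmon q' hq').2 hdvd)
    · obtain ⟨t, ht, rfl⟩ := Finset.mem_image.mp hq
      exact minpoly_dvd_of_map_eq hT ht
  · rw [← map_dvd_map' (algebraMap F k), hT]
    refine Finset.prod_dvd_of_coprime (fun t _ t' _ hne ↦ ?_) fun t ht ↦ ?_
    · exact isCoprime_X_sub_C_of_isUnit_sub (sub_ne_zero.mpr hne).isUnit
    · rw [dvd_iff_isRoot, IsRoot.def, eval_map_algebraMap, map_prod]
      exact Finset.prod_eq_zero (Finset.mem_image_of_mem _ ht) (minpoly.aeval F t)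

theorem natDegree_minpoly_eq [DecidableEq F[X]] (hh : h.Monic)
    (hT : h.map (algebraMap F k) = ∏ t ∈ T, (X - C t)) {t : k} (ht : t ∈ T) :
    (minpoly F t).natDegree = (T.filter fun s ↦ minpoly F s = minpoly F t).card := by
  classical
  have hsplit : (h.map (algebraMap F k)).Splits := by
    rw [hT]
    exact Splits.prod fun s _ ↦ Splits.X_sub_C s
  have hsep : (h.map (algebraMap F k)).Separable := by
    rw [hT]
    exact (separable_prod_X_sub_C_iff' (f := fun t : k ↦ t)).mpr fun _ _ _ _ h ↦ h
  have hdvd : (minpoly F t).map (algebraMap F k) ∣ h.map (algebraMap F k) :=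
    Polynomial.map_dvd (algebraMap F k) (minpoly_dvd_of_map_eq hT ht)
  have h_int : ∀ s : k, IsIntegral F s := fun s ↦ Algebra.IsIntegral.isIntegral s
  rw [← natDegree_map (algebraMap F k),
    (hsplit.of_dvd (hh.map _).ne_zero hdvd).natDegree_eq_card_roots,
    ← Multiset.toFinset_card_of_nodup (nodup_roots (hsep.of_dvd hdvd))]
  refine congrArg _ (Finset.ext fun s ↦ ?_)
  rw [Multiset.mem_toFinset, mem_roots ((minpoly.monic (h_int t)).map _).ne_zero, IsRoot.def,
    eval_map_algebraMap, Finset.mem_filter]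
  constructor
  · intro hs
    have hmem : aeval s h = 0 := aeval_eq_zero_of_dvd_aeval_eq_zero (minpoly_dvd_of_map_eq hT ht) hs
    rw [← eval_map_algebraMap, hT, eval_prod, Finset.prod_eq_zero_iff] at hmem
    obtain ⟨t', ht', h0⟩ := hmem
    rw [eval_sub, eval_X, eval_C, sub_eq_zero] at h0
    refine ⟨by rwa [h0], (minpoly.eq_of_irreducible_of_monic (minpoly.irreducible (h_int t)) hs
      (minpoly.monic (h_int t))).symm⟩
  · rintro ⟨-, hs⟩
    rw [← hs]
    exact minpoly.aeval F s

/-- Reindexing the multiset of fibre statistics of two functions with the same fibres. -/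
theorem map_val_image_eq {ι α β γ : Type*} [DecidableEq α] [DecidableEq β] (S : Finset ι)
    (a : ι → α) (b : ι → β) (u : α → γ) (v : β → γ)
    (hab : ∀ x ∈ S, ∀ y ∈ S, a x = a y ↔ b x = b y) (huv : ∀ x ∈ S, u (a x) = v (b x)) :
    (S.image a).val.map u = (S.image b).val.map v := by
  rcases S.eq_empty_or_nonempty with rfl | ⟨x₀, -⟩
  · simp
  have : Nonempty ι := ⟨x₀⟩
  choose! g hg using fun (y : α) (hy : y ∈ S.image a) ↦ Finset.mem_image.mp hy
  have hb : S.image b = (S.image a).image (b ∘ g) := by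
    rw [Finset.image_image]
    refine Finset.image_congr fun x hx ↦ ?_
    have := hg (a x) (Finset.mem_image_of_mem a hx)
    exact (hab x hx _ this.1).mp this.2.symm
  have hinj : Set.InjOn (b ∘ g) (S.image a) := fun y hy z hz hyz ↦ by
    rw [← (hg y hy).2, ← (hg z hz).2]
    exact (hab _ (hg y hy).1 _ (hg z hz).1).mpr hyz
  rw [hb, Finset.image_val_of_injOn hinj, Multiset.map_map]
  refine Multiset.map_congr rfl fun y hy ↦ ?_
  rw [Function.comp, Function.comp, ← huv _ (hg y hy).1, (hg y hy).2]

end Factorization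

section FactorizationType

open Polynomial NumberField

variable {L : Type*} [Field L] {f : ℤ[X]} {p : ℕ} {Q : Ideal (𝓞 L)}
  {S : Finset (𝓞 L)}

theorem map_castRingHom_eq_prod (F : Type*) [Field F] [Algebra F (𝓞 L ⧸ Q)]
    (hS : f.map (Int.castRingHom (𝓞 L)) = ∏ r ∈ S, (X - C r)) [DecidableEq (𝓞 L ⧸ Q)]
    (hQ : ∀ r ∈ S, ∀ s ∈ S, r - s ∈ Q → r = s) :
    (f.map (Int.castRingHom F)).map (algebraMap F (𝓞 L ⧸ Q)) =
      ∏ t ∈ S.image (Ideal.Quotient.mk Q), (X - C t) := by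
  rw [Finset.prod_image fun r hr s hs h ↦ hQ r hr s hs (Ideal.Quotient.eq.mp h), map_map]
  have h1 : (algebraMap F (𝓞 L ⧸ Q)).comp (Int.castRingHom F) =
    (Ideal.Quotient.mk Q).comp (Int.castRingHom (𝓞 L)) := RingHom.ext_int _ _
  rw [h1, ← map_map, hS, Polynomial.map_prod]
  simp

variable [NumberField L] {σ : L ≃ₐ[ℚ] L}

open scoped Classical in
/-- The multiset of sizes of the orbits of `σ` on `R`. -/
noncomputable def orbitType (R : Finset L) (σ : L ≃ₐ[ℚ] L) : Multiset ℕ :=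
  (R.image fun x ↦ R.filter fun y ↦ ∃ k : ℤ, (σ ^ k) x = y).val.map Finset.card

theorem factorizationType_iff (hf : f.Monic) (hp : p.Prime) [Q.IsPrime] (hpQ : (p : 𝓞 L) ∈ Q)
    (hσ : IsFrobenius p σ Q) (hS : f.map (Int.castRingHom (𝓞 L)) = ∏ r ∈ S, (X - C r))
    (hQ : ∀ r ∈ S, ∀ s ∈ S, r - s ∈ Q → r = s) {R : Finset L}
    (hR : ∀ x : L, x ∈ R ↔ ∃ r ∈ S, (r : L) = x) (π : Multiset ℕ) :
    (Squarefree (f.map (Int.castRingHom (ZMod p))) ∧ ∃ s : Multiset (ZMod p)[X],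
      (∀ g ∈ s, g.Monic ∧ Irreducible g) ∧ s.prod = f.map (Int.castRingHom (ZMod p)) ∧
        s.map natDegree = π) ↔ orbitType R σ = π := by
  classical
  have : Fact p.Prime := ⟨hp⟩
  have : Finite (𝓞 L ⧸ Q) := Q.finiteQuotientOfFreeOfNeBot (by
    rintro rfl
    rw [Ideal.mem_bot] at hpQ
    exact hp.ne_zero (by exact_mod_cast hpQ))
  have : Q.IsMaximal := Ideal.Quotient.maximal_of_isField _ (Finite.isField_of_domain (𝓞 L ⧸ Q))
  let := Ideal.Quotient.field Q
  have : CharP (𝓞 L ⧸ Q) p := (CharP.charP_iff_prime_eq_zero hp).mpr (by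
    rw [← map_natCast (Ideal.Quotient.mk Q)]
    exact Ideal.Quotient.eq_zero_iff_mem.mpr hpQ)
  let := ZMod.algebra (𝓞 L ⧸ Q) p
  have := Fintype.ofFinite (𝓞 L ⧸ Q)
  set mk := Ideal.Quotient.mk Q with hmk
  have hT := map_castRingHom_eq_prod (ZMod p) hS hQ
  have hmon : (f.map (Int.castRingHom (ZMod p))).Monic := hf.map _
  have hinj : Set.InjOn mk S := fun r hr s hs h ↦ hQ r hr s hs (Ideal.Quotient.eq.mp h)
  have hsq : Squarefree (f.map (Int.castRingHom (ZMod p))) := by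
    refine Separable.squarefree ((separable_map (algebraMap (ZMod p) (𝓞 L ⧸ Q))).mp ?_)
    rw [hT]
    exact (separable_prod_X_sub_C_iff' (f := fun t : 𝓞 L ⧸ Q ↦ t)).mpr fun _ _ _ _ h ↦ h
  have hpow (n : ℕ) (x : 𝓞 L) : mk (σ ^ n • x) = mk x ^ p ^ n := by
    rw [← map_pow, hmk, Ideal.Quotient.eq]
    exact hσ.pow_sub_mem n x
  have hrel (x : 𝓞 L) (hx : x ∈ S) (y : 𝓞 L) (hy : y ∈ S) :
      minpoly (ZMod p) (mk x) = minpoly (ZMod p) (mk y) ↔ ∃ k : ℤ, σ ^ k • x = y := by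
    constructor
    · intro h
      obtain ⟨τ, hτ⟩ := isConjRoot_iff_exists_algEquiv.mp h
      obtain ⟨n, hn⟩ := exists_ringHom_eq_pow p (τ : (𝓞 L ⧸ Q) →+* (𝓞 L ⧸ Q))
      have h1 : mk x = mk (σ ^ n • y) := by
        rw [hpow, ← hτ]
        exact hn (mk y)
      have h2 := hinj hx (smul_mem_integralRoots hS _ hy) h1
      exact ⟨-n, by rw [h2, zpow_neg, zpow_natCast, inv_smul_smul]⟩
    · rintro ⟨k, rfl⟩
      obtain ⟨n, hn⟩ : ∃ n : ℕ, σ ^ n = σ ^ k := by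
        obtain ⟨n, hn⟩ := mem_powers_iff_mem_zpowers.mpr (⟨k, rfl⟩ : σ ^ k ∈ Subgroup.zpowers σ)
        exact ⟨n, hn⟩
      rw [← hn, hpow]
      have h1 := minpoly.algEquiv_eq
        (FiniteField.frobeniusAlgEquivOfAlgebraic (ZMod p) (𝓞 L ⧸ Q) ^ n) (mk x)
      rw [AlgEquiv.coe_pow, FiniteField.coe_frobeniusAlgEquivOfAlgebraic_iterate, ZMod.card] at h1
      exact h1.symm
  have himage : R = S.image fun r : 𝓞 L ↦ (r : L) := by
    ext x
    rw [hR, Finset.mem_image]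
  have hfilter (x : 𝓞 L) (hx : x ∈ S) : (R.filter fun y ↦ ∃ k : ℤ, (σ ^ k) (x : L) = y) =
      (S.filter fun y ↦ minpoly (ZMod p) (mk x) = minpoly (ZMod p) (mk y)).image
        fun r : 𝓞 L ↦ (r : L) := by
    rw [himage, Finset.filter_image]
    refine congrArg _ (Finset.filter_congr fun y hy ↦ ?_)
    rw [hrel x hx y hy]
    exact exists_congr fun k ↦
      ⟨fun h ↦ RingOfIntegers.ext h, fun h ↦ congrArg (fun r : 𝓞 L ↦ (r : L)) h⟩
  have hcoe : Function.Injective fun r : 𝓞 L ↦ (r : L) := RingOfIntegers.coe_injective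
  rw [and_iff_right hsq, exists_degrees_iff _ (fun q hq ↦ ?_) (prod_minpoly_eq hmon hT)]
  swap
  · obtain ⟨t, -, rfl⟩ := Finset.mem_image.mp hq
    exact ⟨minpoly.monic (Algebra.IsIntegral.isIntegral t),
      minpoly.irreducible (Algebra.IsIntegral.isIntegral t)⟩
  have hmain : orbitType R σ =
      ((S.image mk).image (minpoly (ZMod p))).val.map natDegree := by
    rw [orbitType]
    conv_lhs => enter [2, 1, 2]; rw [himage]
    rw [Finset.image_image, Finset.image_image]
    refine map_val_image_eq S _ _ _ _ (fun x hx y hy ↦ ?_) fun x hx ↦ ?_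
    · simp only [Function.comp]
      rw [hfilter x hx, hfilter y hy, (Finset.image_injective hcoe).eq_iff]
      refine ⟨fun h ↦ ?_, fun h ↦ by rw [h]⟩
      have : x ∈ S.filter fun z ↦ minpoly (ZMod p) (mk x) = minpoly (ZMod p) (mk z) := by
        simp [hx]
      rw [h, Finset.mem_filter] at this
      exact this.2.symm
    · simp only [Function.comp]
      rw [hfilter x hx, Finset.card_image_of_injective _ hcoe,
        natDegree_minpoly_eq hmon hT (Finset.mem_image_of_mem mk hx), Finset.filter_image,
        Finset.card_image_of_injOn (hinj.mono fun y hy ↦ (Finset.mem_filter.mp hy).1)]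
      exact congrArg _ (Finset.filter_congr fun y _ ↦ eq_comm)
  rw [hmain]

end FactorizationType

section ClassFunction

open Finset

variable {G : Type*} [Group G] [Finite G]

open scoped Classical in
theorem natCard_conj_zpowers_mem (H : Subgroup G) (σ : G) :
    Nat.card {τ : G // τ⁻¹ * σ * τ ∈ H} = Nat.card {τ : G // Subgroup.zpowers (τ⁻¹ * σ * τ) = H} +
      ∑ᶠ K : {K : Subgroup G // K < H}, Nat.card {τ : G // Subgroup.zpowers (τ⁻¹ * σ * τ) = K} := by
  have := Fintype.ofFinite G
  rw [finsum_eq_sum_of_fintype]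
  simp only [Nat.card_eq_fintype_card, Fintype.card_subtype]
  have h1 : (univ.filter fun τ : G ↦ τ⁻¹ * σ * τ ∈ H) =
      (univ.filter fun τ : G ↦ Subgroup.zpowers (τ⁻¹ * σ * τ) = H) ∪
        univ.filter fun τ : G ↦ Subgroup.zpowers (τ⁻¹ * σ * τ) < H := by
    ext τ
    simp [← Subgroup.zpowers_le, le_iff_eq_or_lt]
  rw [h1, card_union_of_disjoint]
  · congr 1
    have := card_eq_sum_card_fiberwise
      (s := univ.filter fun τ : G ↦ Subgroup.zpowers (τ⁻¹ * σ * τ) < H)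
      (t := univ.filter fun K : Subgroup G ↦ K < H) (f := fun τ ↦ Subgroup.zpowers (τ⁻¹ * σ * τ))
      (by intro τ; simp)
    rw [this, sum_subtype (univ.filter fun K : Subgroup G ↦ K < H) (p := fun K ↦ K < H) (by simp)]
    refine sum_congr rfl fun K _ ↦ ?_
    congr 1
    ext τ
    have := K.2
    simp only [mem_filter, mem_univ, true_and, and_iff_right_iff_imp]
    rintro h
    rwa [h]
  · rw [disjoint_filter]
    exact fun τ _ h ↦ h.not_lt

/-- A subspace of functions on a finite group containing the permutation characters of all the
coset spaces contains every class function which only depends on the subgroup generated. -/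
theorem mem_of_forall_natCard_conj_mem (P : Submodule ℝ (G → ℝ))
    (hP : ∀ H : Subgroup G, (fun σ ↦ (Nat.card {τ : G // τ⁻¹ * σ * τ ∈ H} : ℝ)) ∈ P) {F : G → ℝ}
    (hF : ∀ σ τ, F (τ⁻¹ * σ * τ) = F σ) (hF' : F.FactorsThrough Subgroup.zpowers) : F ∈ P := by
  classical
  have := Fintype.ofFinite G
  have hB (H : Subgroup G) :
      (fun σ ↦ (Nat.card {τ : G // Subgroup.zpowers (τ⁻¹ * σ * τ) = H} : ℝ)) ∈ P := by
    induction H using WellFoundedLT.induction with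
    | ind H ih =>
      have : (fun σ ↦ (Nat.card {τ : G // Subgroup.zpowers (τ⁻¹ * σ * τ) = H} : ℝ)) =
          (fun σ ↦ (Nat.card {τ : G // τ⁻¹ * σ * τ ∈ H} : ℝ)) -
            ∑ K : {K : Subgroup G // K < H},
              fun σ ↦ (Nat.card {τ : G // Subgroup.zpowers (τ⁻¹ * σ * τ) = K} : ℝ) := by
        ext σ
        rw [Pi.sub_apply, natCard_conj_zpowers_mem, finsum_eq_sum_of_fintype, Finset.sum_apply]
        push_cast
        ring
      rw [this]
      exact P.sub_mem (hP H) (P.sum_mem fun K _ ↦ ih K K.2)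
  obtain ⟨e, rfl⟩ : ∃ e : Subgroup G → ℝ, F = e ∘ Subgroup.zpowers :=
    (Function.factorsThrough_iff F).mp hF'
  have : e ∘ Subgroup.zpowers = (Fintype.card G : ℝ)⁻¹ • ∑ H : Subgroup G,
      e H • fun σ ↦ (Nat.card {τ : G // Subgroup.zpowers (τ⁻¹ * σ * τ) = H} : ℝ) := by
    ext σ
    have h1 : ∑ τ : G, (e ∘ Subgroup.zpowers) (τ⁻¹ * σ * τ) =
        Fintype.card G * (e ∘ Subgroup.zpowers) σ := by
      rw [sum_congr rfl fun τ _ ↦ hF σ τ]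
      simp
    rw [← sum_fiberwise univ (fun τ ↦ Subgroup.zpowers (τ⁻¹ * σ * τ))] at h1
    rw [Pi.smul_apply, Finset.sum_apply, smul_eq_mul, eq_inv_mul_iff_mul_eq₀ (by simp), ← h1]
    refine sum_congr rfl fun H _ ↦ ?_
    rw [Pi.smul_apply, Nat.card_eq_fintype_card, Fintype.card_subtype, smul_eq_mul, mul_comm,
      ← nsmul_eq_mul, ← sum_const]
    exact sum_congr rfl fun τ hτ ↦ congrArg e (mem_filter.mp hτ).2
  rw [this]
  exact P.smul_mem _ (P.sum_mem fun H _ ↦ P.smul_mem _ (hB H))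

end ClassFunction

section NaturalDensity

open Filter Topology Finset Asymptotics

theorem tendsto_primeCounting_mul_log_sub_theta_div :
    Tendsto (fun x : ℝ ↦ ((Nat.primeCounting ⌊x⌋₊ : ℝ) * Real.log x - Chebyshev.theta x) / x)
      atTop (𝓝 0) := by
  have h1 : (fun x : ℝ ↦ (Nat.primeCounting ⌊x⌋₊ : ℝ) * Real.log x - Chebyshev.theta x) =O[atTop]
      fun x ↦ x / Real.log x := by
    refine (Chebyshev.primeCounting_sub_theta_div_log_isBigO.mul
      (isBigO_refl Real.log atTop)).congr' ?_ ?_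
    all_goals
      filter_upwards [eventually_gt_atTop 1] with x hx
      have := Real.log_pos hx
      field_simp
  refine (h1.trans_isLittleO ?_).tendsto_div_nhds_zero
  refine isLittleO_of_tendsto' ?_ ?_
  · filter_upwards [eventually_gt_atTop 0] with x hx h
    exact absurd h hx.ne'
  · refine Real.tendsto_log_atTop.inv_tendsto_atTop.congr' ?_
    filter_upwards [eventually_gt_atTop 0] with x hx
    rw [Pi.inv_apply]
    field_simp

theorem range_filter_prime (N : ℕ) :
    ((range (N + 1)).filter Nat.Prime) = (Ioc 0 N).filter Nat.Prime := by
  ext p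
  simp only [mem_filter, mem_range, mem_Ioc, and_congr_left_iff]
  intro hp
  have := hp.pos
  omega

theorem tendsto_sum_prime_mul_log_div {a : ℕ → ℝ} {B c : ℝ} (ha : ∀ p, |a p| ≤ B)
    (h : Tendsto (fun x ↦ primeLogSum a x / x) atTop (𝓝 c)) :
    Tendsto (fun N : ℕ ↦ (∑ p ∈ range (N + 1) with p.Prime, a p) * Real.log N / N) atTop
      (𝓝 c) := by
  have h0 := (tendsto_primeCounting_mul_log_sub_theta_div.comp
    tendsto_natCast_atTop_atTop).const_mul B
  rw [mul_zero] at h0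
  have h1 : Tendsto (fun N : ℕ ↦ (∑ p ∈ range (N + 1) with p.Prime, a p) * Real.log N / N -
      primeLogSum a N / N) atTop (𝓝 0) := by
    refine squeeze_zero_norm (fun N ↦ ?_) h0
    rw [Function.comp_apply, ← sub_div, norm_div, Real.norm_natCast, ← mul_div_assoc,
      Real.norm_eq_abs]
    gcongr
    have hcard : (Nat.primeCounting N : ℝ) = ∑ p ∈ Ioc 0 N with p.Prime, (1 : ℝ) := by
      rw [Nat.primeCounting, Nat.primeCounting', Nat.count_eq_card_filter_range,
        range_filter_prime]
      simp
    rw [Nat.floor_natCast, hcard, Chebyshev.theta, primeLogSum, Nat.floor_natCast,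
      range_filter_prime, sum_mul, sum_mul, ← sum_sub_distrib, ← sum_sub_distrib, mul_sum]
    refine (abs_sum_le_sum_abs _ _).trans (sum_le_sum fun p hp ↦ ?_)
    have h2 : Real.log p ≤ Real.log N := by
      obtain ⟨h3, h4⟩ := mem_filter.mp hp
      exact Real.log_le_log (by exact_mod_cast h4.pos) (by exact_mod_cast (mem_Ioc.mp h3).2)
    rw [one_mul, mul_comm (Real.log p), ← mul_sub, abs_mul, abs_of_nonneg (sub_nonneg.mpr h2)]
    exact mul_le_mul_of_nonneg_right (ha p) (sub_nonneg.mpr h2)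
  simpa using h1.add (h.comp tendsto_natCast_atTop_atTop)

/-- A bounded function on the primes with a logarithmically weighted mean value has the same
natural mean value. -/
theorem tendsto_sum_prime_div_card {a : ℕ → ℝ} {B c : ℝ} (ha : ∀ p, |a p| ≤ B)
    (h1 : Tendsto (fun x ↦ primeLogSum 1 x / x) atTop (𝓝 1))
    (h : Tendsto (fun x ↦ primeLogSum a x / x) atTop (𝓝 c)) :
    Tendsto (fun N : ℕ ↦ (∑ p ∈ range (N + 1) with p.Prime, a p) /
      (((range (N + 1)).filter Nat.Prime).card : ℝ)) atTop (𝓝 c) := by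
  have h2 := (tendsto_sum_prime_mul_log_div ha h).div
    (tendsto_sum_prime_mul_log_div (B := 1) (fun p ↦ by simp) h1) one_ne_zero
  rw [div_one] at h2
  refine h2.congr' ?_
  filter_upwards [eventually_gt_atTop 1] with N hN
  have h3 : (N : ℝ) ≠ 0 := by positivity
  have h4 : Real.log N ≠ 0 := (Real.log_pos (by exact_mod_cast hN)).ne'
  rw [Pi.div_apply, div_div_div_cancel_right₀ h3, mul_div_mul_right _ _ h4]
  simp

end NaturalDensity

section FrobeniusMean

open Filter Topology Finset NumberField IntermediateField

theorem primeLogSum_add (a b : ℕ → ℝ) (x : ℝ) :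
    primeLogSum (a + b) x = primeLogSum a x + primeLogSum b x := by
  simp [primeLogSum, mul_add, sum_add_distrib]

theorem primeLogSum_smul (c : ℝ) (a : ℕ → ℝ) (x : ℝ) :
    primeLogSum (c • a) x = c * primeLogSum a x := by
  simp [primeLogSum, mul_sum, mul_left_comm]

theorem tendsto_primeLogSum_congr {a b : ℕ → ℝ} {Z : Set ℕ} (hZ : Z.Finite)
    (hab : ∀ p, p.Prime → p ∉ Z → a p = b p) {c : ℝ}
    (h : Tendsto (fun x ↦ primeLogSum a x / x) atTop (𝓝 c)) :
    Tendsto (fun x ↦ primeLogSum b x / x) atTop (𝓝 c) := by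
  classical
  set C := ∑ p ∈ hZ.toFinset, |Real.log p * (b p - a p)| with hC
  have h1 : Tendsto (fun x ↦ primeLogSum b x / x - primeLogSum a x / x) atTop (𝓝 0) := by
    have h0 : Tendsto (fun x : ℝ ↦ C / |x|) atTop (𝓝 0) :=
      tendsto_const_nhds.div_atTop tendsto_abs_atTop_atTop
    refine squeeze_zero_norm (fun x ↦ ?_) h0
    rw [← sub_div, norm_div, Real.norm_eq_abs, Real.norm_eq_abs]
    gcongr
    rw [primeLogSum, primeLogSum, ← sum_sub_distrib]
    simp_rw [← mul_sub]
    refine (abs_sum_le_sum_abs _ _).trans ?_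
    rw [hC, ← sum_filter_add_sum_filter_not _ (· ∈ Z), sum_eq_zero (s := filter (· ∉ Z) _),
      add_zero]
    · refine sum_le_sum_of_subset_of_nonneg (fun p hp ↦ ?_) fun _ _ _ ↦ abs_nonneg _
      simpa using (mem_filter.mp hp).2
    · intro p hp
      simp only [mem_filter] at hp
      rw [hab p hp.1.2 hp.2, sub_self, mul_zero, abs_zero]
  simpa using h1.add h

/-- The functions whose mean value along `σ`, weighted by `log p`, is their average over `G`. -/
noncomputable def equidistributed {G : Type*} [Group G] [Finite G] (σ : ℕ → G) :
    Submodule ℝ (G → ℝ) where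
  carrier := {F | Tendsto (fun x ↦ primeLogSum (F ∘ σ) x / x) atTop
    (𝓝 ((∑ᶠ g, F g) / Nat.card G))}
  zero_mem' := by simp [primeLogSum]
  add_mem' {F F'} h h' := by
    have := h.add h'
    rw [← add_div, ← finsum_add_distrib (Set.toFinite _) (Set.toFinite _)] at this
    refine this.congr fun x ↦ ?_
    rw [← add_div, ← primeLogSum_add]
    rfl
  smul_mem' c F h := by
    have := Tendsto.const_mul c h
    rw [← mul_div_assoc, ← smul_eq_mul, smul_finsum] at this
    refine this.congr fun x ↦ ?_
    rw [← mul_div_assoc, ← primeLogSum_smul]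
    rfl

theorem finsum_natCard_conj_mem {G : Type*} [Group G] [Finite G] (H : Subgroup G) :
    ∑ᶠ σ : G, (Nat.card {τ : G // τ⁻¹ * σ * τ ∈ H} : ℝ) = Nat.card G * Nat.card H := by
  have := Fintype.ofFinite G
  have h (τ : G) : Nat.card {σ : G // τ⁻¹ * σ * τ ∈ H} = Nat.card H :=
    Nat.card_congr ((MulAut.conj τ⁻¹).toEquiv.subtypeEquiv fun σ ↦ by simp)
  rw [finsum_eq_sum_of_fintype, ← Nat.cast_sum, ← Nat.card_sigma,
    Nat.card_congr (Equiv.trans (Equiv.sigmaCongrRight fun σ ↦ Equiv.refl _)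
      ((Equiv.subtypeProdEquivSigmaSubtype fun σ τ : G ↦ τ⁻¹ * σ * τ ∈ H).symm.trans
        (((Equiv.prodComm G G).subtypeEquiv fun _ ↦ Iff.rfl).trans
          (Equiv.subtypeProdEquivSigmaSubtype fun τ σ : G ↦ τ⁻¹ * σ * τ ∈ H)))), Nat.card_sigma]
  simp [h]

variable {L : Type*} [Field L] [NumberField L] [IsGalois ℚ L] {σ : ℕ → (L ≃ₐ[ℚ] L)} {Z : Set ℕ}

theorem mem_equidistributed (hZ : Z.Finite) (hσ : ∀ p, p.Prime → p ∉ Z → ∃ Q : Ideal (𝓞 L),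
      Q.IsPrime ∧ (p : 𝓞 L) ∈ Q ∧ IsFrobenius p (σ p) Q ∧
        ∀ g : L ≃ₐ[ℚ] L, (∀ x : 𝓞 L, g • x - x ∈ Q) → g = 1)
    {F : (L ≃ₐ[ℚ] L) → ℝ} (hF : ∀ g τ, F (τ⁻¹ * g * τ) = F g)
    (hF' : F.FactorsThrough Subgroup.zpowers) : F ∈ equidistributed σ := by
  refine mem_of_forall_natCard_conj_mem _ (fun H ↦ ?_) hF hF'
  change Tendsto _ _ (𝓝 _)
  rw [finsum_natCard_conj_mem, mul_div_cancel_left₀ _ (by simp)]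
  have h := (tendsto_primeLogSum_degreeOneCount (fixedField H)).const_mul (Nat.card H : ℝ)
  rw [mul_one] at h
  simp_rw [← mul_div_assoc, ← primeLogSum_smul] at h
  refine tendsto_primeLogSum_congr hZ (fun p hp hpZ ↦ ?_) h
  obtain ⟨Q, hQ, hpQ, hfrob, hin⟩ := hσ p hp hpZ
  rw [Function.comp_apply, ← card_mul_degreeOneCount H hp hpQ hfrob hin]
  simp

/-- **Chebotarev density theorem** for unions of classes of elements generating conjugate cyclic
subgroups. -/
theorem tendsto_sum_frobenius_div_card (hZ : Z.Finite)
    (hσ : ∀ p, p.Prime → p ∉ Z → ∃ Q : Ideal (𝓞 L),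
      Q.IsPrime ∧ (p : 𝓞 L) ∈ Q ∧ IsFrobenius p (σ p) Q ∧
        ∀ g : L ≃ₐ[ℚ] L, (∀ x : 𝓞 L, g • x - x ∈ Q) → g = 1)
    {F : (L ≃ₐ[ℚ] L) → ℝ} (hF : ∀ g τ, F (τ⁻¹ * g * τ) = F g)
    (hF' : F.FactorsThrough Subgroup.zpowers) {a : ℕ → ℝ} {B : ℝ} (ha : ∀ p, |a p| ≤ B)
    (haF : ∀ p, p.Prime → p ∉ Z → a p = F (σ p)) :
    Tendsto (fun N : ℕ ↦ (∑ p ∈ range (N + 1) with p.Prime, a p) /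
      (((range (N + 1)).filter Nat.Prime).card : ℝ)) atTop
      (𝓝 ((∑ᶠ g, F g) / Nat.card (L ≃ₐ[ℚ] L))) := by
  have := Fintype.ofFinite (L ≃ₐ[ℚ] L)
  have h1 : Tendsto (fun x ↦ primeLogSum 1 x / x) atTop (𝓝 1) := by
    have h : (1 : (L ≃ₐ[ℚ] L) → ℝ) ∈ equidistributed σ :=
      mem_equidistributed hZ hσ (fun _ _ ↦ rfl) fun _ _ _ ↦ rfl
    change Tendsto _ _ (𝓝 _) at h
    simpa [finsum_eq_sum_of_fintype] using h
  exact tendsto_sum_prime_div_card ha h1 (tendsto_primeLogSum_congr hZ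
    (fun p hp hpZ ↦ (haF p hp hpZ).symm) (mem_equidistributed hZ hσ hF hF'))

end FrobeniusMean

section CycleTypes

open Filter Topology Finset NumberField Polynomial

variable {L : Type*} [Field L] [NumberField L]

theorem orbitType_eq_of_zpowers_eq (R : Finset L) {σ τ : L ≃ₐ[ℚ] L}
    (h : Subgroup.zpowers σ = Subgroup.zpowers τ) : orbitType R σ = orbitType R τ := by
  classical
  have hrel (σ : L ≃ₐ[ℚ] L) (x y : L) :
      (∃ k : ℤ, (σ ^ k) x = y) ↔ ∃ g ∈ Subgroup.zpowers σ, g x = y :=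
    (Subgroup.exists_mem_zpowers (p := fun g : L ≃ₐ[ℚ] L ↦ g x = y)).symm
  rw [orbitType, orbitType]
  congr 3
  funext x
  exact filter_congr fun y _ ↦ by rw [hrel σ, hrel τ, h]

theorem orbitType_conj {R : Finset L} (hR : ∀ (g : L ≃ₐ[ℚ] L), ∀ x ∈ R, g x ∈ R)
    (σ τ : L ≃ₐ[ℚ] L) : orbitType R (τ⁻¹ * σ * τ) = orbitType R σ := by
  classical
  have hRτ : R.image τ = R := eq_of_subset_of_card_le
    (image_subset_iff.mpr fun x hx ↦ hR τ x hx) (card_image_of_injective _ τ.injective).ge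
  have hfilter (x : L) : (R.filter fun y ↦ ∃ k : ℤ, (σ ^ k) (τ x) = y) =
      (R.filter fun y ↦ ∃ k : ℤ, ((τ⁻¹ * σ * τ) ^ k) x = y).image τ := by
    conv_lhs => rw [← hRτ]
    rw [filter_image]
    refine congrArg _ (filter_congr fun y _ ↦ exists_congr fun k ↦ ?_)
    have : (τ⁻¹ * σ * τ) ^ k = τ⁻¹ * σ ^ k * τ := by
      simpa using conj_zpow (i := k) (a := τ⁻¹) (b := σ)
    rw [this, AlgEquiv.mul_apply, AlgEquiv.mul_apply]
    exact (AlgEquiv.symm_apply_eq τ).symm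
  rw [orbitType, orbitType]
  conv_rhs => enter [2, 1, 2]; rw [← hRτ]
  rw [image_image]
  refine map_val_image_eq R _ _ _ _ (fun x _ y _ ↦ ?_) fun x _ ↦ ?_
  · simp only [Function.comp]
    rw [hfilter, hfilter, (image_injective τ.injective).eq_iff]
  · simp only [Function.comp]
    rw [hfilter, card_image_of_injective _ τ.injective]

variable {f : ℤ[X]} {S : Finset (𝓞 L)}

theorem eq_one_of_forall_smul_sub_mem [(f.map (Int.castRingHom ℚ)).IsSplittingField ℚ L]
    (hS : f.map (Int.castRingHom (𝓞 L)) = ∏ r ∈ S, (X - C r))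
    (hSR : ∀ x : L, x ∈ (f.map (Int.castRingHom L)).roots ↔ ∃ r ∈ S, (r : L) = x)
    {Q : Ideal (𝓞 L)} (hQ : ∀ r ∈ S, ∀ s ∈ S, r - s ∈ Q → r = s) {g : L ≃ₐ[ℚ] L}
    (hg : ∀ x : 𝓞 L, g • x - x ∈ Q) : g = 1 := by
  classical
  have h1 : (g : L →ₐ[ℚ] L) = AlgHom.id ℚ L := by
    refine AlgHom.ext_of_adjoin_eq_top
      (IsSplittingField.adjoin_rootSet L (f.map (Int.castRingHom ℚ))) fun x hx ↦ ?_
    rw [rootSet, mem_coe, aroots, Polynomial.map_map, Multiset.mem_toFinset,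
      RingHom.ext_int ((algebraMap ℚ L).comp (Int.castRingHom ℚ)) (Int.castRingHom L), hSR] at hx
    obtain ⟨r, hr, rfl⟩ := hx
    exact congrArg (fun z : 𝓞 L ↦ (z : L))
      (hQ _ (smul_mem_integralRoots hS g hr) _ hr (hg r))
  exact AlgEquiv.ext fun x ↦ DFunLike.congr_fun h1 x

theorem tendsto_factorizationType [(f.map (Int.castRingHom ℚ)).IsSplittingField ℚ L]
    (hf : f.Monic) (hirr : Irreducible (f.map (Int.castRingHom ℚ))) {R : Finset L}
    (hR : ∀ x, x ∈ R ↔ x ∈ (f.map (Int.castRingHom L)).roots) (π : Multiset ℕ)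
    [DecidablePred fun p : ℕ ↦ Squarefree (f.map (Int.castRingHom (ZMod p))) ∧
      ∃ s : Multiset (ZMod p)[X], (∀ g ∈ s, g.Monic ∧ Irreducible g) ∧
        s.prod = f.map (Int.castRingHom (ZMod p)) ∧ s.map natDegree = π] :
    Tendsto (fun N : ℕ ↦ (((range (N + 1)).filter fun p ↦ p.Prime ∧
        Squarefree (f.map (Int.castRingHom (ZMod p))) ∧
        ∃ s : Multiset (ZMod p)[X], (∀ g ∈ s, g.Monic ∧ Irreducible g) ∧
          s.prod = f.map (Int.castRingHom (ZMod p)) ∧ s.map natDegree = π).card : ℝ) /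
        (((range (N + 1)).filter Nat.Prime).card : ℝ)) atTop
      (𝓝 ((Nat.card {σ : L ≃ₐ[ℚ] L // orbitType R σ = π} : ℝ) / Nat.card (L ≃ₐ[ℚ] L))) := by
  classical
  have := Fintype.ofFinite (L ≃ₐ[ℚ] L)
  have hcomp : (algebraMap ℚ L).comp (Int.castRingHom ℚ) = Int.castRingHom L :=
    RingHom.ext_int _ _
  have hsepQ : (f.map (Int.castRingHom ℚ)).Separable := hirr.separable
  have : IsGalois ℚ L := IsGalois.of_separable_splitting_field hsepQ
  have hsep : (f.map (Int.castRingHom L)).Separable := by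
    rw [← hcomp, ← Polynomial.map_map]
    exact hsepQ.map
  have hsplit : (f.map (Int.castRingHom L)).Splits := by
    rw [← hcomp, ← Polynomial.map_map]
    exact IsSplittingField.splits L (f.map (Int.castRingHom ℚ))
  obtain ⟨S, hS, hSR⟩ := exists_integralRoots hf hsep hsplit
  have hRS (x : L) : x ∈ R ↔ ∃ r ∈ S, (r : L) = x := (hR x).trans (hSR x)
  set Z := {p : ℕ | p.Prime ∧ ∃ Q : Ideal (𝓞 L), Q.IsPrime ∧ (p : 𝓞 L) ∈ Q ∧
    ∃ r ∈ S, ∃ s ∈ S, r ≠ s ∧ r - s ∈ Q} with hZdef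
  have hZ : Z.Finite := finite_setOf_sub_mem S
  have hfrob (p : ℕ) (hp : p.Prime) : ∃ σ : L ≃ₐ[ℚ] L, ∃ Q : Ideal (𝓞 L),
      Q.IsPrime ∧ (p : 𝓞 L) ∈ Q ∧ IsFrobenius p σ Q := by
    obtain ⟨Q, hQ, hpQ⟩ := exists_isPrime_natCast_mem (L := L) hp
    obtain ⟨σ, hσ⟩ := exists_isFrobenius_gal hp hpQ
    exact ⟨σ, Q, hQ, hpQ, hσ⟩
  choose! σ Q hQ hpQ hσ using hfrob
  have hQS (p : ℕ) (hp : p.Prime) (hpZ : p ∉ Z) : ∀ r ∈ S, ∀ s ∈ S, r - s ∈ Q p → r = s := by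
    intro r hr s hs h
    by_contra hne
    exact hpZ ⟨hp, Q p, hQ p hp, hpQ p hp, r, hr, s, hs, hne, h⟩
  have hRg (g : L ≃ₐ[ℚ] L) (x : L) (hx : x ∈ R) : g x ∈ R := by
    obtain ⟨r, hr, rfl⟩ := (hRS x).mp hx
    exact (hRS _).mpr ⟨g • r, smul_mem_integralRoots hS g hr, rfl⟩
  have hmain := tendsto_sum_frobenius_div_card (L := L) (σ := σ) hZ
    (fun p hp hpZ ↦ ⟨Q p, hQ p hp, hpQ p hp, hσ p hp, fun g hg ↦
      eq_one_of_forall_smul_sub_mem hS hSR (hQS p hp hpZ) hg⟩)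
    (F := fun g ↦ if orbitType R g = π then 1 else 0)
    (fun g τ ↦ by simp only [orbitType_conj hRg])
    (fun g τ h ↦ by simp only [orbitType_eq_of_zpowers_eq R h])
    (a := fun p ↦ if Squarefree (f.map (Int.castRingHom (ZMod p))) ∧
      ∃ s : Multiset (ZMod p)[X], (∀ g ∈ s, g.Monic ∧ Irreducible g) ∧
        s.prod = f.map (Int.castRingHom (ZMod p)) ∧ s.map natDegree = π then 1 else 0) (B := 1)
    (fun p ↦ by split_ifs <;> simp) fun p hp hpZ ↦ by
      have := hQ p hp
      simp only [factorizationType_iff hf hp (hpQ p hp) (hσ p hp) hS (hQS p hp hpZ) hRS]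
  rw [finsum_eq_sum_of_fintype, sum_boole] at hmain
  rw [Nat.card_eq_fintype_card, Fintype.card_subtype]
  refine hmain.congr fun N ↦ ?_
  rw [sum_boole, filter_filter]

end CycleTypes

end FrobeniusDensity

open scoped Classical

/-- **Chebotarev density theorem for factorization types.** Let `f ∈ ℤ[X]` be monic of
degree `n ≥ 1` and irreducible over `ℚ`, let `L` be the splitting field of `f` over `ℚ`,
and let `G = Gal(L/ℚ)` act on the set `R` of roots of `f` in `L`.  For a multiset `π` of
positive integers summing to `n`, let `c_π` be the proportion of `σ ∈ G` whose multiset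
of orbit sizes on `R` (under the cyclic group generated by `σ`) equals `π`.  Then the
natural density of the primes `p` such that `f mod p` is squarefree and the multiset of
degrees of its monic irreducible factors over `ℤ/pℤ` equals `π` exists and equals
`c_π`. -/
theorem chebotarev_cycle_types (f : Polynomial ℤ) (hf : f.Monic) (n : ℕ) (hn : 1 ≤ n)
    (hdeg : f.natDegree = n) (hirr : Irreducible (f.map (Int.castRingHom ℚ)))
    (π : Multiset ℕ) (hπ : ∀ k ∈ π, 0 < k) (hsum : π.sum = n) :
    Filter.Tendsto
      (fun N : ℕ =>
        (((Finset.range (N + 1)).filter (fun p : ℕ => p.Prime ∧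
            Squarefree (f.map (Int.castRingHom (ZMod p))) ∧
            ∃ s : Multiset (Polynomial (ZMod p)),
              (∀ g ∈ s, Polynomial.Monic g ∧ Irreducible g) ∧
              s.prod = f.map (Int.castRingHom (ZMod p)) ∧
              s.map Polynomial.natDegree = π)).card : ℝ) /
          (((Finset.range (N + 1)).filter Nat.Prime).card : ℝ))
      Filter.atTop
      (nhds
        ((Nat.card {σ : (f.map (Int.castRingHom ℚ)).SplittingField ≃ₐ[ℚ]
              (f.map (Int.castRingHom ℚ)).SplittingField //
            letI L := (f.map (Int.castRingHom ℚ)).SplittingField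
            letI R : Finset L := (f.map (Int.castRingHom L)).roots.toFinset
            ((R.image (fun x => R.filter (fun y => ∃ k : ℤ, (σ ^ k) x = y))).val.map
              Finset.card) = π} : ℝ) /
          (Nat.card ((f.map (Int.castRingHom ℚ)).SplittingField ≃ₐ[ℚ]
            (f.map (Int.castRingHom ℚ)).SplittingField) : ℝ))) := by
  have key (L : Type) [Field L] [CharZero L] {alg : Algebra ℚ L}
      (hL : (f.map (Int.castRingHom ℚ)).IsSplittingField ℚ L) {R : Finset L}
      (hR : ∀ x, x ∈ R ↔ x ∈ (f.map (Int.castRingHom L)).roots) :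
      Filter.Tendsto
        (fun N : ℕ =>
          (((Finset.range (N + 1)).filter (fun p : ℕ => p.Prime ∧
              Squarefree (f.map (Int.castRingHom (ZMod p))) ∧
              ∃ s : Multiset (Polynomial (ZMod p)),
                (∀ g ∈ s, Polynomial.Monic g ∧ Irreducible g) ∧
                s.prod = f.map (Int.castRingHom (ZMod p)) ∧
                s.map Polynomial.natDegree = π)).card : ℝ) /
            (((Finset.range (N + 1)).filter Nat.Prime).card : ℝ))
        Filter.atTop
        (nhds ((Nat.card {σ : L ≃ₐ[ℚ] L //
          ((R.image (fun x => R.filter (fun y => ∃ k : ℤ, (σ ^ k) x = y))).val.map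
            Finset.card) = π} : ℝ) / (Nat.card (L ≃ₐ[ℚ] L) : ℝ))) := by
    obtain rfl : alg = DivisionRing.toRatAlgebra := Subsingleton.elim _ _
    have : NumberField L :=
      { to_finiteDimensional :=
          Polynomial.IsSplittingField.finiteDimensional L (f.map (Int.castRingHom ℚ)) }
    exact FrobeniusDensity.tendsto_factorizationType hf hirr hR π
  exact key _ (Polynomial.IsSplittingField.splittingField _) fun x ↦ Multiset.mem_toFinset
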